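/- Let ℓ be a prime integer and let K/k be a Galois extension of number fields with Gal(K/k) cyclic of order ℓ. Let t be the number of primes of k, finite or infinite, which ramify in K. Then rank_{ℤ/ℓℤ}(Cl_K / ℓ·Cl_K) ≤ ℓ·( rank_{ℤ/ℓℤ}(Cl_k / ℓ·Cl_k) + max{0, t − 1} ). -/

import Mathlib

open NumberField IsDedekindDomain

/-- The `ℓ`-rank `rank_{ℤ/ℓℤ}(G/ℓG)` of the finite abelian group `G`: since `G/Gˡ` is an
elementary abelian `ℓ`-group, its order is exactly `ℓ ^ rank`, so the rank is `log_ℓ` of the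
order of the quotient of `G` by the subgroup of `ℓ`-th powers. -/
noncomputable def ellRank (ℓ : ℕ) (G : Type*) [CommGroup G] : ℕ :=
  Nat.log ℓ (Nat.card (G ⧸ (powMonoidHom ℓ : G →* G).range))

set_option linter.all false

namespace GenusRank

open NumberField.Units NumberField.Units.dirichletUnitTheorem

/-- tent function -/
noncomputable def tent (x : ℝ) : ℝ := max 0 (1 - |x|)

lemma tent_nonneg (x : ℝ) : 0 ≤ tent x := le_max_left _ _

lemma tent_le_one (x : ℝ) : tent x ≤ 1 := by
  unfold tent
  have := abs_nonneg x
  exact max_le (by norm_num) (by linarith)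

lemma abs_tent_sub_le (x y : ℝ) : |tent x - tent y| ≤ |x - y| := by
  unfold tent
  refine (abs_max_sub_max_le_max 0 (1 - |x|) 0 (1 - |y|)).trans ?_
  have h1 : |(1 - |x|) - (1 - |y|)| ≤ |x - y| := by
    rw [show (1 - |x|) - (1 - |y|) = |y| - |x| by ring, abs_sub_comm x y]
    exact abs_abs_sub_abs_le _ _
  simpa using h1

lemma abs_lt_one_of_tent_ne_zero {x : ℝ} (h : tent x ≠ 0) : |x| < 1 := by
  by_contra hx
  exact h (max_eq_left (by linarith))

lemma tent_sum (x : ℝ) : ∑ z ∈ ({⌊-x⌋, ⌊-x⌋ + 1} : Finset ℤ), tent (x + z) = 1 := by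
  rw [Finset.sum_pair (by omega)]
  have h1 := Int.floor_le (-x)
  have h2 := Int.lt_floor_add_one (-x)
  push_cast
  unfold tent
  rw [abs_of_nonpos (by linarith), abs_of_nonneg (by linarith), max_eq_right (by linarith),
    max_eq_right (by linarith)]
  ring

lemma tent_eq_zero_of_notMem (x : ℝ) (z : ℤ) (hz : z ∉ ({⌊-x⌋, ⌊-x⌋ + 1} : Finset ℤ)) :
    tent (x + z) = 0 := by
  by_contra h
  have h := abs_lt.1 (abs_lt_one_of_tent_ne_zero h)
  apply hz
  simp only [Finset.mem_insert, Finset.mem_singleton]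
  have h1 := Int.floor_le (-x)
  have h2 := Int.lt_floor_add_one (-x)
  have h3 : (z : ℝ) < ⌊-x⌋ + 1 + 1 := by linarith
  have h4 : (⌊-x⌋ : ℝ) < z + 1 := by linarith
  have h5 : z < ⌊-x⌋ + 1 + 1 := by exact_mod_cast h3
  have h6 : ⌊-x⌋ < z + 1 := by exact_mod_cast h4
  omega

lemma hasSum_prod_tent {r : ℕ} (ξ : Fin r → ℝ) :
    HasSum (fun z : Fin r → ℤ => ∏ i, tent (ξ i + z i)) 1 := by
  classical
  have h : ∑ z ∈ Fintype.piFinset (fun i => ({⌊-ξ i⌋, ⌊-ξ i⌋ + 1} : Finset ℤ)),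
      ∏ i, tent (ξ i + z i) = 1 := by
    rw [← Finset.prod_univ_sum (fun i => ({⌊-ξ i⌋, ⌊-ξ i⌋ + 1} : Finset ℤ))
      (fun i z => tent (ξ i + z))]
    exact Finset.prod_eq_one fun i _ => tent_sum _
  rw [← h]
  apply hasSum_sum_of_ne_finset_zero
  intro z hz
  simp only [Fintype.mem_piFinset, not_forall] at hz
  obtain ⟨i, hi⟩ := hz
  exact Finset.prod_eq_zero (Finset.mem_univ i) (tent_eq_zero_of_notMem _ _ hi)

lemma abs_prod_sub_prod_le {ι : Type*} (s : Finset ι) (a b : ι → ℝ)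
    (ha : ∀ i, 0 ≤ a i) (ha' : ∀ i, a i ≤ 1) (hb : ∀ i, 0 ≤ b i) (hb' : ∀ i, b i ≤ 1) :
    |∏ i ∈ s, a i - ∏ i ∈ s, b i| ≤ ∑ i ∈ s, |a i - b i| := by
  classical
  induction s using Finset.induction_on with
  | empty => simp
  | insert j s hj ih =>
    rw [Finset.prod_insert hj, Finset.prod_insert hj, Finset.sum_insert hj]
    have e : a j * ∏ i ∈ s, a i - b j * ∏ i ∈ s, b i =
      (a j - b j) * ∏ i ∈ s, a i + b j * (∏ i ∈ s, a i - ∏ i ∈ s, b i) := by ring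
    rw [e]
    refine (abs_add_le _ _).trans (add_le_add ?_ ?_)
    · rw [abs_mul]
      refine mul_le_of_le_one_right (abs_nonneg _) ?_
      rw [abs_of_nonneg (Finset.prod_nonneg fun i _ => ha i)]
      exact Finset.prod_le_one (fun i _ => ha i) (fun i _ => ha' i)
    · rw [abs_mul, abs_of_nonneg (hb j)]
      exact (mul_le_of_le_one_left (abs_nonneg _) (hb' j)).trans ih

variable (K : Type*) [Field K] [NumberField K]

open scoped Classical in
/-- real basis of the log space given by the fundamental units -/
noncomputable def logBasis : Module.Basis (Fin (rank K)) ℝ (logSpace K) :=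
  (basisUnitLattice K).ofZLatticeBasis ℝ (unitLattice K)

/-- coordinates of the logarithmic embedding -/
noncomputable def xi (x : K) (i : Fin (rank K)) : ℝ :=
  (logBasis K).repr (mixedEmbedding.logMap (mixedEmbedding K x)) i

/-- weight -/
noncomputable def wt (x : K) : ℝ := ∏ i, tent (xi K x i)

lemma wt_nonneg (x : K) : 0 ≤ wt K x := Finset.prod_nonneg fun _ _ => tent_nonneg _

lemma wt_le_one (x : K) : wt K x ≤ 1 :=
  Finset.prod_le_one (fun _ _ => tent_nonneg _) fun _ _ => tent_le_one _

lemma norm_mixed_ne_zero {x : K} (hx : x ≠ 0) :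
    mixedEmbedding.norm (mixedEmbedding K x) ≠ 0 := by
  rw [mixedEmbedding.norm_eq_norm]
  simpa using hx

lemma xi_unit_mul (ζ : torsion K) (z : Fin (rank K) → ℤ) {x : K} (hx : x ≠ 0) (i : Fin (rank K)) :
    xi K ((((ζ : (𝓞 K)ˣ) * ∏ i, fundSystem K i ^ z i : (𝓞 K)ˣ) : K) * x) i = xi K x i + z i := by
  unfold xi
  rw [map_mul, mixedEmbedding.logMap_mul (norm_mixed_ne_zero K (coe_ne_zero _)) (norm_mixed_ne_zero K hx)]
  rw [mixedEmbedding.logMap_eq_logEmbedding]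
  have : logEmbedding K (Additive.ofMul ((ζ : (𝓞 K)ˣ) * ∏ i, fundSystem K i ^ z i : (𝓞 K)ˣ)) =
      ∑ j, (z j : ℝ) • logBasis K j := by
    rw [ofMul_mul, map_add, logEmbedding_eq_zero_iff.2 ζ.2, zero_add, ofMul_prod, map_sum]
    refine Finset.sum_congr rfl fun j _ => ?_
    rw [ofMul_zpow, map_zsmul, logEmbedding_fundSystem, logBasis,
      Module.Basis.ofZLatticeBasis_apply, Int.cast_smul_eq_zsmul]
  rw [this, map_add, Finsupp.add_apply, add_comm]
  congr 1
  rw [(logBasis K).repr_sum_self]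

lemma exists_unitsEquiv : ∃ e : torsion K × (Fin (rank K) → ℤ) ≃ (𝓞 K)ˣ,
    ∀ p, e p = (p.1 : (𝓞 K)ˣ) * ∏ i, fundSystem K i ^ p.2 i := by
  have he : Function.Bijective (fun p : torsion K × (Fin (rank K) → ℤ) =>
      (p.1 : (𝓞 K)ˣ) * ∏ i, fundSystem K i ^ p.2 i) := by
    rw [Function.bijective_iff_existsUnique]
    intro u
    obtain ⟨p, hp, hp'⟩ := exist_unique_eq_mul_prod K u
    exact ⟨p, hp.symm, fun q hq => hp' q hq.symm⟩
  exact ⟨Equiv.ofBijective _ he, fun p => rfl⟩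

lemma hasSum_const_one (T : Type*) [Finite T] : HasSum (fun _ : T => (1:ℝ)) (Nat.card T) := by
  have := Fintype.ofFinite T
  convert hasSum_fintype (fun _ : T => (1:ℝ))
  simp [Nat.card_eq_fintype_card]

lemma wt_unit_mul (ζ : torsion K) (z : Fin (rank K) → ℤ) {x : K} (hx : x ≠ 0) :
    wt K ((((ζ : (𝓞 K)ˣ) * ∏ i, fundSystem K i ^ z i : (𝓞 K)ˣ) : K) * x) =
      ∏ i, tent (xi K x i + z i) :=
  Finset.prod_congr rfl fun i _ => by rw [xi_unit_mul K ζ z hx]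

lemma hasSum_mul_aux {S T : Type*} [Finite S] {f : T → ℝ} (hf : ∀ t, 0 ≤ f t) (h : HasSum f 1) :
    HasSum (fun p : S × T => f p.2) (Nat.card S) := by
  have h1 := hasSum_const_one S
  have h3 := h1.mul h (h1.summable.mul_of_nonneg h.summable (fun _ => zero_le_one) hf)
  simpa using h3

lemma hasSum_wt {x : K} (hx : x ≠ 0) :
    HasSum (fun u : (𝓞 K)ˣ => wt K ((u : K) * x)) (Nat.card (torsion K) : ℝ) := by
  obtain ⟨e, he⟩ := exists_unitsEquiv K
  rw [← e.hasSum_iff]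
  have : ((fun u : (𝓞 K)ˣ => wt K ((u : K) * x)) ∘ e) =
      fun p : torsion K × (Fin (rank K) → ℤ) => ∏ i, tent (xi K x i + p.2 i) := by
    funext p
    rw [Function.comp_apply, he, wt_unit_mul K p.1 p.2 hx]
  rw [this]
  exact hasSum_mul_aux (S := torsion K) (T := Fin (rank K) → ℤ)
    (f := fun z => ∏ i, tent (xi K x i + z i)) (fun z => Finset.prod_nonneg fun _ _ => tent_nonneg _)
    (hasSum_prod_tent (xi K x))

end GenusRank

namespace GenusRank

open NumberField.Units NumberField.Units.dirichletUnitTheorem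

variable (K : Type*) [Field K] [NumberField K]

open scoped Classical in
/-- sup of the absolute values of `x` at infinite places -/
noncomputable def nrm (x : K) : ℝ := ‖mixedEmbedding K x‖

lemma place_le_nrm (v : InfinitePlace K) (x : K) : v x ≤ nrm K x := by
  rw [nrm, mixedEmbedding.norm_eq_sup'_normAtPlace, ← mixedEmbedding.normAtPlace_apply]
  exact Finset.le_sup' (fun w => mixedEmbedding.normAtPlace w (mixedEmbedding K x))
    (Finset.mem_univ v)

lemma exists_place_eq_nrm (x : K) : ∃ v : InfinitePlace K, v x = nrm K x := by
  rw [nrm, mixedEmbedding.norm_eq_sup'_normAtPlace]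
  obtain ⟨v, -, hv⟩ := Finset.exists_mem_eq_sup' (s := (Finset.univ : Finset (InfinitePlace K)))
    Finset.univ_nonempty (fun w => mixedEmbedding.normAtPlace w (mixedEmbedding K x))
  exact ⟨v, by rw [hv, mixedEmbedding.normAtPlace_apply]⟩

lemma nrm_add_le (x y : K) : nrm K (x + y) ≤ nrm K x + nrm K y := by
  classical
  unfold nrm; rw [map_add]; apply norm_add_le

lemma nrm_sub_comm (x y : K) : nrm K (x - y) = nrm K (y - x) := by
  classical
  unfold nrm; rw [map_sub, map_sub]; apply norm_sub_rev

lemma nrm_pos {x : K} (hx : x ≠ 0) : 0 < nrm K x := by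
  obtain ⟨v, hv⟩ := exists_place_eq_nrm K x
  rw [← hv]
  exact InfinitePlace.pos_iff.2 hx

/-- absolute norm as a real number -/
noncomputable def absN (x : K) : ℝ := |((Algebra.norm ℚ x : ℚ) : ℝ)|

lemma absN_eq_prod (x : K) : absN K x = ∏ v : InfinitePlace K, v x ^ v.mult := by
  rw [InfinitePlace.prod_eq_abs_norm, absN, Rat.cast_abs]

lemma absN_pos {x : K} (hx : x ≠ 0) : 0 < absN K x := by
  rw [absN, abs_pos]
  simpa using hx

lemma one_le_absN {x : 𝓞 K} (hx : x ≠ 0) : 1 ≤ absN K x := by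
  rw [absN, ← Algebra.coe_norm_int]
  have : Algebra.norm ℤ x ≠ 0 := by simpa using hx
  have := Int.one_le_abs this
  push_cast
  exact_mod_cast this

lemma log_absN {x : K} (hx : x ≠ 0) :
    Real.log (absN K x) = ∑ v : InfinitePlace K, v.mult * Real.log (v x) := by
  rw [absN_eq_prod, Real.log_prod]
  · simp [Real.log_pow]
  · intro v _
    exact pow_ne_zero _ (InfinitePlace.pos_iff.2 hx).ne'

lemma logMap_eq (x : K) (w : {w : InfinitePlace K // w ≠ w₀}) :
    mixedEmbedding.logMap (mixedEmbedding K x) w = w.1.mult * (Real.log (w.1 x) -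
      Real.log (absN K x) * (Module.finrank ℚ K : ℝ)⁻¹) := by
  rw [mixedEmbedding.logMap_apply, mixedEmbedding.normAtPlace_apply, mixedEmbedding.norm_eq_norm,
    absN, Rat.cast_abs]

lemma sum_mult_real : ∑ v : InfinitePlace K, (v.mult : ℝ) = Module.finrank ℚ K := by
  exact_mod_cast InfinitePlace.sum_mult_eq (K := K)

lemma finrank_pos_real : (0 : ℝ) < Module.finrank ℚ K := by
  exact_mod_cast Module.finrank_pos (R := ℚ) (M := K)

lemma one_le_mult_real (v : InfinitePlace K) : (1 : ℝ) ≤ v.mult := by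
  exact_mod_cast Nat.one_le_iff_ne_zero.2 InfinitePlace.mult_ne_zero

lemma mult_le_two (v : InfinitePlace K) : (v.mult : ℝ) ≤ 2 := by
  unfold InfinitePlace.mult
  split_ifs <;> norm_num

lemma exists_comparable : ∃ c : ℝ, 0 < c ∧ ∀ x : K, x ≠ 0 → wt K x ≠ 0 →
    ∀ v : InfinitePlace K, c * nrm K x ≤ v x := by
  classical
  obtain ⟨C, hC0, hC⟩ : ∃ C : ℝ, 0 ≤ C ∧ ∀ x : K, wt K x ≠ 0 →
      ‖mixedEmbedding.logMap (mixedEmbedding K x)‖ ≤ C := by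
    refine ⟨∑ i, ‖logBasis K i‖, Finset.sum_nonneg fun _ _ => norm_nonneg _, fun x hx => ?_⟩
    rw [← (logBasis K).sum_repr (mixedEmbedding.logMap (mixedEmbedding K x))]
    refine (norm_sum_le _ _).trans (Finset.sum_le_sum fun i _ => ?_)
    rw [norm_smul]
    refine mul_le_of_le_one_left (norm_nonneg _) ?_
    rw [wt, Finset.prod_ne_zero_iff] at hx
    exact (abs_lt_one_of_tent_ne_zero (hx i (Finset.mem_univ i))).le
  set C' : ℝ := (Fintype.card (InfinitePlace K)) * C + C with hC'
  have hCC : C ≤ C' := by rw [hC']; have : 0 ≤ (Fintype.card (InfinitePlace K) : ℝ) * C := by positivity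
                          linarith
  have key : ∀ x : K, x ≠ 0 → wt K x ≠ 0 → ∀ v : InfinitePlace K,
      |Real.log (v x) - Real.log (absN K x) * (Module.finrank ℚ K : ℝ)⁻¹| ≤ C' := by
    intro x hx hw
    set A := Real.log (absN K x) * (Module.finrank ℚ K : ℝ)⁻¹ with hA
    have h1 : ∀ v : InfinitePlace K, v ≠ w₀ → |v.mult * (Real.log (v x) - A)| ≤ C := by
      intro v hv
      have := (norm_le_pi_norm (mixedEmbedding.logMap (mixedEmbedding K x)) ⟨v, hv⟩).trans (hC x hw)
      rwa [logMap_eq, Real.norm_eq_abs] at this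
    have hm : ∀ v : InfinitePlace K, |Real.log (v x) - A| ≤ |v.mult * (Real.log (v x) - A)| := by
      intro v
      rw [abs_mul, abs_of_nonneg (by positivity : (0:ℝ) ≤ v.mult)]
      exact le_mul_of_one_le_left (abs_nonneg _) (one_le_mult_real K v)
    intro v
    by_cases hv : v = w₀
    · refine (hm v).trans ?_
      have hs : ∑ v : InfinitePlace K, v.mult * (Real.log (v x) - A) = 0 := by
        simp_rw [mul_sub, Finset.sum_sub_distrib, ← Finset.sum_mul]
        rw [← log_absN K hx, sum_mult_real, hA]
        have := finrank_pos_real K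
        field_simp
        ring
      rw [← Finset.add_sum_erase _ _ (Finset.mem_univ v)] at hs
      rw [eq_neg_of_add_eq_zero_left hs, abs_neg]
      refine (Finset.abs_sum_le_sum_abs _ _).trans ?_
      calc _ ≤ ∑ w ∈ Finset.univ.erase v, C := Finset.sum_le_sum fun w hw' => h1 w (by
              rw [← hv]; exact Finset.ne_of_mem_erase hw')
        _ ≤ ∑ w : InfinitePlace K, C :=
              Finset.sum_le_sum_of_subset_of_nonneg (Finset.erase_subset _ _) (fun _ _ _ => hC0)
        _ ≤ C' := by simp [hC']; exact hC0
    · exact ((hm v).trans (h1 v hv)).trans hCC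
  refine ⟨Real.exp (-(2 * C')), Real.exp_pos _, fun x hx hw v => ?_⟩
  obtain ⟨v', hv'⟩ := exists_place_eq_nrm K x
  have h1 := abs_le.1 (key x hx hw v)
  have h2 := abs_le.1 (key x hx hw v')
  have p1 : 0 < v x := InfinitePlace.pos_iff.2 hx
  have p2 : 0 < v' x := InfinitePlace.pos_iff.2 hx
  rw [← hv', ← Real.exp_log p2, ← Real.exp_add, ← Real.exp_log p1]
  apply Real.exp_le_exp.2
  linarith [h1.1, h2.2]

lemma abs_log_absN_sub_le {x y : K} (hx : x ≠ 0) (hy : y ≠ 0) {δ : ℝ}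
    (h : ∀ v : InfinitePlace K, |Real.log (v x) - Real.log (v y)| ≤ δ) :
    |Real.log (absN K x) - Real.log (absN K y)| ≤ Module.finrank ℚ K * δ := by
  rw [log_absN K hx, log_absN K hy, ← Finset.sum_sub_distrib, ← sum_mult_real, Finset.sum_mul]
  refine (Finset.abs_sum_le_sum_abs _ _).trans (Finset.sum_le_sum fun v _ => ?_)
  rw [← mul_sub, abs_mul, abs_of_nonneg (by positivity : (0:ℝ) ≤ v.mult)]
  exact mul_le_mul_of_nonneg_left (h v) (by positivity)

lemma exists_wt_lipschitz : ∃ C : ℝ, 0 ≤ C ∧ ∀ x y : K, x ≠ 0 → y ≠ 0 → ∀ δ : ℝ, 0 ≤ δ →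
    (∀ v : InfinitePlace K, |Real.log (v x) - Real.log (v y)| ≤ δ) →
    |wt K x - wt K y| ≤ C * δ := by
  classical
  let f : Fin (rank K) → (logSpace K →L[ℝ] ℝ) := fun i =>
    LinearMap.toContinuousLinearMap ((logBasis K).coord i)
  refine ⟨(∑ i, ‖f i‖) * 4, by positivity, fun x y hx hy δ hδ h => ?_⟩
  have hn := finrank_pos_real K
  have hA : |Real.log (absN K x) * (Module.finrank ℚ K : ℝ)⁻¹ -
      Real.log (absN K y) * (Module.finrank ℚ K : ℝ)⁻¹| ≤ δ := by
    rw [← sub_mul, abs_mul, abs_of_pos (inv_pos.2 hn), ← div_eq_mul_inv, div_le_iff₀ hn, mul_comm]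
    exact abs_log_absN_sub_le K hx hy h
  have hlog : ‖mixedEmbedding.logMap (mixedEmbedding K x) -
      mixedEmbedding.logMap (mixedEmbedding K y)‖ ≤ 4 * δ := by
    rw [pi_norm_le_iff_of_nonneg (by positivity)]
    intro w
    rw [Pi.sub_apply, logMap_eq, logMap_eq, ← mul_sub, Real.norm_eq_abs, abs_mul,
      abs_of_nonneg (by positivity : (0:ℝ) ≤ w.1.mult)]
    have h1 := abs_le.1 (h w.1)
    have h2 := abs_le.1 hA
    calc _ ≤ 2 * (2 * δ) := by
          refine mul_le_mul (mult_le_two K _) ?_ (abs_nonneg _) (by norm_num)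
          rw [abs_le]
          constructor <;> linarith [h1.1, h1.2, h2.1, h2.2]
      _ = 4 * δ := by ring
  refine (abs_prod_sub_prod_le _ _ _ (fun _ => tent_nonneg _) (fun _ => tent_le_one _)
    (fun _ => tent_nonneg _) (fun _ => tent_le_one _)).trans ?_
  rw [mul_assoc, Finset.sum_mul]
  refine Finset.sum_le_sum fun i _ => (abs_tent_sub_le _ _).trans ?_
  have : xi K x i - xi K y i = f i (mixedEmbedding.logMap (mixedEmbedding K x) -
      mixedEmbedding.logMap (mixedEmbedding K y)) := by
    rw [map_sub]; rfl
  rw [this, ← Real.norm_eq_abs]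
  exact (ContinuousLinearMap.le_opNorm _ _).trans (mul_le_mul_of_nonneg_left hlog (norm_nonneg _))

lemma abs_log_sub_le {a b δ : ℝ} (ha : 0 < a) (hδ : 0 ≤ δ) (hδ' : δ ≤ 1 / 2)
    (h : |a - b| ≤ δ * a) : 0 < b ∧ |Real.log a - Real.log b| ≤ 2 * δ := by
  have h1 := abs_le.1 h
  have hb : a / 2 ≤ b := by nlinarith [h1.2]
  have hb0 : 0 < b := by linarith
  refine ⟨hb0, ?_⟩
  have e1 : Real.log a - Real.log b ≤ a / b - 1 := by
    rw [← Real.log_div ha.ne' hb0.ne']; exact Real.log_le_sub_one_of_pos (by positivity)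
  have e2 : Real.log b - Real.log a ≤ b / a - 1 := by
    rw [← Real.log_div hb0.ne' ha.ne']; exact Real.log_le_sub_one_of_pos (by positivity)
  have e3 : a / b - 1 ≤ 2 * δ := by
    rw [sub_le_iff_le_add, div_le_iff₀ hb0]; nlinarith [h1.2]
  have e4 : b / a - 1 ≤ 2 * δ := by
    rw [sub_le_iff_le_add, div_le_iff₀ ha]; nlinarith [h1.1]
  rw [abs_le]; constructor <;> linarith

lemma norm_pos_of_close {x y : K} (hx : x ≠ 0) {δ : ℝ}
    (hδ : Module.finrank ℚ K * δ ≤ 1 / 4)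
    (h : ∀ v : InfinitePlace K, v (x - y) ≤ δ * v x) :
    0 < Algebra.norm ℚ x * Algebra.norm ℚ y := by
  have hxn : Algebra.norm ℚ x ≠ 0 := by simpa using hx
  have key : 0 < Algebra.norm ℚ (y / x) := by
    have h1 : ‖((Algebra.norm ℚ (y / x) : ℚ) : ℂ) - 1‖ ≤ Real.exp (1 / 4) - 1 := by
      have e : ((Algebra.norm ℚ (y / x) : ℚ) : ℂ) =
          ∏ σ : K →ₐ[ℚ] ℂ, (1 + σ ((y - x) / x)) := by
        have := Algebra.norm_eq_prod_embeddings ℚ ℂ (y / x)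
        rw [eq_ratCast] at this
        rw [this]
        refine Finset.prod_congr rfl fun σ _ => ?_
        rw [sub_div, div_self hx, map_sub, map_one]; ring
      rw [e]
      refine (Finset.norm_prod_one_add_sub_one_le _ _).trans ?_
      refine sub_le_sub_right (Real.exp_le_exp.2 ?_) _
      refine le_trans ?_ hδ
      have : ∀ σ : K →ₐ[ℚ] ℂ, ‖σ ((y - x) / x)‖ ≤ δ := by
        intro σ
        have h2 := h (InfinitePlace.mk (σ : K →+* ℂ))
        rw [InfinitePlace.apply, InfinitePlace.apply, ← neg_sub, map_neg, norm_neg] at h2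
        rw [map_div₀, norm_div, div_le_iff₀ (by simpa using hx)]
        exact h2
      refine (Finset.sum_le_sum fun σ _ => this σ).trans ?_
      rw [Finset.sum_const, Finset.card_univ, AlgHom.card, nsmul_eq_mul]
    have h3 : Real.exp (1 / 4) - 1 < 1 := by
      have : Real.exp (1/4) < Real.exp (1/2) := Real.exp_lt_exp.2 (by norm_num)
      have h4 : Real.exp (1/2) * Real.exp (1/2) < 2.7182818286 := by
        rw [← Real.exp_add, show (1/2 + 1/2 : ℝ) = 1 by norm_num]; exact Real.exp_one_lt_d9
      have := Real.exp_pos (1/2)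
      nlinarith
    have h5 := h1.trans_lt h3
    have h6 : ((Algebra.norm ℚ (y / x) : ℚ) : ℂ) - 1 =
        (((Algebra.norm ℚ (y / x) : ℚ) : ℝ) - 1 : ℝ) := by push_cast; rfl
    rw [h6, Complex.norm_real, Real.norm_eq_abs, abs_lt] at h5
    have : (0:ℝ) < (Algebra.norm ℚ (y / x) : ℚ) := by linarith [h5.1]
    exact_mod_cast this
  have : Algebra.norm ℚ x * Algebra.norm ℚ y =
      Algebra.norm ℚ x ^ 2 * Algebra.norm ℚ (y / x) := by
    rw [show Algebra.norm ℚ y = Algebra.norm ℚ x * Algebra.norm ℚ (y / x) by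
      rw [← map_mul, mul_div_cancel₀ _ hx]]
    ring
  rw [this]
  positivity


lemma absN_ge {c : ℝ} (hc : 0 < c) {x : K} (h : ∀ v : InfinitePlace K, c * nrm K x ≤ v x) :
    (c * nrm K x) ^ Module.finrank ℚ K ≤ absN K x := by
  have h0 : 0 ≤ nrm K x := by classical exact norm_nonneg _
  rw [absN_eq_prod, ← InfinitePlace.sum_mult_eq, ← Finset.prod_pow_eq_pow_sum]
  exact Finset.prod_le_prod (fun v _ => by positivity)
    fun v _ => pow_le_pow_left₀ (by positivity) (h v) _

lemma exists_lip_half (R : ℝ) (hR : 0 ≤ R) : ∃ C : ℝ, 0 ≤ C ∧ ∀ x y : 𝓞 K, x ≠ 0 → y ≠ 0 →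
    nrm K ((x : K) - y) ≤ R → ∀ s : ℝ, 1 < s → s ≤ 2 → ∀ a b : ℂ, ‖a‖ ≤ 1 → ‖b‖ ≤ 1 →
    (0 < Algebra.norm ℤ x * Algebra.norm ℤ y → a = b) → wt K x ≠ 0 →
    ‖a * ((wt K x * absN K x ^ (-s) : ℝ) : ℂ) - b * ((wt K y * absN K y ^ (-s) : ℝ) : ℂ)‖ ≤
      C * (nrm K x ^ (Module.finrank ℚ K + 1))⁻¹ := by
  obtain ⟨c, hc, hcomp⟩ := exists_comparable K
  obtain ⟨C₀, hC₀, hlip⟩ := exists_wt_lipschitz K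
  set n := Module.finrank ℚ K with hn
  have hn0 : 0 < n := Module.finrank_pos
  have hn1 : (1 : ℝ) ≤ n := by exact_mod_cast hn0
  set R₁ : ℝ := 4 * n * R / c with hR₁
  have hR₁0 : 0 ≤ R₁ := by positivity
  refine ⟨2 * R₁ ^ (n + 1) + (2 * C₀ + 8 * n) * (R / c) * (c ^ n)⁻¹, by positivity, ?_⟩
  intro x y hx hy hxy s hs1 hs2 a b ha hb hab hw
  have hx' : (x : K) ≠ 0 := by simpa using hx
  have hy' : (y : K) ≠ 0 := by simpa using hy
  have hpos := nrm_pos K hx'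
  have hNx := one_le_absN K hx
  have hNy := one_le_absN K hy
  have hcx := hcomp x hx' hw
  have t1 : ∀ z : 𝓞 K, z ≠ 0 → 0 ≤ wt K z * absN K z ^ (-s) ∧ wt K z * absN K z ^ (-s) ≤ 1 := by
    intro z hz
    have h1 := one_le_absN K hz
    refine ⟨mul_nonneg (wt_nonneg K _) (Real.rpow_nonneg (by linarith) _), ?_⟩
    exact mul_le_one₀ (wt_le_one K _) (Real.rpow_nonneg (by linarith) _)
      (Real.rpow_le_one_of_one_le_of_nonpos h1 (by linarith))
  rcases lt_or_ge (nrm K (x : K)) R₁ with hlt | hge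
  · have h2 : ‖a * ((wt K x * absN K x ^ (-s) : ℝ) : ℂ) -
        b * ((wt K y * absN K y ^ (-s) : ℝ) : ℂ)‖ ≤ 2 := by
      refine (norm_sub_le _ _).trans ?_
      rw [norm_mul, norm_mul, Complex.norm_real, Complex.norm_real, Real.norm_of_nonneg (t1 x hx).1,
        Real.norm_of_nonneg (t1 y hy).1]
      have := mul_le_one₀ ha (t1 x hx).1 (t1 x hx).2
      have := mul_le_one₀ hb (t1 y hy).1 (t1 y hy).2
      linarith
    refine h2.trans ?_
    have h3 : 1 ≤ R₁ ^ (n + 1) * (nrm K (x : K) ^ (n + 1))⁻¹ := by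
      rw [← div_eq_mul_inv, one_le_div (by positivity)]
      exact pow_le_pow_left₀ hpos.le hlt.le _
    have h4 : 0 ≤ (2 * C₀ + 8 * n) * (R / c) * (c ^ n)⁻¹ * (nrm K (x : K) ^ (n + 1))⁻¹ := by
      positivity
    calc (2:ℝ) ≤ 2 * (R₁ ^ (n + 1) * (nrm K (x : K) ^ (n + 1))⁻¹) := by linarith
      _ ≤ _ := by rw [add_mul]; linarith
  · set δ : ℝ := R / (c * nrm K (x : K)) with hδ
    have hδ0 : 0 ≤ δ := by positivity
    have hδn : n * δ ≤ 1 / 4 := by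
      rw [hδ, ← mul_div_assoc, div_le_iff₀ (by positivity)]
      rw [hR₁, div_le_iff₀ hc] at hge
      linarith
    have hδ2 : δ ≤ 1 / 2 := by nlinarith
    have hv : ∀ v : InfinitePlace K, v ((x : K) - y) ≤ δ * v x := by
      intro v
      refine (place_le_nrm K v _).trans (hxy.trans ?_)
      calc R = δ * (c * nrm K (x : K)) := by rw [hδ]; field_simp
        _ ≤ _ := mul_le_mul_of_nonneg_left (hcx v) hδ0
    have hab' : a = b := by
      apply hab
      have := norm_pos_of_close K hx' (y := (y : K)) hδn hv
      rw [← Algebra.coe_norm_int, ← Algebra.coe_norm_int] at this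
      exact_mod_cast this
    subst hab'
    have hlog : ∀ v : InfinitePlace K, |Real.log (v x) - Real.log (v y)| ≤ 2 * δ := by
      intro v
      refine (abs_log_sub_le (InfinitePlace.pos_iff.2 hx') hδ0 hδ2 ?_).2
      refine le_trans ?_ (hv v)
      obtain ⟨φ, hφ⟩ : ∃ φ : K →+* ℂ, InfinitePlace.mk φ = v := ⟨v.embedding, v.mk_embedding⟩
      rw [← hφ, InfinitePlace.apply, InfinitePlace.apply, InfinitePlace.apply, map_sub]
      exact abs_norm_sub_norm_le _ _
    have hwd := hlip x y hx' hy' (2 * δ) (by positivity) hlog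
    have hNd := abs_log_absN_sub_le K hx' hy' hlog
    rw [← hn] at hNd
    have hexp : |absN K (x:K) ^ (-s) - absN K (y:K) ^ (-s)| ≤ absN K (x:K) ^ (-s) * (8 * n * δ) := by
      set u := s * (Real.log (absN K (x:K)) - Real.log (absN K (y:K))) with hu
      have hu1 : |u| ≤ 4 * n * δ := by
        rw [hu, abs_mul, abs_of_pos (by linarith)]
        calc _ ≤ 2 * (n * (2 * δ)) := mul_le_mul hs2 hNd (abs_nonneg _) (by norm_num)
          _ = _ := by ring
      have e : absN K (y:K) ^ (-s) = absN K (x:K) ^ (-s) * Real.exp u := by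
        rw [Real.rpow_def_of_pos (by linarith), Real.rpow_def_of_pos (by linarith), ← Real.exp_add, hu]
        congr 1; ring
      have hp : 0 ≤ absN K (x:K) ^ (-s) := Real.rpow_nonneg (by linarith) _
      rw [e, show absN K (x:K) ^ (-s) - absN K (x:K) ^ (-s) * Real.exp u =
        absN K (x:K) ^ (-s) * (-(Real.exp u - 1)) by ring, abs_mul, abs_neg, abs_of_nonneg hp]
      refine mul_le_mul_of_nonneg_left ?_ hp
      have := Real.abs_exp_sub_one_le (x := u) (by nlinarith)
      linarith
    have hfin : |wt K (x:K) * absN K (x:K) ^ (-s) - wt K (y:K) * absN K (y:K) ^ (-s)| ≤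
        absN K (x:K) ^ (-s) * ((2 * C₀ + 8 * n) * δ) := by
      have hp : 0 ≤ absN K (x:K) ^ (-s) := Real.rpow_nonneg (by linarith) _
      rw [show wt K (x:K) * absN K (x:K) ^ (-s) - wt K (y:K) * absN K (y:K) ^ (-s) =
        (wt K (x:K) - wt K (y:K)) * absN K (x:K) ^ (-s) +
          wt K (y:K) * (absN K (x:K) ^ (-s) - absN K (y:K) ^ (-s)) by ring]
      refine (abs_add_le _ _).trans ?_
      rw [abs_mul, abs_mul, abs_of_nonneg hp, abs_of_nonneg (wt_nonneg K _)]
      have h1 := mul_le_mul_of_nonneg_right hwd hp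
      have h2 := (mul_le_of_le_one_left (abs_nonneg _) (wt_le_one K (y:K))).trans hexp
      calc _ ≤ C₀ * (2 * δ) * absN K (x:K) ^ (-s) + absN K (x:K) ^ (-s) * (8 * n * δ) :=
            add_le_add h1 h2
        _ = _ := by ring
    have hNx2 : absN K (x:K) ^ (-s) ≤ (c ^ n)⁻¹ * (nrm K (x:K) ^ n)⁻¹ := by
      calc absN K (x:K) ^ (-s) ≤ absN K (x:K) ^ (-1 : ℝ) :=
            Real.rpow_le_rpow_of_exponent_le hNx (by linarith)
        _ = (absN K (x:K))⁻¹ := Real.rpow_neg_one _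
        _ ≤ ((c * nrm K (x:K)) ^ n)⁻¹ := by
            apply inv_anti₀ (by positivity)
            exact absN_ge K hc hcx
        _ = _ := by rw [mul_pow, mul_inv]
    rw [← mul_sub, norm_mul, ← Complex.ofReal_sub, Complex.norm_real, Real.norm_eq_abs]
    refine (mul_le_of_le_one_left (abs_nonneg _) ha).trans (hfin.trans ?_)
    calc _ ≤ (c ^ n)⁻¹ * (nrm K (x:K) ^ n)⁻¹ * ((2 * C₀ + 8 * n) * δ) :=
          mul_le_mul_of_nonneg_right hNx2 (by positivity)
      _ = (2 * C₀ + 8 * n) * (R / c) * (c ^ n)⁻¹ * (nrm K (x:K) ^ (n + 1))⁻¹ := by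
          rw [hδ]; field_simp; ring
      _ ≤ _ := by
          refine mul_le_mul_of_nonneg_right ?_ (by positivity)
          have : 0 ≤ 2 * R₁ ^ (n + 1) := by positivity
          linarith

lemma one_le_nrm {x : 𝓞 K} (hx : x ≠ 0) : 1 ≤ nrm K (x : K) := by
  by_contra h
  push Not at h
  have h1 := one_le_absN K hx
  have h0 : 0 ≤ nrm K (x:K) := by classical exact norm_nonneg _
  have h2 : absN K (x:K) ≤ nrm K (x:K) ^ Module.finrank ℚ K := by
    rw [absN_eq_prod, ← InfinitePlace.sum_mult_eq, ← Finset.prod_pow_eq_pow_sum]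
    exact Finset.prod_le_prod (fun v _ => by positivity)
      fun v _ => pow_le_pow_left₀ (apply_nonneg v _) (place_le_nrm K v _) _
  have h3 := pow_lt_one₀ h0 h (Module.finrank_pos (R := ℚ) (M := K)).ne'
  linarith

lemma exists_lip (R : ℝ) (hR : 0 ≤ R) : ∃ C : ℝ, 0 ≤ C ∧ ∀ x y : 𝓞 K, x ≠ 0 → y ≠ 0 →
    nrm K ((x : K) - y) ≤ R → ∀ s : ℝ, 1 < s → s ≤ 2 → ∀ a b : ℂ, ‖a‖ ≤ 1 → ‖b‖ ≤ 1 →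
    (0 < Algebra.norm ℤ x * Algebra.norm ℤ y → a = b) →
    ‖a * ((wt K x * absN K x ^ (-s) : ℝ) : ℂ) - b * ((wt K y * absN K y ^ (-s) : ℝ) : ℂ)‖ ≤
      C * (nrm K x ^ (Module.finrank ℚ K + 1))⁻¹ := by
  obtain ⟨C, hC, h⟩ := exists_lip_half K R hR
  set n := Module.finrank ℚ K with hn
  refine ⟨C + C * (1 + R) ^ (n + 1), by positivity, ?_⟩
  intro x y hx hy hxy s hs1 hs2 a b ha hb hab
  have hx' : (x : K) ≠ 0 := by simpa using hx
  have hpos := nrm_pos K hx'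
  by_cases hwx : wt K x = 0
  · by_cases hwy : wt K y = 0
    · rw [hwx, hwy]; simp; positivity
    · have h1 := h y x hy hx (by rwa [nrm_sub_comm]) s hs1 hs2 b a hb ha
        (fun h => (hab (by rwa [mul_comm])).symm) hwy
      rw [norm_sub_rev] at h1
      refine h1.trans ?_
      have hy1 := one_le_nrm K hy
      have h2 : nrm K (x:K) ≤ (1 + R) * nrm K (y:K) := by
        have := nrm_add_le K ((x:K) - y) y
        rw [sub_add_cancel] at this
        nlinarith
      have h3 : (nrm K (y:K) ^ (n + 1))⁻¹ ≤ (1 + R) ^ (n + 1) * (nrm K (x:K) ^ (n + 1))⁻¹ := by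
        rw [← div_eq_mul_inv, inv_eq_one_div, div_le_div_iff₀ (by positivity) (by positivity), one_mul,
          ← mul_pow]
        exact pow_le_pow_left₀ hpos.le h2 _
      have h4 : 0 ≤ C * (nrm K (x:K) ^ (n + 1))⁻¹ := by positivity
      calc _ ≤ C * ((1 + R) ^ (n + 1) * (nrm K (x:K) ^ (n + 1))⁻¹) :=
            mul_le_mul_of_nonneg_left h3 hC
        _ ≤ _ := by rw [add_mul]; linarith
  · refine (h x y hx hy hxy s hs1 hs2 a b ha hb hab hwx).trans ?_
    refine mul_le_mul_of_nonneg_right ?_ (by positivity)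
    have : 0 ≤ C * (1 + R) ^ (n + 1) := by positivity
    linarith

lemma summable_nrm_rpow (r : ℝ) (hr : r < -Module.finrank ℚ K) :
    Summable (fun x : 𝓞 K => nrm K (x : K) ^ r) := by
  classical
  have h := ZLattice.summable_norm_rpow (mixedEmbedding.integerLattice K) r (by
    rw [ZLattice.rank ℝ, mixedEmbedding.finrank]; exact hr)
  have hmem : ∀ x : 𝓞 K, mixedEmbedding K (x : K) ∈ mixedEmbedding.integerLattice K :=
    fun x => LinearMap.mem_range.2 ⟨x, rfl⟩
  have hf : Function.Injective (fun x : 𝓞 K =>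
      (⟨mixedEmbedding K (x : K), hmem x⟩ : mixedEmbedding.integerLattice K)) := by
    intro x y hxy
    have : mixedEmbedding K (x : K) = mixedEmbedding K (y : K) := congrArg Subtype.val hxy
    exact RingOfIntegers.ext (mixedEmbedding_injective K this)
  have h2 := h.comp_injective hf
  refine h2.congr fun x => ?_
  rw [Function.comp_apply, nrm, Submodule.coe_norm]

lemma summable_wt (s : ℝ) (hs : 1 < s) :
    Summable (fun x : 𝓞 K => wt K x * absN K (x:K) ^ (-s)) := by
  obtain ⟨c, hc, hcomp⟩ := exists_comparable K
  have hn := finrank_pos_real K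
  have h := (summable_nrm_rpow K (-(Module.finrank ℚ K * s)) (by nlinarith)).mul_left
    (c ^ (-(Module.finrank ℚ K * s)))
  refine h.of_nonneg_of_le (fun x => ?_) (fun x => ?_)
  · exact mul_nonneg (wt_nonneg K _) (Real.rpow_nonneg (abs_nonneg _) _)
  · have h0 : 0 ≤ nrm K (x:K) := by classical exact norm_nonneg _
    by_cases hx : x = 0
    · have : absN K (x:K) = 0 := by rw [hx]; simp [absN]
      rw [this, Real.zero_rpow (by linarith), mul_zero]
      positivity
    · have hx' : (x : K) ≠ 0 := by simpa using hx
      by_cases hw : wt K (x:K) = 0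
      · rw [hw, zero_mul]; positivity
      · have h1 := absN_ge K hc (hcomp x hx' hw)
        have hp := nrm_pos K hx'
        refine (mul_le_of_le_one_left (Real.rpow_nonneg (abs_nonneg _) _) (wt_le_one K _)).trans ?_
        rw [← Real.mul_rpow hc.le h0]
        rw [show -(Module.finrank ℚ K * s) = (Module.finrank ℚ K : ℝ) * (-s) by ring,
          Real.rpow_mul (by positivity), Real.rpow_natCast]
        exact Real.rpow_le_rpow_of_nonpos (by positivity) h1 (by linarith)

end GenusRank

namespace GenusRank

open NumberField.Units NumberField.Units.dirichletUnitTheorem nonZeroDivisors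

variable (K : Type*) [Field K] [NumberField K]

lemma absN_eq_absNorm (x : 𝓞 K) : absN K (x : K) = (Ideal.absNorm (Ideal.span {x}) : ℝ) := by
  rw [absN, ← Algebra.coe_norm_int, Ideal.absNorm_span_singleton]
  push_cast
  simp [Nat.cast_natAbs]

lemma exists_gen {R : Type*} [CommRing R] [IsDedekindDomain R] (b : (Ideal R)⁰)
    (C : ClassGroup R) (hC : C * ClassGroup.mk0 b = 1) (I : (Ideal R)⁰) (hI : ClassGroup.mk0 I = C) :
    ∃ g : R, g ≠ 0 ∧ Ideal.span {g} = (I : Ideal R) * (b : Ideal R) := by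
  have h1 : ClassGroup.mk0 (I * b) = 1 := by rw [map_mul, hI, hC]
  rw [ClassGroup.mk0_eq_one_iff] at h1
  obtain ⟨g, hg⟩ := h1
  have hg' : (I : Ideal R) * (b : Ideal R) = Ideal.span {g} := hg
  refine ⟨g, ?_, hg'.symm⟩
  rintro rfl
  rw [Ideal.span_singleton_eq_bot.2 rfl] at hg'
  exact mul_ne_zero (nonZeroDivisors.ne_zero I.2) (nonZeroDivisors.ne_zero b.2) hg'

lemma exists_of_mem {R : Type*} [CommRing R] [IsDedekindDomain R] (b : (Ideal R)⁰)
    (C : ClassGroup R) (hC : C * ClassGroup.mk0 b = 1) (x : R) (hxb : x ∈ (b : Ideal R)) (hx0 : x ≠ 0) :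
    ∃ I : (Ideal R)⁰, ClassGroup.mk0 I = C ∧ Ideal.span {x} = (I : Ideal R) * (b : Ideal R) := by
  have h1 : (b : Ideal R) ∣ Ideal.span {x} :=
    Ideal.dvd_iff_le.2 ((Ideal.span_singleton_le_iff_mem _).2 hxb)
  obtain ⟨I, hI⟩ := h1
  have hI0 : I ≠ 0 := by
    rintro rfl
    rw [mul_zero] at hI
    exact hx0 (by simpa using hI)
  refine ⟨⟨I, mem_nonZeroDivisors_of_ne_zero hI0⟩, ?_, ?_⟩
  · rw [← mul_left_inj (ClassGroup.mk0 b), hC, ← map_mul, ClassGroup.mk0_eq_one_iff]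
    refine ⟨x, ?_⟩
    change I * (b : Ideal R) = _
    rw [mul_comm, ← hI]
  · rw [hI, mul_comm]

lemma exists_fiber_equiv {R : Type*} [CommRing R] [IsDedekindDomain R] (b : (Ideal R)⁰)
    (C : ClassGroup R) (hC : C * ClassGroup.mk0 b = 1) :
    ∃ (g : {I : (Ideal R)⁰ // ClassGroup.mk0 I = C} → R)
      (e : {I : (Ideal R)⁰ // ClassGroup.mk0 I = C} × Rˣ ≃
      {x : R // x ∈ (b : Ideal R) ∧ x ≠ 0}), (∀ I, g I ≠ 0) ∧
      (∀ p, (e p).1 = (p.2 : R) * g p.1) ∧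
      (∀ p, Ideal.span {(e p).1} = ((p.1.1 : Ideal R) * (b : Ideal R))) := by
  choose g hg0 hg using fun I : {I : (Ideal R)⁰ // ClassGroup.mk0 I = C} => exists_gen b C hC I.1 I.2
  have hgb : ∀ I, g I ∈ (b : Ideal R) := by
    intro I
    have h0 : (I.1 : Ideal R) * (b : Ideal R) ≤ b := Ideal.mul_le_right
    rw [← hg I, Ideal.span_singleton_le_iff_mem] at h0
    exact h0
  obtain ⟨e, he1⟩ : ∃ e : {I : (Ideal R)⁰ // ClassGroup.mk0 I = C} × Rˣ →
      {x : R // x ∈ (b : Ideal R) ∧ x ≠ 0}, ∀ p, (e p).1 = (p.2 : R) * g p.1 :=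
    ⟨fun p => ⟨(p.2 : R) * g p.1, Ideal.mul_mem_left _ _ (hgb _), mul_ne_zero p.2.ne_zero (hg0 _)⟩,
      fun p => rfl⟩
  have hspan : ∀ p, Ideal.span {(e p).1} = ((p.1.1 : Ideal R) * (b : Ideal R)) := by
    intro p
    rw [← hg p.1, he1]
    exact Ideal.span_singleton_mul_left_unit p.2.isUnit _
  have he : Function.Bijective e := by
    constructor
    · intro p q hpq
      have h1 : (p.1.1 * b : Ideal R) = (q.1.1 * b : Ideal R) := by
        rw [← hspan, ← hspan, hpq]
      have hb : (b : Ideal R) ≠ 0 := nonZeroDivisors.ne_zero b.2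
      have h2 := mul_right_cancel₀ hb h1
      have h3 : p.1 = q.1 := Subtype.ext (Subtype.ext h2)
      have h4 : (e p).1 = (e q).1 := by rw [hpq]
      rw [he1, he1, h3] at h4
      exact Prod.ext h3 (Units.ext (mul_right_cancel₀ (hg0 _) h4))
    · rintro ⟨x, hxb, hx0⟩
      obtain ⟨I, hI, hx⟩ := exists_of_mem b C hC x hxb hx0
      have h2 : Ideal.span {g ⟨I, hI⟩} = Ideal.span {x} := by
        rw [hg, hx]
      rw [Ideal.span_singleton_eq_span_singleton] at h2
      obtain ⟨u, hu⟩ := h2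
      refine ⟨(⟨I, hI⟩, u), Subtype.ext ?_⟩
      rw [he1, mul_comm]; exact hu
  refine ⟨g, Equiv.ofBijective e he, hg0, fun p => ?_, fun p => ?_⟩
  · rw [Equiv.ofBijective_apply, he1]
  · rw [Equiv.ofBijective_apply, hspan]

lemma fiber_one (g : 𝓞 K) (hg : g ≠ 0) (z : ℂ) :
    HasSum (fun u : (𝓞 K)ˣ => (wt K ((u : K) * (g : K)) : ℂ) * z) ((Nat.card (torsion K) : ℂ) * z) := by
  have h1 := ((Complex.hasSum_ofReal.2 (hasSum_wt K (x := (g : K)) (by simpa using hg)))).mul_right z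
  simpa only [Complex.ofReal_natCast] using h1

lemma hasSum_prod_aux {α β γ : Type*} (e : α × β ≃ γ) (f : γ → ℂ) (h : α → β → ℂ) (r : α → ℂ) {A : ℂ}
    (hf : HasSum f A) (h1 : ∀ a b, f (e (a, b)) = h a b) (h2 : ∀ a, HasSum (h a) (r a)) : HasSum r A := by
  have h3 : HasSum (f ∘ e) A := e.hasSum_iff.2 hf
  refine HasSum.prod_fiberwise h3 fun a => ?_
  refine (h2 a).congr_fun fun b => h1 a b

lemma fiber_hasSum (b : (Ideal (𝓞 K))⁰) (C : ClassGroup (𝓞 K)) (hC : C * ClassGroup.mk0 b = 1)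
    (F : Ideal (𝓞 K) → ℂ) {A : ℂ}
    (h : HasSum (fun x : {x : 𝓞 K // x ∈ (b : Ideal (𝓞 K)) ∧ x ≠ 0} =>
      (wt K (x.1 : K) : ℂ) * F (Ideal.span {x.1})) A) :
    HasSum (fun I : {I : (Ideal (𝓞 K))⁰ // ClassGroup.mk0 I = C} =>
      (Nat.card (torsion K) : ℂ) * F ((I.1 : Ideal (𝓞 K)) * (b : Ideal (𝓞 K)))) A := by
  obtain ⟨g, e, hg0, he, hspan⟩ := exists_fiber_equiv b C hC
  refine hasSum_prod_aux e _ (fun I u => (wt K ((u : K) * (g I : K)) : ℂ) *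
    F ((I.1 : Ideal (𝓞 K)) * (b : Ideal (𝓞 K)))) _ h (fun I u => ?_) (fun I => ?_)
  · have h1 := hspan (I, u)
    have h2 := he (I, u)
    simp only at h1 h2
    rw [h1, h2]; rfl
  · exact fiber_one K (g I) (hg0 I) _

/-- term of the L-series -/
noncomputable def Tm (θ : Ideal (𝓞 K) → ℂ) (s : ℝ) (I : Ideal (𝓞 K)) : ℂ :=
  θ I * (((Ideal.absNorm I : ℝ) ^ (-s) : ℝ) : ℂ)

variable {K}

lemma Tm_mul (θ : Ideal (𝓞 K) →*₀ ℂ) (s : ℝ) (I J : Ideal (𝓞 K)) :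
    Tm K θ s (I * J) = Tm K θ s I * Tm K θ s J := by
  unfold Tm
  rw [map_mul, map_mul, Nat.cast_mul, Real.mul_rpow (by positivity) (by positivity)]
  push_cast
  ring

lemma Tm_zero (θ : Ideal (𝓞 K) →*₀ ℂ) (s : ℝ) : Tm K θ s ⊥ = 0 := by
  unfold Tm
  rw [show (⊥ : Ideal (𝓞 K)) = 0 from rfl, map_zero, zero_mul]

lemma norm_Tm_le (θ : Ideal (𝓞 K) →*₀ ℂ) (hθ : ∀ I, ‖θ I‖ ≤ 1) (s : ℝ) (I : Ideal (𝓞 K)) :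
    ‖Tm K θ s I‖ ≤ (Ideal.absNorm I : ℝ) ^ (-s) := by
  unfold Tm
  rw [norm_mul, Complex.norm_real, Real.norm_of_nonneg (by positivity)]
  exact mul_le_of_le_one_left (by positivity) (hθ I)

lemma summable_wt_Tm (θ : Ideal (𝓞 K) →*₀ ℂ) (hθ : ∀ I, ‖θ I‖ ≤ 1) (s : ℝ) (hs : 1 < s) :
    Summable (fun x : 𝓞 K => (wt K (x : K) : ℂ) * Tm K θ s (Ideal.span {x})) := by
  refine Summable.of_norm_bounded (summable_wt K s hs) fun x => ?_
  rw [norm_mul, Complex.norm_real, Real.norm_of_nonneg (wt_nonneg K _), absN_eq_absNorm]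
  exact mul_le_mul_of_nonneg_left (norm_Tm_le θ hθ s _) (wt_nonneg K _)

/-- the sum over a class -/
lemma hasSum_class (θ : Ideal (𝓞 K) →*₀ ℂ) (hθ : ∀ I, ‖θ I‖ ≤ 1) (s : ℝ) (hs : 1 < s)
    (b : (Ideal (𝓞 K))⁰) (C : ClassGroup (𝓞 K)) (hC : C * ClassGroup.mk0 b = 1) :
    HasSum (fun I : {I : (Ideal (𝓞 K))⁰ // ClassGroup.mk0 I = C} =>
      (Nat.card (torsion K) : ℂ) * Tm K θ s b * Tm K θ s I.1)
      (∑' x : (b : Ideal (𝓞 K)), (wt K (x.1 : K) : ℂ) * Tm K θ s (Ideal.span {x.1})) := by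
  have h1 := (summable_wt_Tm θ hθ s hs).subtype (b : Set (𝓞 K))
  have h2 : HasSum (fun x : {x : 𝓞 K // x ∈ (b : Ideal (𝓞 K)) ∧ x ≠ 0} =>
      (wt K (x.1 : K) : ℂ) * Tm K θ s (Ideal.span {x.1}))
      (∑' x : (b : Ideal (𝓞 K)), (wt K (x.1 : K) : ℂ) * Tm K θ s (Ideal.span {x.1})) := by
    have h3 : HasSum (fun x : (b : Ideal (𝓞 K)) => (wt K (x.1 : K) : ℂ) * Tm K θ s (Ideal.span {x.1})) _ := h1.hasSum
    have inj : Function.Injective (fun x : {x : 𝓞 K // x ∈ (b : Ideal (𝓞 K)) ∧ x ≠ 0} =>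
      (⟨x.1, x.2.1⟩ : (b : Ideal (𝓞 K)))) := by
      intro x y h
      simpa [Subtype.ext_iff] using h
    refine (inj.hasSum_iff ?_).2 h3
    rintro ⟨x, hx⟩ hx'
    have : x = 0 := by
      by_contra h0
      exact hx' ⟨⟨x, hx, h0⟩, rfl⟩
    subst this
    simp [Tm_zero]
  refine (fiber_hasSum K b C hC (Tm K θ s) h2).congr_fun fun I => ?_
  rw [Tm_mul]; ring

end GenusRank

namespace GenusRank

open NumberField.Units NumberField.Units.dirichletUnitTheorem nonZeroDivisors

variable {K : Type*} [Field K] [NumberField K]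

/-- sum over elements of an ideal -/
noncomputable def Sb (θ : Ideal (𝓞 K) → ℂ) (s : ℝ) (b : Ideal (𝓞 K)) : ℂ :=
  ∑' x : b, (wt K (x.1 : K) : ℂ) * Tm K θ s (Ideal.span {x.1})

/-- sum over a class -/
noncomputable def Acl (θ : Ideal (𝓞 K) → ℂ) (s : ℝ) (C : ClassGroup (𝓞 K)) : ℂ :=
  ∑' I : {I : (Ideal (𝓞 K))⁰ // ClassGroup.mk0 I = C}, Tm K θ s I.1

lemma Sb_eq (θ : Ideal (𝓞 K) →*₀ ℂ) (hθ : ∀ I, ‖θ I‖ ≤ 1) (s : ℝ) (hs : 1 < s)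
    (b : (Ideal (𝓞 K))⁰) (C : ClassGroup (𝓞 K)) (hC : C * ClassGroup.mk0 b = 1) :
    Sb θ s b = (Nat.card (torsion K) : ℂ) * Tm K θ s b * Acl θ s C := by
  have h := (hasSum_class θ hθ s hs b C hC).tsum_eq
  rw [tsum_mul_left] at h
  exact h.symm

lemma exists_coset_equiv (b c m : Ideal (𝓞 K)) (hb : b ≠ ⊥) (hc : c ≠ ⊥) (hmc : m ⊔ c = ⊤) :
    ∃ (r : Fin (Ideal.absNorm c) → 𝓞 K) (e : Fin (Ideal.absNorm c) × (b * c : Ideal (𝓞 K)) ≃ b),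
      (∀ q, r q ∈ m) ∧ ∀ q x, (e (q, x)).1 = x.1 + r q := by
  let B := b.toAddSubgroup
  let D := (b * c).toAddSubgroup
  have hle : b * c ≤ b := Ideal.mul_le_left
  have hle2 : b * m ≤ b := Ideal.mul_le_left
  have hle3 : b * m ≤ m := Ideal.mul_le_right
  have hDB : D ≤ B := hle
  let Q := B ⧸ D.addSubgroupOf B
  have hcard : Nat.card Q = Ideal.absNorm c := by
    have h1 : Nat.card Q = D.relIndex B := rfl
    have h2 := AddSubgroup.relIndex_mul_index hDB
    have h3 : D.index = Ideal.absNorm (b * c) := rfl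
    have h4 : B.index = Ideal.absNorm b := rfl
    rw [h3, h4, map_mul, mul_comm (Ideal.absNorm b)] at h2
    rw [h1]
    exact Nat.eq_of_mul_eq_mul_right (Nat.pos_of_ne_zero (by simpa [Ideal.absNorm_eq_zero_iff] using hb)) h2
  have hpos : Ideal.absNorm c ≠ 0 := by simpa [Ideal.absNorm_eq_zero_iff] using hc
  have : Finite Q := Nat.finite_of_card_ne_zero (by rw [hcard]; exact hpos)
  obtain ⟨e0⟩ : Nonempty (Fin (Ideal.absNorm c) ≃ Q) := by
    rw [← hcard]; exact ⟨(Finite.equivFin Q).symm⟩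
  have hr : ∀ q : Q, ∃ r : B, r.1 ∈ m ∧ (QuotientAddGroup.mk r : Q) = q := by
    intro q
    obtain ⟨x, rfl⟩ := QuotientAddGroup.mk_surjective q
    have hx : x.1 ∈ b * c ⊔ b * m := by
      rw [← Ideal.mul_sup, sup_comm, hmc, Ideal.mul_top]; exact x.2
    obtain ⟨y, hy, z, hz, hyz⟩ := Submodule.mem_sup.1 hx
    refine ⟨⟨z, hle2 hz⟩, hle3 hz, ?_⟩
    rw [QuotientAddGroup.eq, AddSubgroup.mem_addSubgroupOf]
    have : (-(⟨z, hle2 hz⟩ : B) + x : B).1 = y := by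
      change -z + x.1 = y
      rw [← hyz]; ring
    rw [this]; exact hy
  choose r hrm hrq using hr
  have hbij : Function.Bijective (fun p : Fin (Ideal.absNorm c) × (b * c : Ideal (𝓞 K)) =>
      (⟨p.2.1 + (r (e0 p.1)).1, b.add_mem (hDB p.2.2) (r (e0 p.1)).2⟩ : b)) := by
    constructor
    · rintro ⟨q, x⟩ ⟨q', x'⟩ h
      have h1 : x.1 + (r (e0 q)).1 = x'.1 + (r (e0 q')).1 := congrArg Subtype.val h
      have h2 : e0 q = e0 q' := by
        rw [← hrq (e0 q), ← hrq (e0 q'), QuotientAddGroup.eq, AddSubgroup.mem_addSubgroupOf]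
        have : (-(r (e0 q)) + r (e0 q') : B).1 = x.1 - x'.1 := by
          change - (r (e0 q)).1 + (r (e0 q')).1 = _
          linear_combination -h1
        rw [this]
        exact (b * c).sub_mem x.2 x'.2
      have h3 : q = q' := e0.injective h2
      subst h3
      have h4 : x = x' := Subtype.ext (add_right_cancel h1)
      rw [h4]
    · intro y
      obtain ⟨q, hq⟩ := e0.surjective (QuotientAddGroup.mk (⟨y.1, y.2⟩ : B) : Q)
      have h1 : (QuotientAddGroup.mk (r (e0 q)) : Q) = QuotientAddGroup.mk (⟨y.1, y.2⟩ : B) := by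
        rw [hrq, hq]
      rw [QuotientAddGroup.eq, AddSubgroup.mem_addSubgroupOf] at h1
      have h2 : -(r (e0 q)).1 + y.1 ∈ b * c := h1
      refine ⟨(q, ⟨_, h2⟩), Subtype.ext ?_⟩
      change -(r (e0 q)).1 + y.1 + (r (e0 q)).1 = y.1
      ring
  exact ⟨fun q => (r (e0 q)).1, Equiv.ofBijective _ hbij, fun q => hrm _, fun q x => rfl⟩

/-- the summand -/
noncomputable def Fw (θ : Ideal (𝓞 K) → ℂ) (s : ℝ) (x : 𝓞 K) : ℂ :=
  (wt K (x : K) : ℂ) * Tm K θ s (Ideal.span {x})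

lemma Fw_zero (θ : Ideal (𝓞 K) →*₀ ℂ) (s : ℝ) : Fw θ s 0 = 0 := by
  unfold Fw
  rw [Ideal.span_singleton_eq_bot.2 rfl, Tm_zero, mul_zero]

lemma Fw_eq (θ : Ideal (𝓞 K) → ℂ) (s : ℝ) (x : 𝓞 K) :
    Fw θ s x = θ (Ideal.span {x}) * ((wt K x * absN K x ^ (-s) : ℝ) : ℂ) := by
  unfold Fw Tm
  rw [absN_eq_absNorm]; push_cast; ring

lemma norm_Fw_le (θ : Ideal (𝓞 K) →*₀ ℂ) (hθ : ∀ I, ‖θ I‖ ≤ 1) (s : ℝ) (hs : 1 < s) (x : 𝓞 K) :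
    ‖Fw θ s x‖ ≤ 1 := by
  by_cases hx : x = 0
  · rw [hx, Fw_zero]; simp
  unfold Fw
  rw [norm_mul, Complex.norm_real, Real.norm_of_nonneg (wt_nonneg K _)]
  refine mul_le_one₀ (wt_le_one K _) (norm_nonneg _) ((norm_Tm_le θ hθ s _).trans ?_)
  refine Real.rpow_le_one_of_one_le_of_nonpos ?_ (by linarith)
  have : Ideal.absNorm (Ideal.span {x}) ≠ 0 := by
    rw [Ne, Ideal.absNorm_eq_zero_iff, Ideal.span_singleton_eq_bot]; exact hx
  exact_mod_cast Nat.one_le_iff_ne_zero.2 this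

lemma diff_bound (θ : Ideal (𝓞 K) →*₀ ℂ) (hθ : ∀ I, ‖θ I‖ ≤ 1) (m : Ideal (𝓞 K))
    (hcong : ∀ x y : 𝓞 K, x ≠ 0 → y ≠ 0 → x - y ∈ m → 0 < Algebra.norm ℤ x * Algebra.norm ℤ y →
      θ (Ideal.span {x}) = θ (Ideal.span {y})) (r : 𝓞 K) (hr : r ∈ m) :
    ∃ C : ℝ, ∀ s, 1 < s → s ≤ 2 → ∀ b : Ideal (𝓞 K),
      ‖∑' x : b, (Fw θ s (x.1 + r) - Fw θ s x.1)‖ ≤ C := by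
  classical
  obtain ⟨C, hC0, hC⟩ := exists_lip K (|nrm K (r : K)|) (abs_nonneg _)
  have hsum := summable_nrm_rpow K (-(Module.finrank ℚ K + 1 : ℕ) : ℝ) (by push_cast; linarith)
  let G : 𝓞 K → ℝ := fun x => C * nrm K (x : K) ^ (-(Module.finrank ℚ K + 1 : ℕ) : ℝ) +
    ((if x = 0 then 1 else 0) + (if x = -r then 1 else 0))
  have hG0 : ∀ x, 0 ≤ G x := by
    intro x
    have : 0 ≤ nrm K (x : K) := norm_nonneg _
    simp only [G]
    positivity
  have hG : Summable G := by
    refine (hsum.mul_left C).add (Summable.add ?_ ?_)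
    · exact (hasSum_ite_eq (0 : 𝓞 K) (1:ℝ)).summable
    · exact (hasSum_ite_eq (-r : 𝓞 K) (1:ℝ)).summable
  have hle : ∀ s, 1 < s → s ≤ 2 → ∀ x : 𝓞 K, ‖Fw θ s (x + r) - Fw θ s x‖ ≤ G x := by
    intro s hs hs2 x
    have hn : 0 ≤ C * nrm K (x : K) ^ (-(Module.finrank ℚ K + 1 : ℕ) : ℝ) := by
      have : 0 ≤ nrm K (x : K) := norm_nonneg _
      positivity
    by_cases hx : x = 0
    · have h1 := norm_Fw_le θ hθ s hs (x + r)
      rw [hx, Fw_zero, sub_zero]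
      rw [hx] at h1 hn
      refine h1.trans ?_
      simp only [G, if_true]
      split_ifs <;> linarith
    by_cases hx2 : x = -r
    · have h1 := norm_Fw_le θ hθ s hs x
      have h0 : x + r = 0 := by rw [hx2]; ring
      rw [h0, Fw_zero, zero_sub, norm_neg]
      refine h1.trans ?_
      simp only [G]
      rw [if_pos hx2]
      split_ifs <;> linarith
    have hxr : x + r ≠ 0 := fun h => hx2 (eq_neg_of_add_eq_zero_left h)
    have h1 := hC x (x + r) hx hxr (by
      rw [nrm_sub_comm]
      have : ((x + r : 𝓞 K) : K) - (x : K) = (r : K) := by push_cast; ring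
      rw [this]; exact le_abs_self _) s hs hs2 (θ (Ideal.span {x})) (θ (Ideal.span {x + r}))
      (hθ _) (hθ _) (fun h => hcong _ _ hx hxr (by
        have : x - (x + r) = -r := by ring
        rw [this]; exact m.neg_mem hr) h)
    rw [Fw_eq, Fw_eq, norm_sub_rev]
    refine h1.trans ?_
    simp only [G]
    have hnn : 0 ≤ nrm K (x : K) := norm_nonneg _
    rw [if_neg hx, if_neg hx2, add_zero, add_zero, Real.rpow_neg hnn, Real.rpow_natCast]
  refine ⟨∑' x, G x, fun s hs hs2 b => ?_⟩
  refine (tsum_of_norm_bounded (hG.subtype (b : Set (𝓞 K))).hasSum fun x => hle s hs hs2 x.1).trans ?_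
  exact hG.tsum_subtype_le _ _ hG0

lemma summable_Fw (θ : Ideal (𝓞 K) →*₀ ℂ) (hθ : ∀ I, ‖θ I‖ ≤ 1) (s : ℝ) (hs : 1 < s) :
    Summable (Fw θ s) := summable_wt_Tm θ hθ s hs

lemma Sb_diff (θ : Ideal (𝓞 K) →*₀ ℂ) (hθ : ∀ I, ‖θ I‖ ≤ 1) (m b c : Ideal (𝓞 K)) (hb : b ≠ ⊥)
    (hc : c ≠ ⊥) (hmc : m ⊔ c = ⊤)
    (hcong : ∀ x y : 𝓞 K, x ≠ 0 → y ≠ 0 → x - y ∈ m → 0 < Algebra.norm ℤ x * Algebra.norm ℤ y →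
      θ (Ideal.span {x}) = θ (Ideal.span {y})) :
    ∃ C : ℝ, ∀ s, 1 < s → s ≤ 2 → ‖Sb θ s b - (Ideal.absNorm c : ℂ) * Sb θ s (b * c)‖ ≤ C := by
  obtain ⟨r, e, hr, he⟩ := exists_coset_equiv b c m hb hc hmc
  choose C hC using fun q => diff_bound θ hθ m hcong (r q) (hr q)
  refine ⟨∑ q, C q, fun s hs hs2 => ?_⟩
  have hS := summable_Fw θ hθ s hs
  have h1 : Sb θ s b = ∑ q, ∑' x : (b * c : Ideal (𝓞 K)), Fw θ s (x.1 + r q) := by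
    have h2 : Summable (fun x : b => Fw θ s x.1) := hS.subtype (b : Set (𝓞 K))
    have h3 : Summable (fun p => Fw θ s (e p).1) := e.summable_iff.2 h2
    have h4 : Sb θ s b = ∑' p, Fw θ s (e p).1 := (e.tsum_eq (fun x : b => Fw θ s x.1)).symm
    rw [h4, h3.tsum_prod, tsum_fintype]
    refine Finset.sum_congr rfl fun q _ => tsum_congr fun x => ?_
    rw [he]
  have h2 : (Ideal.absNorm c : ℂ) * Sb θ s (b * c) =
      ∑ q : Fin (Ideal.absNorm c), ∑' x : (b * c : Ideal (𝓞 K)), Fw θ s x.1 := by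
    simp [Sb, Fw]
  rw [h1, h2, ← Finset.sum_sub_distrib]
  refine norm_sum_le_of_le _ fun q _ => ?_
  rw [← Summable.tsum_sub]
  · exact hC q s hs hs2 _
  · exact hS.comp_injective (i := fun x : (b * c : Ideal (𝓞 K)) => x.1 + r q)
      (fun x y h => Subtype.ext (add_right_cancel h))
  · exact hS.subtype ((b * c : Ideal (𝓞 K)) : Set (𝓞 K))

end GenusRank

namespace GenusRank

open NumberField.Units NumberField.Units.dirichletUnitTheorem nonZeroDivisors

variable {K : Type*} [Field K] [NumberField K]

variable (K) in
open scoped Classical in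
/-- trivial weight -/
noncomputable def triv : Ideal (𝓞 K) →*₀ ℂ where
  toFun I := if I = 0 then 0 else 1
  map_zero' := by simp
  map_one' := by simp
  map_mul' := by
    intro I J
    by_cases hI : I = 0
    · rw [if_pos hI, hI, zero_mul, if_pos rfl, zero_mul]
    · by_cases hJ : J = 0
      · rw [if_pos hJ, hJ, mul_zero, if_pos rfl, mul_zero]
      · rw [if_neg hI, if_neg hJ, if_neg (mul_ne_zero hI hJ), mul_one]

lemma triv_apply {I : Ideal (𝓞 K)} (hI : I ≠ 0) : triv K I = 1 := by
  change (if I = 0 then (0:ℂ) else 1) = 1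
  rw [if_neg hI]

lemma norm_triv_le (I : Ideal (𝓞 K)) : ‖triv K I‖ ≤ 1 := by
  by_cases hI : I = 0
  · rw [hI, map_zero]; simp
  · simp [triv_apply hI]

lemma Tm_triv (s : ℝ) {I : Ideal (𝓞 K)} (hI : I ≠ 0) :
    Tm K (triv K) s I = (((Ideal.absNorm I : ℝ) ^ (-s) : ℝ) : ℂ) := by
  unfold Tm
  rw [triv_apply hI, one_mul]

lemma summable_class (s : ℝ) (hs : 1 < s) (C : ClassGroup (𝓞 K)) :
    Summable (fun I : {I : (Ideal (𝓞 K))⁰ // ClassGroup.mk0 I = C} =>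
      ((Ideal.absNorm (I.1 : Ideal (𝓞 K)) : ℝ) ^ (-s))) := by
  obtain ⟨b, hb⟩ := ClassGroup.mk0_surjective C⁻¹
  have h := (hasSum_class (triv K) norm_triv_le s hs b C (by rw [hb]; simp)).summable
  have hb0 : (b : Ideal (𝓞 K)) ≠ 0 := nonZeroDivisors.ne_zero b.2
  have hz : (Nat.card (torsion K) : ℂ) * Tm K (triv K) s b ≠ 0 := by
    rw [Tm_triv s hb0]
    refine mul_ne_zero (by exact_mod_cast Nat.card_pos.ne') ?_
    have : (0:ℝ) < (Ideal.absNorm (b : Ideal (𝓞 K)) : ℝ) := by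
      have : Ideal.absNorm (b : Ideal (𝓞 K)) ≠ 0 := by
        rw [Ne, Ideal.absNorm_eq_zero_iff]; exact hb0
      positivity
    exact_mod_cast (Real.rpow_pos_of_pos this _).ne'
  have h2 := (summable_mul_left_iff hz).1 h
  have h3 : Summable (fun I : {I : (Ideal (𝓞 K))⁰ // ClassGroup.mk0 I = C} =>
      (((Ideal.absNorm (I.1 : Ideal (𝓞 K)) : ℝ) ^ (-s) : ℝ) : ℂ)) := by
    refine h2.congr fun I => ?_
    rw [Tm_triv s (nonZeroDivisors.ne_zero I.1.2)]
  exact Complex.summable_ofReal.1 h3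

lemma summable_ideal0 (s : ℝ) (hs : 1 < s) :
    Summable (fun I : (Ideal (𝓞 K))⁰ => ((Ideal.absNorm (I : Ideal (𝓞 K)) : ℝ) ^ (-s))) := by
  rw [← (Equiv.sigmaFiberEquiv (ClassGroup.mk0 : (Ideal (𝓞 K))⁰ → ClassGroup (𝓞 K))).summable_iff]
  refine (summable_sigma_of_nonneg (fun x => ?_)).2 ⟨fun C => ?_, ?_⟩
  · simp only [Function.comp_apply]; positivity
  · exact summable_class s hs C
  · exact (hasSum_fintype _).summable

lemma injective_coe0 : Function.Injective (fun I : (Ideal (𝓞 K))⁰ => (I : Ideal (𝓞 K))) :=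
  Subtype.val_injective

lemma not_range_coe0 {I : Ideal (𝓞 K)} (h : I ∉ Set.range (fun I : (Ideal (𝓞 K))⁰ => (I : Ideal (𝓞 K)))) :
    I = 0 := by
  by_contra h0
  exact h ⟨⟨I, mem_nonZeroDivisors_of_ne_zero h0⟩, rfl⟩

lemma summable_ideal (s : ℝ) (hs : 1 < s) :
    Summable (fun I : Ideal (𝓞 K) => ((Ideal.absNorm I : ℝ) ^ (-s))) := by
  refine (injective_coe0.summable_iff fun I hI => ?_).1 (summable_ideal0 s hs)
  rw [not_range_coe0 hI]
  simp [Real.zero_rpow (show -s ≠ 0 by linarith)]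

lemma summable_norm_Tm (θ : Ideal (𝓞 K) →*₀ ℂ) (hθ : ∀ I, ‖θ I‖ ≤ 1) (s : ℝ) (hs : 1 < s) :
    Summable (fun I => ‖Tm K θ s I‖) :=
  Summable.of_nonneg_of_le (fun _ => norm_nonneg _) (norm_Tm_le θ hθ s) (summable_ideal s hs)

lemma tsum_eq_sum_Acl (θ : Ideal (𝓞 K) →*₀ ℂ) (hθ : ∀ I, ‖θ I‖ ≤ 1) (s : ℝ) (hs : 1 < s) :
    ∑' I, Tm K θ s I = ∑ C, Acl θ s C := by
  have h0 : Summable (fun I => Tm K θ s I) := (summable_norm_Tm θ hθ s hs).of_norm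
  have h1 : ∑' I, Tm K θ s I = ∑' I : (Ideal (𝓞 K))⁰, Tm K θ s (I : Ideal (𝓞 K)) := by
    refine (injective_coe0.tsum_eq (f := Tm K θ s) fun I hI => ?_).symm
    by_contra h
    apply hI
    rw [not_range_coe0 h]; exact Tm_zero θ s
  have h2 : Summable (fun I : (Ideal (𝓞 K))⁰ => Tm K θ s (I : Ideal (𝓞 K))) :=
    h0.comp_injective injective_coe0
  let e := (Equiv.sigmaFiberEquiv (ClassGroup.mk0 : (Ideal (𝓞 K))⁰ → ClassGroup (𝓞 K)))
  rw [h1, ← e.tsum_eq]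
  have h3 : Summable (fun p => Tm K θ s (e p : Ideal (𝓞 K))) := e.summable_iff.2 h2
  rw [Summable.tsum_sigma h3, tsum_fintype]
  rfl

lemma Acl_diff (θ : Ideal (𝓞 K) →*₀ ℂ) (hθ : ∀ I, ‖θ I‖ ≤ 1) (m : Ideal (𝓞 K)) (c : (Ideal (𝓞 K))⁰)
    (hmc : m ⊔ c = ⊤) (hc1 : ‖θ c‖ = 1)
    (hcong : ∀ x y : 𝓞 K, x ≠ 0 → y ≠ 0 → x - y ∈ m → 0 < Algebra.norm ℤ x * Algebra.norm ℤ y →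
      θ (Ideal.span {x}) = θ (Ideal.span {y})) (A : ClassGroup (𝓞 K)) :
    ∃ C : ℝ, ∀ s, 1 < s → s ≤ 2 →
      ‖Acl θ s A - (Ideal.absNorm (c : Ideal (𝓞 K)) : ℂ) * Tm K θ s c * Acl θ s (A * (ClassGroup.mk0 c)⁻¹)‖ ≤ C := by
  by_cases h : ∃ a : (Ideal (𝓞 K))⁰, ClassGroup.mk0 a = A ∧ θ a ≠ 0
  · obtain ⟨a, haA, ha⟩ := h
    let b : (Ideal (𝓞 K))⁰ := a ^ (Fintype.card (ClassGroup (𝓞 K)) - 1)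
    have hAb : A * ClassGroup.mk0 b = 1 := by
      simp only [b]
      rw [map_pow, haA, ← pow_succ', Nat.sub_add_cancel Fintype.card_pos, pow_card_eq_one]
    have hθb : θ b ≠ 0 := by
      simp only [b]
      rw [show ((a ^ (Fintype.card (ClassGroup (𝓞 K)) - 1) : (Ideal (𝓞 K))⁰) : Ideal (𝓞 K)) =
        (a : Ideal (𝓞 K)) ^ (Fintype.card (ClassGroup (𝓞 K)) - 1) from rfl, map_pow]
      exact pow_ne_zero _ ha
    clear_value b
    have hb0 : (b : Ideal (𝓞 K)) ≠ 0 := nonZeroDivisors.ne_zero b.2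
    have hc0 : (c : Ideal (𝓞 K)) ≠ 0 := nonZeroDivisors.ne_zero c.2
    obtain ⟨C, hC⟩ := Sb_diff θ hθ m b c hb0 hc0 hmc hcong
    let κ : ℝ := (Nat.card (torsion K) : ℝ) * (‖θ b‖ * (Ideal.absNorm (b : Ideal (𝓞 K)) : ℝ) ^ (-2 : ℝ))
    have hN : (1:ℝ) ≤ (Ideal.absNorm (b : Ideal (𝓞 K)) : ℝ) := by
      have : Ideal.absNorm (b : Ideal (𝓞 K)) ≠ 0 := by
        rw [Ne, Ideal.absNorm_eq_zero_iff]; exact hb0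
      exact_mod_cast Nat.one_le_iff_ne_zero.2 this
    have hκ : 0 < κ := by
      have h1 : (0:ℝ) < Nat.card (torsion K) := by exact_mod_cast Nat.card_pos
      have h2 : 0 < ‖θ b‖ := norm_pos_iff.2 hθb
      have h3 : (0:ℝ) < (Ideal.absNorm (b : Ideal (𝓞 K)) : ℝ) := by linarith
      simp only [κ]; positivity
    refine ⟨C / κ, fun s hs hs2 => ?_⟩
    have h1 := hC s hs hs2
    rw [Sb_eq θ hθ s hs b A hAb] at h1
    have h2 := Sb_eq θ hθ s hs (b * c) (A * (ClassGroup.mk0 c)⁻¹) (by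
      rw [map_mul]
      calc A * (ClassGroup.mk0 c)⁻¹ * (ClassGroup.mk0 b * ClassGroup.mk0 c)
          = A * ClassGroup.mk0 b := by
            rw [mul_comm (ClassGroup.mk0 b), mul_assoc, inv_mul_cancel_left]
        _ = 1 := hAb)
    rw [show ((b * c : (Ideal (𝓞 K))⁰) : Ideal (𝓞 K)) = (b : Ideal (𝓞 K)) * c from rfl] at h2
    rw [h2, Tm_mul] at h1
    rw [le_div_iff₀' hκ]
    refine le_trans ?_ h1
    rw [show (Nat.card (torsion K) : ℂ) * Tm K θ s b * Acl θ s A -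
      (Ideal.absNorm (c : Ideal (𝓞 K)) : ℂ) * ((Nat.card (torsion K) : ℂ) * (Tm K θ s b * Tm K θ s c) *
        Acl θ s (A * (ClassGroup.mk0 c)⁻¹)) = ((Nat.card (torsion K) : ℂ) * Tm K θ s b) *
      (Acl θ s A - (Ideal.absNorm (c : Ideal (𝓞 K)) : ℂ) * Tm K θ s c * Acl θ s (A * (ClassGroup.mk0 c)⁻¹))
      by ring, norm_mul]
    refine mul_le_mul_of_nonneg_right ?_ (norm_nonneg _)
    rw [norm_mul, Complex.norm_natCast]
    unfold Tm
    rw [norm_mul, Complex.norm_real, Real.norm_of_nonneg (by positivity)]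
    refine mul_le_mul_of_nonneg_left (mul_le_mul_of_nonneg_left ?_ (norm_nonneg _)) (by positivity)
    exact Real.rpow_le_rpow_of_exponent_le hN (by linarith)
  · push Not at h
    refine ⟨0, fun s hs hs2 => ?_⟩
    have h1 : Acl θ s A = 0 := by
      unfold Acl
      rw [← tsum_zero]
      refine tsum_congr fun I => ?_
      unfold Tm
      rw [h I.1 I.2, zero_mul]
    have h2 : Acl θ s (A * (ClassGroup.mk0 c)⁻¹) = 0 := by
      unfold Acl
      rw [← tsum_zero]
      refine tsum_congr fun I => ?_
      unfold Tm
      have h3 := h (I.1 * c) (by rw [map_mul, I.2]; simp)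
      rw [show ((I.1 * c : (Ideal (𝓞 K))⁰) : Ideal (𝓞 K)) = (I.1 : Ideal (𝓞 K)) * c from rfl, map_mul] at h3
      have h4 : θ c ≠ 0 := by intro h0; rw [h0] at hc1; simp at hc1
      rw [(mul_eq_zero.1 h3).resolve_right h4, zero_mul]
    rw [h1, h2]; simp

lemma lower_aux (z : ℂ) (hz : ‖z‖ = 1) (hz1 : z ≠ 1) : ∃ δ > 0, ∀ r : ℝ, 0 ≤ r → δ ≤ ‖1 - (r:ℂ) * z‖ := by
  by_cases him : z.im = 0
  · have hre : z.re = -1 := by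
      have h1 : z.re ^ 2 = 1 := by
        have := Complex.sq_norm z
        rw [hz, Complex.normSq_apply, him] at this
        nlinarith
      rcases eq_or_eq_neg_of_sq_eq_sq z.re 1 (by rw [h1]; norm_num) with h | h
      · exact absurd (Complex.ext (by simpa using h) (by simpa using him)) hz1
      · exact h
    refine ⟨1, one_pos, fun r hr => ?_⟩
    refine le_trans ?_ (Complex.abs_re_le_norm _)
    simp [hre]
    rw [abs_of_nonneg (by linarith)]; linarith
  · by_cases hre : z.re ≤ 0
    · refine ⟨1, one_pos, fun r hr => ?_⟩
      refine le_trans ?_ (Complex.abs_re_le_norm _)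
      simp
      rw [abs_of_nonneg (by nlinarith)]; nlinarith
    · refine ⟨|z.im| , abs_pos.2 him, fun r hr => ?_⟩
      have h1 : ‖1 - (r:ℂ) * z‖ = ‖(starRingEnd ℂ) z - r‖ := by
        have hzz : (starRingEnd ℂ) z * z = 1 := by
          rw [mul_comm, Complex.mul_conj, Complex.normSq_eq_norm_sq, hz]; simp
        calc ‖1 - (r:ℂ) * z‖ = ‖((starRingEnd ℂ) z - r) * z‖ := by rw [sub_mul, hzz]
          _ = _ := by rw [norm_mul, hz, mul_one]
      rw [h1]
      refine le_trans ?_ (Complex.abs_im_le_norm _)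
      simp

theorem bounded_L (θ : Ideal (𝓞 K) →*₀ ℂ) (hθ : ∀ I, ‖θ I‖ ≤ 1) (m c : Ideal (𝓞 K)) (hc0 : c ≠ ⊥)
    (hmc : m ⊔ c = ⊤) (hc1 : ‖θ c‖ = 1) (hcne : θ c ≠ 1)
    (hcong : ∀ x y : 𝓞 K, x ≠ 0 → y ≠ 0 → x - y ∈ m → 0 < Algebra.norm ℤ x * Algebra.norm ℤ y →
      θ (Ideal.span {x}) = θ (Ideal.span {y})) :
    ∃ C : ℝ, ∀ s, 1 < s → s ≤ 2 → ‖∑' I, Tm K θ s I‖ ≤ C := by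
  let c' : (Ideal (𝓞 K))⁰ := ⟨c, mem_nonZeroDivisors_of_ne_zero hc0⟩
  choose C hC using fun A => Acl_diff θ hθ m c' hmc hc1 hcong A
  obtain ⟨δ, hδ, hδ'⟩ := lower_aux _ hc1 hcne
  refine ⟨(∑ A, C A) / δ, fun s hs hs2 => ?_⟩
  rw [le_div_iff₀ hδ, tsum_eq_sum_Acl θ hθ s hs]
  have h1 : ‖∑ A, (Acl θ s A - (Ideal.absNorm c : ℂ) * Tm K θ s c * Acl θ s (A * (ClassGroup.mk0 c')⁻¹))‖
      ≤ ∑ A, C A := norm_sum_le_of_le _ fun A _ => hC A s hs hs2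
  rw [Finset.sum_sub_distrib, ← Finset.mul_sum] at h1
  have h2 : ∑ A, Acl θ s (A * (ClassGroup.mk0 c')⁻¹) = ∑ A, Acl θ s A :=
    Equiv.sum_comp (Equiv.mulRight (ClassGroup.mk0 c')⁻¹) (Acl θ s)
  rw [h2] at h1
  have h3 : ∑ A, Acl θ s A - (Ideal.absNorm c : ℂ) * Tm K θ s c * ∑ A, Acl θ s A =
    (∑ A, Acl θ s A) * (1 - (((Ideal.absNorm c : ℝ) * (Ideal.absNorm c : ℝ) ^ (-s) : ℝ) : ℂ) * θ c) := by
    unfold Tm; push_cast; ring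
  rw [h3, norm_mul] at h1
  refine le_trans (mul_le_mul_of_nonneg_left (hδ' _ (by positivity)) (norm_nonneg _)) h1

end GenusRank

namespace GenusRank

open nonZeroDivisors Filter Topology

variable {K : Type*} [Field K] [NumberField K]

/-- prime term -/
noncomputable def pn (q : HeightOneSpectrum (𝓞 K)) (s : ℝ) : ℝ := (Ideal.absNorm q.asIdeal : ℝ) ^ (-s)

lemma two_le_absNorm (q : HeightOneSpectrum (𝓞 K)) : 2 ≤ Ideal.absNorm q.asIdeal := by
  have h0 : Ideal.absNorm q.asIdeal ≠ 0 := by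
    rw [Ne, Ideal.absNorm_eq_zero_iff]; exact q.ne_bot
  have h1 : Ideal.absNorm q.asIdeal ≠ 1 := by
    rw [Ne, Ideal.absNorm_eq_one_iff]; exact q.isPrime.ne_top
  omega

lemma pn_nonneg (q : HeightOneSpectrum (𝓞 K)) (s : ℝ) : 0 ≤ pn q s := by unfold pn; positivity

lemma pn_le_half (q : HeightOneSpectrum (𝓞 K)) (s : ℝ) (hs : 1 < s) : pn q s ≤ 1 / 2 := by
  have h2 : (2:ℝ) ≤ (Ideal.absNorm q.asIdeal : ℝ) := by exact_mod_cast two_le_absNorm q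
  unfold pn
  calc (Ideal.absNorm q.asIdeal : ℝ) ^ (-s) ≤ (Ideal.absNorm q.asIdeal : ℝ) ^ (-1 : ℝ) :=
        Real.rpow_le_rpow_of_exponent_le (by linarith) (by linarith)
    _ ≤ 1 / 2 := by
        rw [Real.rpow_neg_one, inv_eq_one_div]
        exact one_div_le_one_div_of_le (by norm_num) h2

lemma asIdeal_injective : Function.Injective (fun q : HeightOneSpectrum (𝓞 K) => q.asIdeal) :=
  fun q q' h => HeightOneSpectrum.ext h

lemma summable_pn (s : ℝ) (hs : 1 < s) : Summable (fun q : HeightOneSpectrum (𝓞 K) => pn q s) :=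
  (summable_ideal s hs).comp_injective asIdeal_injective

open scoped Classical in
/-- truncated term -/
noncomputable def Tc (θ : Ideal (𝓞 K) → ℂ) (s : ℝ) (F : Finset (HeightOneSpectrum (𝓞 K))) (I : Ideal (𝓞 K)) : ℂ :=
  if ∀ q ∈ F, ¬ q.asIdeal ∣ I then Tm K θ s I else 0

lemma norm_Tc_le (θ : Ideal (𝓞 K) → ℂ) (s : ℝ) (F : Finset (HeightOneSpectrum (𝓞 K))) (I : Ideal (𝓞 K)) :
    ‖Tc θ s F I‖ ≤ ‖Tm K θ s I‖ := by
  unfold Tc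
  split_ifs <;> simp

lemma summable_Tc (θ : Ideal (𝓞 K) →*₀ ℂ) (hθ : ∀ I, ‖θ I‖ ≤ 1) (s : ℝ) (hs : 1 < s)
    (F : Finset (HeightOneSpectrum (𝓞 K))) : Summable (Tc θ s F) :=
  Summable.of_norm_bounded (summable_norm_Tm θ hθ s hs) (norm_Tc_le θ s F)

lemma euler_step (θ : Ideal (𝓞 K) →*₀ ℂ) (hθ : ∀ I, ‖θ I‖ ≤ 1) (s : ℝ) (hs : 1 < s)
    (F : Finset (HeightOneSpectrum (𝓞 K))) (q : HeightOneSpectrum (𝓞 K)) (hq : q ∉ F) [DecidableEq (HeightOneSpectrum (𝓞 K))] :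
    ∑' I, Tc θ s (insert q F) I = (∑' I, Tc θ s F I) * (1 - Tm K θ s q.asIdeal) := by
  classical
  have hq0 : q.asIdeal ≠ 0 := q.ne_bot
  have h1 : ∀ J, Tc θ s F (q.asIdeal * J) = Tm K θ s q.asIdeal * Tc θ s F J := by
    intro J
    unfold Tc
    have : (∀ q' ∈ F, ¬ q'.asIdeal ∣ q.asIdeal * J) ↔ (∀ q' ∈ F, ¬ q'.asIdeal ∣ J) := by
      refine forall₂_congr fun q' hq' => not_congr ?_
      rw [q'.prime.dvd_mul]
      constructor
      · rintro (h | h)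
        · exfalso
          have h2 : q'.asIdeal = q.asIdeal :=
            ((Ideal.dvd_iff_le.1 h).antisymm ((q.isMaximal.eq_of_le q'.isPrime.ne_top (Ideal.dvd_iff_le.1 h)).ge)).symm
          exact hq (HeightOneSpectrum.ext h2 ▸ hq')
        · exact h
      · exact Or.inr
    by_cases h : ∀ q' ∈ F, ¬ q'.asIdeal ∣ J
    · rw [if_pos (this.2 h), if_pos h, Tm_mul]
    · rw [if_neg (fun h' => h (this.1 h')), if_neg h, mul_zero]
  have hinj : Function.Injective (fun J : Ideal (𝓞 K) => q.asIdeal * J) := mul_right_injective₀ hq0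
  have h2 : ∑' J, Tc θ s F (q.asIdeal * J) = ∑' I, (Tc θ s F I - Tc θ s (insert q F) I) := by
    have h3 : ∀ I, Tc θ s F I - Tc θ s (insert q F) I = if q.asIdeal ∣ I then Tc θ s F I else 0 := by
      intro I
      unfold Tc
      by_cases hF : ∀ q' ∈ F, ¬ q'.asIdeal ∣ I <;> by_cases hI : q.asIdeal ∣ I <;>
        simp [Finset.forall_mem_insert, hI, hF]
    rw [tsum_congr h3]
    rw [← hinj.tsum_eq (f := fun I => if q.asIdeal ∣ I then Tc θ s F I else 0)]
    · refine tsum_congr fun J => ?_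
      simp
    · intro I hI
      rw [Function.mem_support] at hI
      have : q.asIdeal ∣ I := by
        by_contra h; rw [if_neg h] at hI; exact hI rfl
      obtain ⟨J, hJ⟩ := this
      exact ⟨J, hJ.symm⟩
  rw [Summable.tsum_sub (summable_Tc θ hθ s hs _) (summable_Tc θ hθ s hs _), tsum_congr h1, tsum_mul_left] at h2
  linear_combination h2

lemma euler_fin (θ : Ideal (𝓞 K) →*₀ ℂ) (hθ : ∀ I, ‖θ I‖ ≤ 1) (s : ℝ) (hs : 1 < s)
    (F : Finset (HeightOneSpectrum (𝓞 K))) :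
    ∑' I, Tc θ s F I = (∑' I, Tm K θ s I) * ∏ q ∈ F, (1 - Tm K θ s q.asIdeal) := by
  classical
  induction F using Finset.induction_on with
  | empty =>
    simp only [Finset.prod_empty, mul_one]
    refine tsum_congr fun I => ?_
    simp [Tc]
  | insert q F hq ih =>
    rw [euler_step θ hθ s hs F q hq, ih, Finset.prod_insert hq]; ring

lemma exists_prime_dvd {I : Ideal (𝓞 K)} (h : I ≠ ⊤) (h0 : I ≠ ⊥) :
    ∃ q : HeightOneSpectrum (𝓞 K), q.asIdeal ∣ I := by
  obtain ⟨M, hM, hI⟩ := Ideal.exists_le_maximal I h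
  refine ⟨⟨M, hM.isPrime, ?_⟩, Ideal.dvd_iff_le.2 hI⟩
  rintro rfl
  exact h0 (le_bot_iff.1 hI)

lemma euler_tendsto (θ : Ideal (𝓞 K) →*₀ ℂ) (hθ : ∀ I, ‖θ I‖ ≤ 1) (s : ℝ) (hs : 1 < s) :
    Tendsto (fun F : Finset (HeightOneSpectrum (𝓞 K)) => (∑' I, Tm K θ s I) * ∏ q ∈ F, (1 - Tm K θ s q.asIdeal))
      atTop (𝓝 1) := by
  classical
  have h1 : Tendsto (fun F : Finset (HeightOneSpectrum (𝓞 K)) => ∑' I, Tc θ s F I) atTop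
      (𝓝 (∑' I : Ideal (𝓞 K), if I = ⊤ then 1 else 0)) := by
    refine tendsto_tsum_of_dominated_convergence (summable_norm_Tm θ hθ s hs) (fun I => ?_)
      (Eventually.of_forall fun F I => norm_Tc_le θ s F I)
    by_cases hI : I = ⊤
    · rw [if_pos hI]
      refine tendsto_const_nhds.congr fun F => ?_
      unfold Tc
      rw [if_pos, hI]
      · unfold Tm
        rw [← Ideal.one_eq_top, map_one, map_one]; simp
      · intro q hq hd
        rw [hI] at hd
        exact q.isPrime.ne_top (top_le_iff.1 (Ideal.dvd_iff_le.1 hd))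
    · rw [if_neg hI]
      by_cases h0 : I = ⊥
      · refine tendsto_const_nhds.congr fun F => ?_
        unfold Tc
        rw [h0, Tm_zero, ite_self]
      · obtain ⟨q, hq⟩ := exists_prime_dvd hI h0
        refine tendsto_const_nhds.congr' ?_
        filter_upwards [eventually_ge_atTop {q}] with F hF
        unfold Tc
        rw [if_neg]
        intro h
        exact h q (hF (Finset.mem_singleton_self q)) hq
  rw [tsum_ite_eq] at h1
  exact h1.congr fun F => euler_fin θ hθ s hs F

lemma norm_Tm_prime_le (θ : Ideal (𝓞 K) →*₀ ℂ) (hθ : ∀ I, ‖θ I‖ ≤ 1) (s : ℝ) (q : HeightOneSpectrum (𝓞 K)) :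
    ‖Tm K θ s q.asIdeal‖ ≤ pn q s := norm_Tm_le θ hθ s _

lemma log_aux (z : ℂ) (hz : ‖z‖ ≤ 1 / 2) : |Real.log ‖1 - z‖ + z.re| ≤ ‖z‖ ^ 2 := by
  have h1 := Complex.norm_log_one_sub_inv_sub_self_le (z := z) (by linarith)
  have h2 := (Complex.abs_re_le_norm _).trans h1
  rw [Complex.sub_re, Complex.log_re, norm_inv, Real.log_inv, ← abs_neg] at h2
  have h3 : ‖z‖ ^ 2 * (1 - ‖z‖)⁻¹ / 2 ≤ ‖z‖ ^ 2 := by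
    have : (1 - ‖z‖)⁻¹ ≤ 2 := by
      rw [inv_le_comm₀ (by linarith) (by norm_num)]; linarith
    nlinarith [sq_nonneg ‖z‖]
  refine le_trans (le_of_eq ?_) (h2.trans h3)
  congr 1; ring

variable (K) in
/-- constant -/
noncomputable def Z2 : ℝ := ∑' q : HeightOneSpectrum (𝓞 K), pn q 2

lemma pn_sq_le (q : HeightOneSpectrum (𝓞 K)) (s : ℝ) (hs : 1 < s) : pn q s ^ 2 ≤ pn q 2 := by
  have h2 : (2:ℝ) ≤ (Ideal.absNorm q.asIdeal : ℝ) := by exact_mod_cast two_le_absNorm q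
  unfold pn
  rw [← Real.rpow_mul_natCast (by positivity)]
  exact Real.rpow_le_rpow_of_exponent_le (by linarith) (by push_cast; linarith)

lemma log_L (θ : Ideal (𝓞 K) →*₀ ℂ) (hθ : ∀ I, ‖θ I‖ ≤ 1) (s : ℝ) (hs : 1 < s) :
    |Real.log ‖∑' I, Tm K θ s I‖ - ∑' q : HeightOneSpectrum (𝓞 K), (Tm K θ s q.asIdeal).re| ≤ Z2 K := by
  set L := ∑' I, Tm K θ s I with hL
  have ht := euler_tendsto θ hθ s hs
  rw [← hL] at ht
  have hL0 : L ≠ 0 := by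
    intro h0
    simp only [h0, zero_mul] at ht
    exact zero_ne_one (tendsto_nhds_unique tendsto_const_nhds ht)
  have hz : ∀ q : HeightOneSpectrum (𝓞 K), ‖Tm K θ s q.asIdeal‖ ≤ 1 / 2 := fun q =>
    (norm_Tm_prime_le θ hθ s q).trans (pn_le_half q s hs)
  have hne : ∀ q : HeightOneSpectrum (𝓞 K), ‖1 - Tm K θ s q.asIdeal‖ ≠ 0 := by
    intro q h
    have h1 : (1:ℂ) = Tm K θ s q.asIdeal := sub_eq_zero.1 (norm_eq_zero.1 h)
    have h2 := hz q
    rw [← h1] at h2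
    norm_num at h2
  have ht2 : Tendsto (fun F : Finset (HeightOneSpectrum (𝓞 K)) =>
      Real.log ‖L‖ + ∑ q ∈ F, Real.log ‖1 - Tm K θ s q.asIdeal‖) atTop (𝓝 0) := by
    have h1 := (Real.continuousAt_log (x := ‖(1:ℂ)‖) (by simp)).tendsto.comp ht.norm
    rw [norm_one, Real.log_one] at h1
    refine h1.congr fun F => ?_
    rw [Function.comp_apply, norm_mul, norm_prod, Real.log_mul (norm_ne_zero_iff.2 hL0)
      (Finset.prod_ne_zero_iff.2 fun q _ => hne q), Real.log_prod fun q _ => hne q]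
  have hsum : Summable (fun q : HeightOneSpectrum (𝓞 K) => (Tm K θ s q.asIdeal).re) := by
    refine Summable.of_norm_bounded (summable_pn s hs) fun q => ?_
    rw [Real.norm_eq_abs]
    exact (Complex.abs_re_le_norm _).trans (norm_Tm_prime_le θ hθ s q)
  have hsum2 : Summable (fun q : HeightOneSpectrum (𝓞 K) => pn q 2) := summable_pn 2 (by norm_num)
  have ht3 : Tendsto (fun F : Finset (HeightOneSpectrum (𝓞 K)) =>
      |Real.log ‖L‖ - ∑ q ∈ F, (Tm K θ s q.asIdeal).re -
      (Real.log ‖L‖ + ∑ q ∈ F, Real.log ‖1 - Tm K θ s q.asIdeal‖)|) atTop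
      (𝓝 |Real.log ‖L‖ - ∑' q : HeightOneSpectrum (𝓞 K), (Tm K θ s q.asIdeal).re - 0|) :=
    ((tendsto_const_nhds.sub hsum.hasSum).sub ht2).abs
  rw [sub_zero] at ht3
  refine le_of_tendsto' ht3 (fun F => ?_)
  · rw [show Real.log ‖L‖ - ∑ q ∈ F, (Tm K θ s q.asIdeal).re -
      (Real.log ‖L‖ + ∑ q ∈ F, Real.log ‖1 - Tm K θ s q.asIdeal‖) =
      - ∑ q ∈ F, (Real.log ‖1 - Tm K θ s q.asIdeal‖ + (Tm K θ s q.asIdeal).re) by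
        rw [Finset.sum_add_distrib]; ring, abs_neg]
    refine (Finset.abs_sum_le_sum_abs _ _).trans ?_
    refine (Finset.sum_le_sum (g := fun q => pn q 2) fun q _ => ?_).trans
      (hsum2.sum_le_tsum F fun q _ => pn_nonneg q 2)
    refine (log_aux _ (hz q)).trans ((pow_le_pow_left₀ (norm_nonneg _) (norm_Tm_prime_le θ hθ s q) 2).trans
      (pn_sq_le q s hs))

end GenusRank

namespace GenusRank

open nonZeroDivisors Filter Topology

variable {K : Type*} [Field K] [NumberField K]

/-- partial prime sums -/
noncomputable def PS (S : Set (HeightOneSpectrum (𝓞 K))) (s : ℝ) : ℝ :=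
  ∑' q, S.indicator (fun q => pn q s) q

lemma summable_PS (S : Set (HeightOneSpectrum (𝓞 K))) (s : ℝ) (hs : 1 < s) :
    Summable (S.indicator (fun q => pn q s)) := (summable_pn s hs).indicator S

/-- upper density -/
def DLe (S : Set (HeightOneSpectrum (𝓞 K))) (a : ℝ) : Prop :=
  ∃ C : ℝ, ∀ᶠ s in 𝓝[>] (1:ℝ), PS S s ≤ a * (-Real.log (s - 1)) + C

/-- lower density -/
def DGe (S : Set (HeightOneSpectrum (𝓞 K))) (a : ℝ) : Prop :=
  ∃ C : ℝ, ∀ᶠ s in 𝓝[>] (1:ℝ), a * (-Real.log (s - 1)) - C ≤ PS S s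

lemma ev_one_two : ∀ᶠ s in 𝓝[>] (1:ℝ), 1 < s ∧ s ≤ 2 := by
  filter_upwards [Ioc_mem_nhdsGT (show (1:ℝ) < 2 by norm_num)] with s hs
  exact hs

lemma tendsto_log : Tendsto (fun s : ℝ => -Real.log (s - 1)) (𝓝[>] (1:ℝ)) atTop := by
  have h1 : Tendsto (fun s : ℝ => s - 1) (𝓝[>] (1:ℝ)) (𝓝[>] 0) := by
    refine tendsto_nhdsWithin_iff.2 ⟨?_, ?_⟩
    · have : Tendsto (fun s : ℝ => s - 1) (𝓝 1) (𝓝 (1 - 1)) := (continuous_id.sub continuous_const).tendsto 1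
      rw [sub_self] at this
      exact this.mono_left nhdsWithin_le_nhds
    · filter_upwards [self_mem_nhdsWithin] with s hs
      exact Set.mem_Ioi.2 (sub_pos.2 (Set.mem_Ioi.1 hs))
  exact tendsto_neg_atBot_atTop.comp (Real.tendsto_log_nhdsGT_zero.comp h1)

lemma density_le {S : Set (HeightOneSpectrum (𝓞 K))} {a b : ℝ} (h1 : DGe S a) (h2 : DLe S b) : a ≤ b := by
  obtain ⟨C, hC⟩ := h1
  obtain ⟨D, hD⟩ := h2
  by_contra hab
  push Not at hab
  have h3 := (tendsto_log.const_mul_atTop (sub_pos.2 hab)).eventually_gt_atTop (C + D)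
  obtain ⟨s, hs1, hs2, hs3⟩ := (hC.and (hD.and h3)).exists
  nlinarith

lemma PS_mono {S T : Set (HeightOneSpectrum (𝓞 K))} (h : S ⊆ T) (s : ℝ) (hs : 1 < s) : PS S s ≤ PS T s := by
  refine Summable.tsum_le_tsum (fun q => ?_) (summable_PS S s hs) (summable_PS T s hs)
  exact Set.indicator_le_indicator_of_subset h (fun q => pn_nonneg q s) q

lemma DGe.mono {S T : Set (HeightOneSpectrum (𝓞 K))} {a : ℝ} (h : DGe S a) (hST : S ⊆ T) : DGe T a := by
  obtain ⟨C, hC⟩ := h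
  refine ⟨C, ?_⟩
  filter_upwards [hC, ev_one_two] with s h1 h2
  exact h1.trans (PS_mono hST s h2.1)

lemma DLe.mono {S T : Set (HeightOneSpectrum (𝓞 K))} {a : ℝ} (h : DLe T a) (hST : S ⊆ T) : DLe S a := by
  obtain ⟨C, hC⟩ := h
  refine ⟨C, ?_⟩
  filter_upwards [hC, ev_one_two] with s h1 h2
  exact (PS_mono hST s h2.1).trans h1

lemma PS_union_le (S T : Set (HeightOneSpectrum (𝓞 K))) (s : ℝ) (hs : 1 < s) : PS (S ∪ T) s ≤ PS S s + PS T s := by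
  unfold PS
  rw [← Summable.tsum_add (summable_PS S s hs) (summable_PS T s hs)]
  refine Summable.tsum_le_tsum (fun q => ?_) (summable_PS _ s hs) ((summable_PS S s hs).add (summable_PS T s hs))
  have := pn_nonneg q s
  by_cases h1 : q ∈ S <;> by_cases h2 : q ∈ T <;> simp [Set.indicator, h1, h2, this]

lemma PS_union_disj {S T : Set (HeightOneSpectrum (𝓞 K))} (hd : Disjoint S T) (s : ℝ) (hs : 1 < s) :
    PS (S ∪ T) s = PS S s + PS T s := by
  unfold PS
  rw [← Summable.tsum_add (summable_PS S s hs) (summable_PS T s hs)]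
  refine tsum_congr fun q => ?_
  rw [Set.indicator_union_of_disjoint hd]

lemma PS_finite {S : Set (HeightOneSpectrum (𝓞 K))} (hS : S.Finite) (s : ℝ) (hs : 1 < s) :
    PS S s ≤ hS.toFinset.card := by
  unfold PS
  rw [tsum_eq_sum (s := hS.toFinset) (fun q hq => Set.indicator_of_notMem (by simpa using hq) _)]
  rw [Finset.card_eq_sum_ones]
  push_cast
  refine Finset.sum_le_sum fun q _ => ?_
  by_cases h : q ∈ S
  · rw [Set.indicator_of_mem h]; linarith [pn_le_half q s hs]
  · rw [Set.indicator_of_notMem h]; norm_num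

lemma DGe.add {S T : Set (HeightOneSpectrum (𝓞 K))} {a b : ℝ} (h1 : DGe S a) (h2 : DGe T b)
    (hd : Disjoint S T) : DGe (S ∪ T) (a + b) := by
  obtain ⟨C, hC⟩ := h1
  obtain ⟨D, hD⟩ := h2
  refine ⟨C + D, ?_⟩
  filter_upwards [hC, hD, ev_one_two] with s h1 h2 h3
  rw [PS_union_disj hd s h3.1]
  linarith

/-- remove a finite set -/
lemma DGe.diff_finite {S F : Set (HeightOneSpectrum (𝓞 K))} {a : ℝ} (h1 : DGe S a) (hF : F.Finite) :
    DGe (S \ F) a := by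
  obtain ⟨C, hC⟩ := h1
  refine ⟨C + hF.toFinset.card, ?_⟩
  filter_upwards [hC, ev_one_two] with s h1 h3
  have h4 := PS_mono (show S ⊆ (S \ F) ∪ F by rw [Set.diff_union_self]; exact Set.subset_union_left) s h3.1
  have h5 := PS_union_le (S \ F) F s h3.1
  have h6 := PS_finite hF s h3.1
  linarith

lemma DGe.diff {S T : Set (HeightOneSpectrum (𝓞 K))} {a b : ℝ} (h1 : DGe S a) (h2 : DLe T b) :
    DGe (S \ T) (a - b) := by
  obtain ⟨C, hC⟩ := h1
  obtain ⟨D, hD⟩ := h2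
  refine ⟨C + D, ?_⟩
  filter_upwards [hC, hD, ev_one_two] with s h1 h2 h3
  have h4 := PS_mono (show S ⊆ (S \ T) ∪ T by rw [Set.diff_union_self]; exact Set.subset_union_left) s h3.1
  have h5 := PS_union_le (S \ T) T s h3.1
  linarith

lemma zeta_eq (s : ℝ) (hs : 1 < s) : (∑' I, Tm K (triv K) s I) = dedekindZeta K (s : ℂ) := by
  have hS : Summable (fun I => Tm K (triv K) s I) := (summable_norm_Tm _ norm_triv_le s hs).of_norm
  let e := Equiv.sigmaFiberEquiv (fun I : Ideal (𝓞 K) => Ideal.absNorm I)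
  have h3 : Summable (fun p => Tm K (triv K) s (e p)) := e.summable_iff.2 hS
  rw [← e.tsum_eq, Summable.tsum_sigma h3]
  unfold dedekindZeta LSeries
  refine tsum_congr fun n => ?_
  rw [LSeries.term_def]
  by_cases hn : n = 0
  · rw [if_pos hn, ← tsum_zero]
    refine tsum_congr fun I => ?_
    have h1 : Ideal.absNorm I.1 = 0 := by rw [I.2, hn]
    rw [Ideal.absNorm_eq_zero_iff] at h1
    change Tm K (triv K) s I.1 = 0
    rw [h1, Tm_zero]
  · rw [if_neg hn]
    have h2 : ∀ I : {I : Ideal (𝓞 K) // Ideal.absNorm I = n}, Tm K (triv K) s (e ⟨n, I⟩) = (1 : ℂ) / (n : ℂ) ^ (s : ℂ) := by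
      intro I
      change Tm K (triv K) s I.1 = _
      rw [Tm_triv, I.2, Real.rpow_neg (by positivity)]
      · rw [Complex.ofReal_inv, Complex.ofReal_cpow (by positivity)]; simp
      · rintro h0
        apply hn
        rw [← I.2, h0]; simp
    have : Finite {I : Ideal (𝓞 K) // Ideal.absNorm I = n} := Ideal.finite_setOfPred_absNorm_eq n
    have := Fintype.ofFinite {I : Ideal (𝓞 K) // Ideal.absNorm I = n}
    rw [tsum_congr h2, tsum_fintype, Finset.sum_const, Finset.card_univ, Nat.card_eq_fintype_card]
    simp [div_eq_mul_inv]

variable (K) in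
lemma log_zeta : ∃ C : ℝ, ∀ᶠ s in 𝓝[>] (1:ℝ), |PS (Set.univ : Set (HeightOneSpectrum (𝓞 K))) s - (-Real.log (s - 1))| ≤ C := by
  have h1 := (tendsto_sub_one_mul_dedekindZeta_nhdsGT K).norm
  have hpos := dedekindZeta_residue_pos K
  have h2 := (Real.continuousAt_log (x := ‖((dedekindZeta_residue K : ℝ) : ℂ)‖)
    (by rw [Complex.norm_real]; simpa using hpos.ne')).tendsto.comp h1
  set R := Real.log ‖((dedekindZeta_residue K : ℝ) : ℂ)‖
  have h3 := h2.abs.eventually_le_const (show |R| < |R| + 1 by linarith)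
  refine ⟨Z2 K + |R| + 1, ?_⟩
  filter_upwards [h3, ev_one_two] with s h4 h5
  have h6 := log_L (triv K) norm_triv_le s h5.1
  rw [zeta_eq s h5.1] at h6
  have h7 : ∑' q : HeightOneSpectrum (𝓞 K), (Tm K (triv K) s q.asIdeal).re = PS (Set.univ : Set (HeightOneSpectrum (𝓞 K))) s := by
    unfold PS
    refine tsum_congr fun q => ?_
    rw [Tm_triv _ q.ne_bot, Complex.ofReal_re]
    simp [pn]
  rw [h7] at h6
  have hs1 : (0:ℝ) < s - 1 := by linarith [h5.1]
  simp only [Function.comp_apply] at h4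
  have hz : ‖dedekindZeta K s‖ ≠ 0 := by
    intro h0
    rw [norm_eq_zero] at h0
    have h8 := euler_tendsto (triv K) norm_triv_le s h5.1
    rw [zeta_eq s h5.1, h0] at h8
    simp only [zero_mul] at h8
    exact zero_ne_one (tendsto_nhds_unique tendsto_const_nhds h8)
  have h9 : ‖((s:ℂ) - 1) * dedekindZeta K s‖ = (s - 1) * ‖dedekindZeta K s‖ := by
    rw [norm_mul, show ((s:ℂ) - 1) = ((s - 1 : ℝ) : ℂ) by push_cast; ring, Complex.norm_real, Real.norm_of_nonneg hs1.le]
  rw [h9, Real.log_mul hs1.ne' hz] at h4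
  rw [abs_le] at *
  constructor <;> linarith [h4.1, h4.2, h6.1, h6.2]

lemma DGe_univ : DGe (Set.univ : Set (HeightOneSpectrum (𝓞 K))) 1 := by
  obtain ⟨C, hC⟩ := log_zeta K
  refine ⟨C, hC.mono fun s hs => ?_⟩
  rw [abs_le] at hs
  linarith [hs.1]

lemma DLe_univ : DLe (Set.univ : Set (HeightOneSpectrum (𝓞 K))) 1 := by
  obtain ⟨C, hC⟩ := log_zeta K
  refine ⟨C, hC.mono fun s hs => ?_⟩
  rw [abs_le] at hs
  linarith [hs.2]

lemma bounded_P (θ : Ideal (𝓞 K) →*₀ ℂ) (hθ : ∀ I, ‖θ I‖ ≤ 1) (m c : Ideal (𝓞 K)) (hc0 : c ≠ ⊥)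
    (hmc : m ⊔ c = ⊤) (hc1 : ‖θ c‖ = 1) (hcne : θ c ≠ 1)
    (hcong : ∀ x y : 𝓞 K, x ≠ 0 → y ≠ 0 → x - y ∈ m → 0 < Algebra.norm ℤ x * Algebra.norm ℤ y →
      θ (Ideal.span {x}) = θ (Ideal.span {y})) :
    ∃ C : ℝ, ∀ s, 1 < s → s ≤ 2 → ∑' q : HeightOneSpectrum (𝓞 K), (Tm K θ s q.asIdeal).re ≤ C := by
  obtain ⟨C, hC⟩ := bounded_L θ hθ m c hc0 hmc hc1 hcne hcong
  refine ⟨Z2 K + |C|, fun s hs hs2 => ?_⟩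
  have h1 := log_L θ hθ s hs
  have h2 := hC s hs hs2
  have h3 : Real.log ‖∑' I, Tm K θ s I‖ ≤ |C| := by
    refine (Real.log_le_self (norm_nonneg _)).trans (h2.trans (le_abs_self _))
  rw [abs_le] at h1
  linarith [h1.1]

end GenusRank

namespace GenusRank
open Filter Topology

section
variable {K : Type*} [Field K] [NumberField K]

/-- The data of a generalized ideal class map. -/
structure GMap (K : Type*) [Field K] [NumberField K] (A : Type*) [CommGroup A] where
  g : Ideal (𝓞 K) → A
  m : Ideal (𝓞 K)
  map_mul : ∀ I J, I ≠ ⊥ → J ≠ ⊥ → IsCoprime I m → IsCoprime J m → g (I * J) = g I * g J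
  cong : ∀ x y : 𝓞 K, x ≠ 0 → y ≠ 0 → IsCoprime (Ideal.span {x}) m → IsCoprime (Ideal.span {y}) m →
    x - y ∈ m → 0 < Algebra.norm ℤ x * Algebra.norm ℤ y → g (Ideal.span {x}) = g (Ideal.span {y})

variable {A : Type*} [CommGroup A]

lemma GMap.map_one (G : GMap K A) : G.g 1 = 1 := by
  have h1 : (1 : Ideal (𝓞 K)) ≠ ⊥ := by rw [Ideal.one_eq_top]; exact top_ne_bot
  have := G.map_mul 1 1 h1 h1 isCoprime_one_left isCoprime_one_left
  rw [mul_one] at this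
  exact (mul_eq_left.1 this.symm)

open scoped Classical in
/-- the twisted function -/
noncomputable def GMap.th (G : GMap K A) (χ : AddChar (Additive A) ℂ) : Ideal (𝓞 K) →*₀ ℂ where
  toFun I := if I ≠ ⊥ ∧ IsCoprime I G.m then χ (Additive.ofMul (G.g I)) else 0
  map_zero' := by
    rw [if_neg]
    rintro ⟨h, -⟩
    exact h rfl
  map_one' := by
    rw [if_pos, G.map_one, ofMul_one, AddChar.map_zero_eq_one]
    exact ⟨by rw [Ideal.one_eq_top]; exact top_ne_bot, isCoprime_one_left⟩
  map_mul' I J := by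
    by_cases h1 : I ≠ ⊥ ∧ IsCoprime I G.m
    · by_cases h2 : J ≠ ⊥ ∧ IsCoprime J G.m
      · rw [if_pos h1, if_pos h2, if_pos, G.map_mul I J h1.1 h2.1 h1.2 h2.2, ofMul_mul, AddChar.map_add_eq_mul]
        exact ⟨mul_ne_zero h1.1 h2.1, h1.2.mul_left h2.2⟩
      · rw [if_neg h2, if_neg, mul_zero]
        rintro ⟨h3, h4⟩
        exact h2 ⟨right_ne_zero_of_mul h3, (IsCoprime.mul_left_iff.1 h4).2⟩
    · rw [if_neg h1, if_neg, zero_mul]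
      rintro ⟨h3, h4⟩
      exact h1 ⟨left_ne_zero_of_mul h3, (IsCoprime.mul_left_iff.1 h4).1⟩

lemma GMap.th_pos (G : GMap K A) (χ : AddChar (Additive A) ℂ) (I : Ideal (𝓞 K)) (h : I ≠ ⊥) (h2 : IsCoprime I G.m) :
    G.th χ I = χ (Additive.ofMul (G.g I)) := if_pos ⟨h, h2⟩

lemma GMap.th_neg (G : GMap K A) (χ : AddChar (Additive A) ℂ) (I : Ideal (𝓞 K)) (h2 : ¬ IsCoprime I G.m) :
    G.th χ I = 0 := if_neg (fun h => h2 h.2)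

lemma GMap.norm_th [Finite A] (G : GMap K A) (χ : AddChar (Additive A) ℂ) (I : Ideal (𝓞 K)) : ‖G.th χ I‖ ≤ 1 := by
  by_cases h : I ≠ ⊥ ∧ IsCoprime I G.m
  · rw [G.th_pos χ I h.1 h.2, AddChar.norm_apply]
  · have : G.th χ I = 0 := if_neg h
    rw [this]; simp

lemma GMap.cong_th (G : GMap K A) (χ : AddChar (Additive A) ℂ) (x y : 𝓞 K) (hx : x ≠ 0) (hy : y ≠ 0)
    (hxy : x - y ∈ G.m) (hn : 0 < Algebra.norm ℤ x * Algebra.norm ℤ y) :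
    G.th χ (Ideal.span {x}) = G.th χ (Ideal.span {y}) := by
  have key : ∀ x y : 𝓞 K, x - y ∈ G.m → IsCoprime (Ideal.span {x}) G.m → IsCoprime (Ideal.span {y}) G.m := by
    intro x y h h1
    rw [Ideal.isCoprime_iff_sup_eq] at *
    rw [eq_top_iff, ← h1]
    refine sup_le ?_ le_sup_right
    rw [Ideal.span_singleton_le_iff_mem]
    have : x = y + (x - y) := by ring
    rw [this]
    exact Ideal.add_mem _ (Ideal.mem_sup_left (Ideal.mem_span_singleton_self y)) (Ideal.mem_sup_right h)
  by_cases hc : IsCoprime (Ideal.span {x}) G.m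
  · have hd := key x y hxy hc
    rw [G.th_pos χ _ (by simpa using hx) hc, G.th_pos χ _ (by simpa using hy) hd, G.cong x y hx hy hc hd hxy hn]
  · rw [G.th_neg χ _ hc, G.th_neg χ _ (fun h => hc (key y x (by rw [← neg_sub]; exact G.m.neg_mem hxy) h))]

lemma GMap.bound_chi [Finite A] (G : GMap K A) (hs : ∀ a : A, ∃ c : Ideal (𝓞 K), c ≠ ⊥ ∧ IsCoprime c G.m ∧ G.g c = a)
    (χ : AddChar (Additive A) ℂ) (hχ : χ ≠ 0) :
    ∃ C : ℝ, ∀ s, 1 < s → s ≤ 2 → ∑' q : HeightOneSpectrum (𝓞 K), (Tm K (G.th χ) s q.asIdeal).re ≤ C := by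
  obtain ⟨a, ha⟩ := AddChar.ne_zero_iff.1 hχ
  obtain ⟨c, hc0, hcm, hca⟩ := hs a.toMul
  have : G.th χ c = χ a := by rw [G.th_pos χ c hc0 hcm, hca]; rfl
  refine bounded_P (G.th χ) (G.norm_th χ) G.m c hc0 ?_ ?_ ?_ (G.cong_th χ)
  · rw [← Ideal.isCoprime_iff_sup_eq]; exact hcm.symm
  · rw [this, AddChar.norm_apply]
  · rw [this]; exact ha

/-- kernel primes -/
def GMap.ker (G : GMap K A) : Set (HeightOneSpectrum (𝓞 K)) := {q | IsCoprime q.asIdeal G.m ∧ G.g q.asIdeal = 1}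

lemma Tm_re_le (θ : Ideal (𝓞 K) →*₀ ℂ) (hθ : ∀ I, ‖θ I‖ ≤ 1) (s : ℝ) (q : HeightOneSpectrum (𝓞 K)) :
    (Tm K θ s q.asIdeal).re ≤ pn q s := by
  refine (Complex.re_le_norm _).trans ?_
  unfold Tm
  rw [norm_mul, Complex.norm_real]
  change ‖θ q.asIdeal‖ * ‖pn q s‖ ≤ pn q s
  rw [Real.norm_of_nonneg (pn_nonneg q s)]
  exact mul_le_of_le_one_left (pn_nonneg q s) (hθ _)

lemma norm_Tm_le_pn (θ : Ideal (𝓞 K) →*₀ ℂ) (hθ : ∀ I, ‖θ I‖ ≤ 1) (s : ℝ) (q : HeightOneSpectrum (𝓞 K)) :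
    ‖(Tm K θ s q.asIdeal).re‖ ≤ pn q s := by
  refine (Complex.abs_re_le_norm _).trans ?_
  unfold Tm
  rw [norm_mul, Complex.norm_real]
  change ‖θ q.asIdeal‖ * ‖pn q s‖ ≤ pn q s
  rw [Real.norm_of_nonneg (pn_nonneg q s)]
  exact mul_le_of_le_one_left (pn_nonneg q s) (hθ _)

lemma summable_Tm_re (θ : Ideal (𝓞 K) →*₀ ℂ) (hθ : ∀ I, ‖θ I‖ ≤ 1) (s : ℝ) (hs : 1 < s) :
    Summable fun q : HeightOneSpectrum (𝓞 K) => (Tm K θ s q.asIdeal).re :=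
  (summable_pn s hs).of_norm_bounded (norm_Tm_le_pn θ hθ s)

lemma GMap.orth [Fintype A] (G : GMap K A) (s : ℝ) (q : HeightOneSpectrum (𝓞 K)) :
    G.ker.indicator (fun q => pn q s) q * (Fintype.card A : ℝ) =
      ∑ χ : AddChar (Additive A) ℂ, (Tm K (G.th χ) s q.asIdeal).re := by
  classical
  by_cases hc : IsCoprime q.asIdeal G.m
  · have h1 : ∀ χ : AddChar (Additive A) ℂ, (Tm K (G.th χ) s q.asIdeal).re =
        (χ (Additive.ofMul (G.g q.asIdeal)) * ((pn q s : ℝ) : ℂ)).re := by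
      intro χ
      unfold Tm
      rw [G.th_pos χ _ q.ne_bot hc]
      rfl
    simp_rw [h1]
    rw [← Complex.re_sum, ← Finset.sum_mul, AddChar.sum_apply_eq_ite]
    by_cases hg : G.g q.asIdeal = 1
    · rw [Set.indicator_of_mem (show q ∈ G.ker from ⟨hc, hg⟩), if_pos (by rw [hg]; rfl)]
      rw [← Complex.ofReal_natCast, ← Complex.ofReal_mul, Complex.ofReal_re, mul_comm, Fintype.card_congr (Additive.ofMul (α := A))]
    · rw [Set.indicator_of_notMem (show q ∉ G.ker from fun h => hg h.2), if_neg]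
      · simp
      · exact hg
  · rw [Set.indicator_of_notMem (show q ∉ G.ker from fun h => hc h.1), zero_mul]
    refine (Finset.sum_eq_zero fun χ _ => ?_).symm
    unfold Tm
    rw [G.th_neg χ _ hc]
    simp

theorem GMap.density_surj [Finite A] (G : GMap K A)
    (hs : ∀ a : A, ∃ c : Ideal (𝓞 K), c ≠ ⊥ ∧ IsCoprime c G.m ∧ G.g c = a) :
    DLe G.ker (1 / (Nat.card A : ℝ)) := by
  classical
  have := Fintype.ofFinite A
  have hb : ∀ χ : AddChar (Additive A) ℂ, ∃ C : ℝ, χ ≠ 0 → ∀ s, 1 < s → s ≤ 2 →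
      ∑' q : HeightOneSpectrum (𝓞 K), (Tm K (G.th χ) s q.asIdeal).re ≤ C := by
    intro χ
    by_cases h : χ = 0
    · exact ⟨0, fun h1 => absurd h h1⟩
    · obtain ⟨C, hC⟩ := G.bound_chi hs χ h
      exact ⟨C, fun _ => hC⟩
  choose C hC using hb
  obtain ⟨D, hD⟩ := DLe_univ (K := K)
  have hA : (0:ℝ) < Fintype.card A := by exact_mod_cast Fintype.card_pos
  refine ⟨(D + ∑ χ ∈ Finset.univ.erase (0 : AddChar (Additive A) ℂ), C χ) / Fintype.card A, ?_⟩
  filter_upwards [hD, ev_one_two] with s h1 h2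
  have key : PS G.ker s * (Fintype.card A : ℝ) = ∑ χ : AddChar (Additive A) ℂ,
      ∑' q : HeightOneSpectrum (𝓞 K), (Tm K (G.th χ) s q.asIdeal).re := by
    unfold PS
    rw [← tsum_mul_right, tsum_congr (G.orth s)]
    exact Summable.tsum_finsetSum fun χ _ => summable_Tm_re _ (G.norm_th χ) s h2.1
  rw [← Finset.add_sum_erase _ _ (Finset.mem_univ (0 : AddChar (Additive A) ℂ))] at key
  have h3 : ∑' q : HeightOneSpectrum (𝓞 K), (Tm K (G.th 0) s q.asIdeal).re ≤ PS (Set.univ : Set (HeightOneSpectrum (𝓞 K))) s := by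
    unfold PS
    refine Summable.tsum_le_tsum (fun q => ?_) (summable_Tm_re _ (G.norm_th 0) s h2.1) (summable_PS _ s h2.1)
    rw [Set.indicator_of_mem (Set.mem_univ q)]
    exact Tm_re_le _ (G.norm_th 0) s q
  have h4 : ∑ χ ∈ Finset.univ.erase (0 : AddChar (Additive A) ℂ), ∑' q : HeightOneSpectrum (𝓞 K), (Tm K (G.th χ) s q.asIdeal).re
      ≤ ∑ χ ∈ Finset.univ.erase (0 : AddChar (Additive A) ℂ), C χ :=
    Finset.sum_le_sum fun χ hχ => hC χ (Finset.ne_of_mem_erase hχ) s h2.1 h2.2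
  rw [Nat.card_eq_fintype_card]
  have h5 : PS G.ker s ≤ (1 * (-Real.log (s - 1)) + D + ∑ χ ∈ Finset.univ.erase (0 : AddChar (Additive A) ℂ), C χ) / Fintype.card A := by
    rw [le_div_iff₀ hA, key]
    linarith
  refine h5.trans (le_of_eq ?_)
  field_simp
  ring

/-- the image subgroup -/
def GMap.im [Finite A] (G : GMap K A) : Subgroup A where
  carrier := {a | ∃ c : Ideal (𝓞 K), c ≠ ⊥ ∧ IsCoprime c G.m ∧ G.g c = a}
  one_mem' := ⟨1, by rw [Ideal.one_eq_top]; exact top_ne_bot, isCoprime_one_left, G.map_one⟩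
  mul_mem' := by
    rintro a b ⟨c, h1, h2, rfl⟩ ⟨d, h3, h4, rfl⟩
    exact ⟨c * d, mul_ne_zero h1 h3, h2.mul_left h4, G.map_mul c d h1 h3 h2 h4⟩
  inv_mem' := by
    rintro a ⟨c, h1, h2, rfl⟩
    have hp : ∀ n : ℕ, G.g (c ^ n) = G.g c ^ n := by
      intro n
      induction n with
      | zero => simpa using G.map_one
      | succ n ih => rw [pow_succ, G.map_mul _ _ (pow_ne_zero n h1) h1 h2.pow_left h2, ih, pow_succ]
    refine ⟨c ^ (Nat.card A - 1), pow_ne_zero _ h1, h2.pow_left, ?_⟩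
    rw [hp]
    refine eq_inv_of_mul_eq_one_left ?_
    rw [← pow_succ, Nat.sub_add_cancel Nat.card_pos, pow_card_eq_one']

lemma GMap.mem_im [Finite A] (G : GMap K A) {a : A} : a ∈ G.im ↔ ∃ c : Ideal (𝓞 K), c ≠ ⊥ ∧ IsCoprime c G.m ∧ G.g c = a := Iff.rfl

open scoped Classical in
/-- corestriction to the image -/
noncomputable def GMap.cores [Finite A] (G : GMap K A) : GMap K G.im where
  g I := if h : I ≠ ⊥ ∧ IsCoprime I G.m then ⟨G.g I, I, h.1, h.2, rfl⟩ else 1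
  m := G.m
  map_mul I J h1 h2 h3 h4 := by
    rw [dif_pos ⟨mul_ne_zero h1 h2, h3.mul_left h4⟩, dif_pos ⟨h1, h3⟩, dif_pos ⟨h2, h4⟩]
    exact Subtype.ext (G.map_mul I J h1 h2 h3 h4)
  cong x y hx hy h1 h2 h3 h4 := by
    rw [dif_pos ⟨by simpa using hx, h1⟩, dif_pos ⟨by simpa using hy, h2⟩]
    exact Subtype.ext (G.cong x y hx hy h1 h2 h3 h4)

lemma GMap.cores_g [Finite A] (G : GMap K A) (I : Ideal (𝓞 K)) (h1 : I ≠ ⊥) (h2 : IsCoprime I G.m) :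
    ((G.cores.g I : G.im) : A) = G.g I := by
  have : G.cores.g I = ⟨G.g I, I, h1, h2, rfl⟩ := dif_pos ⟨h1, h2⟩
  rw [this]

theorem GMap.density [Finite A] (G : GMap K A) : DLe G.ker (1 / (Nat.card G.im : ℝ)) := by
  refine (G.cores.density_surj ?_).mono ?_
  · rintro ⟨a, c, h1, h2, rfl⟩
    exact ⟨c, h1, h2, Subtype.ext (G.cores_g c h1 h2)⟩
  · rintro q ⟨h1, h2⟩
    exact ⟨h1, Subtype.ext ((G.cores_g _ q.ne_bot h1).trans h2)⟩
end
end GenusRank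

namespace GenusRank
open Filter Topology

section
variable {E M : Type*} [Field E] [NumberField E] [Field M] [NumberField M] [Algebra E M]

instance under_liesOver (P : HeightOneSpectrum (𝓞 M)) : P.asIdeal.LiesOver (P.under (𝓞 E)).asIdeal := ⟨rfl⟩

lemma absNorm_under (P : HeightOneSpectrum (𝓞 M)) : ∃ f : ℕ, 1 ≤ f ∧
    Ideal.absNorm P.asIdeal = Ideal.absNorm (P.under (𝓞 E)).asIdeal ^ f := by
  have h := Ideal.absNorm_eq_pow_inertiaDeg'_of_liesOver P.asIdeal (P.under (𝓞 E)).asIdeal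
    (P.under (𝓞 E)).isPrime (P.under (𝓞 E)).ne_bot
  refine ⟨_, ?_, h⟩
  by_contra h0
  have h1 : Ideal.inertiaDeg' (P.under (𝓞 E)).asIdeal P.asIdeal = 0 := by omega
  rw [h1, pow_zero] at h
  have := two_le_absNorm P
  omega

lemma card_fiber (q : HeightOneSpectrum (𝓞 E)) (F : Finset (HeightOneSpectrum (𝓞 M)))
    (hF : ∀ P ∈ F, P.under (𝓞 E) = q) : F.card ≤ Module.finrank E M := by
  classical
  have := q.isPrime.isMaximal q.ne_bot
  have : NoZeroSMulDivisors (𝓞 E) (𝓞 M) := ⟨fun {c x} h => smul_eq_zero.1 h⟩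
  have h := Ideal.card_primesOverFinset_le_finrank (R := 𝓞 E) (S := 𝓞 M) E M (p := q.asIdeal) q.ne_bot
  refine le_trans ?_ h
  rw [← Finset.card_image_of_injective F asIdeal_injective]
  refine Finset.card_le_card fun P hP => ?_
  obtain ⟨Q, hQ, rfl⟩ := Finset.mem_image.1 hP
  rw [IsDedekindDomain.mem_primesOverFinset_iff q.ne_bot]
  refine ⟨Q.isPrime, ?_⟩
  rw [← hF Q hQ]
  infer_instance

variable (E) in
/-- primes below -/
def below (T : Set (HeightOneSpectrum (𝓞 M))) : Set (HeightOneSpectrum (𝓞 E)) :=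
  {q | ∃ P ∈ T, P.under (𝓞 E) = q ∧ Ideal.absNorm P.asIdeal = Ideal.absNorm q.asIdeal}

lemma pn_down (T : Set (HeightOneSpectrum (𝓞 M))) (s : ℝ) (hs : 1 < s) (P : HeightOneSpectrum (𝓞 M)) :
    T.indicator (fun q => pn q s) P ≤
      (below E T).indicator (fun q => pn q s) (P.under (𝓞 E)) + pn (P.under (𝓞 E)) 2 := by
  have h0 : 0 ≤ (below E T).indicator (fun q => pn q s) (P.under (𝓞 E)) :=
    Set.indicator_nonneg (fun q _ => pn_nonneg q s) _
  have h1 := pn_nonneg (P.under (𝓞 E)) 2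
  by_cases hP : P ∈ T
  swap
  · rw [Set.indicator_of_notMem hP]; positivity
  rw [Set.indicator_of_mem hP]
  by_cases hn : Ideal.absNorm P.asIdeal = Ideal.absNorm (P.under (𝓞 E)).asIdeal
  · rw [Set.indicator_of_mem (show P.under (𝓞 E) ∈ below E T from ⟨P, hP, rfl, hn⟩)]
    have : pn P s = pn (P.under (𝓞 E)) s := by unfold pn; rw [hn]
    linarith
  · obtain ⟨f, hf, hN⟩ := absNorm_under (E := E) P
    have hf2 : 2 ≤ f := by
      by_contra hf2
      have : f = 1 := by omega
      rw [this, pow_one] at hN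
      exact hn hN
    have h2 : (1:ℝ) ≤ (Ideal.absNorm (P.under (𝓞 E)).asIdeal : ℝ) := by
      have := two_le_absNorm (P.under (𝓞 E))
      exact_mod_cast (by omega : 1 ≤ Ideal.absNorm (P.under (𝓞 E)).asIdeal)
    have h3 : pn P s ≤ pn (P.under (𝓞 E)) 2 := by
      unfold pn
      rw [hN]
      push_cast
      rw [← Real.rpow_natCast, ← Real.rpow_mul (by linarith)]
      refine Real.rpow_le_rpow_of_exponent_le h2 ?_
      have : (2:ℝ) ≤ f := by exact_mod_cast hf2
      nlinarith
    linarith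

lemma PS_down (T : Set (HeightOneSpectrum (𝓞 M))) (s : ℝ) (hs : 1 < s) :
    PS T s ≤ Module.finrank E M * (PS (below E T) s + ∑' q : HeightOneSpectrum (𝓞 E), pn q 2) := by
  classical
  set u : HeightOneSpectrum (𝓞 E) → ℝ := fun q => (below E T).indicator (fun q => pn q s) q + pn q 2 with hu
  have hu0 : ∀ q, 0 ≤ u q := fun q => add_nonneg (Set.indicator_nonneg (fun q _ => pn_nonneg q s) _) (pn_nonneg q 2)
  have hus : Summable u := (summable_PS _ s hs).add (summable_pn 2 one_lt_two)
  have hut : ∑' q, u q = PS (below E T) s + ∑' q : HeightOneSpectrum (𝓞 E), pn q 2 :=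
    Summable.tsum_add (summable_PS _ s hs) (summable_pn 2 one_lt_two)
  rw [← hut]
  refine (summable_PS T s hs).tsum_le_of_sum_le fun F => ?_
  refine (Finset.sum_le_sum fun P _ => pn_down (E := E) T s hs P).trans ?_
  change ∑ P ∈ F, u (P.under (𝓞 E)) ≤ _
  rw [Finset.sum_comp u (fun P : HeightOneSpectrum (𝓞 M) => P.under (𝓞 E))]
  refine le_trans ?_ (mul_le_mul_of_nonneg_left (hus.sum_le_tsum (F.image (fun P : HeightOneSpectrum (𝓞 M) => P.under (𝓞 E))) fun q _ => hu0 q) (Nat.cast_nonneg _))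
  rw [Finset.mul_sum]
  refine Finset.sum_le_sum fun q _ => ?_
  rw [nsmul_eq_mul]
  refine mul_le_mul_of_nonneg_right ?_ (hu0 q)
  exact_mod_cast card_fiber q _ fun P hP => (Finset.mem_filter.1 hP).2

theorem DGe.down {T : Set (HeightOneSpectrum (𝓞 M))} {a : ℝ} (h : DGe T a) :
    DGe (below E T) (a / Module.finrank E M) := by
  obtain ⟨C, hC⟩ := h
  have hn : (0:ℝ) < Module.finrank E M := by
    exact_mod_cast Module.finrank_pos
  refine ⟨C / Module.finrank E M + ∑' q : HeightOneSpectrum (𝓞 E), pn q 2, ?_⟩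
  filter_upwards [hC, ev_one_two] with s h1 h2
  have h3 := h1.trans (PS_down (E := E) T s h2.1)
  rw [← div_le_iff₀' hn] at h3
  have : (a * -Real.log (s - 1) - C) / (Module.finrank E M : ℝ) = a / Module.finrank E M * -Real.log (s - 1) - C / Module.finrank E M := by
    ring
  linarith

variable (E M) in
/-- primes having a degree one prime above -/
def Spl : Set (HeightOneSpectrum (𝓞 E)) := below E (Set.univ : Set (HeightOneSpectrum (𝓞 M)))

variable (E M) in
theorem DGe_Spl : DGe (Spl E M) (1 / Module.finrank E M) := DGe_univ.down

end
end GenusRank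

namespace GenusRank
open Filter Topology nonZeroDivisors

section
variable {k K : Type*} [Field k] [NumberField k] [Field K] [NumberField K] [Algebra k K]

open scoped Classical in
/-- class of an ideal -/
noncomputable def cl (I : Ideal (𝓞 k)) : ClassGroup (𝓞 k) :=
  if h : I ≠ ⊥ then ClassGroup.mk0 ⟨I, mem_nonZeroDivisors_of_ne_zero h⟩ else 1

lemma cl_of {I : Ideal (𝓞 k)} (h : I ≠ ⊥) : cl I = ClassGroup.mk0 ⟨I, mem_nonZeroDivisors_of_ne_zero h⟩ := dif_pos h

lemma cl_mk0 (I : (Ideal (𝓞 k))⁰) : cl (I : Ideal (𝓞 k)) = ClassGroup.mk0 I :=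
  cl_of (nonZeroDivisors.coe_ne_zero I)

lemma cl_mul {I J : Ideal (𝓞 k)} (hI : I ≠ ⊥) (hJ : J ≠ ⊥) : cl (I * J) = cl I * cl J := by
  rw [cl_of hI, cl_of hJ, cl_of (mul_ne_zero hI hJ), ← map_mul]
  rfl

lemma cl_one : cl (1 : Ideal (𝓞 k)) = 1 := by
  have h1 : (1 : Ideal (𝓞 k)) ≠ ⊥ := by rw [Ideal.one_eq_top]; exact top_ne_bot
  rw [cl_of h1]
  exact map_one _

lemma cl_pow {I : Ideal (𝓞 k)} (hI : I ≠ ⊥) (n : ℕ) : cl (I ^ n) = cl I ^ n := by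
  induction n with
  | zero => simpa using cl_one
  | succ n ih => rw [pow_succ, cl_mul (pow_ne_zero n hI) hI, ih, pow_succ]

lemma cl_eq_one_iff {I : Ideal (𝓞 k)} (hI : I ≠ ⊥) : cl I = 1 ↔ ∃ x ≠ 0, I = Ideal.span {x} := by
  rw [cl_of hI, ClassGroup.mk0_eq_one_iff]
  constructor
  · rintro ⟨x, hx⟩
    refine ⟨x, ?_, hx⟩
    rintro rfl
    exact hI (by rw [hx]; simp)
  · rintro ⟨x, _, hx⟩
    exact ⟨x, hx⟩

lemma span_ne_bot {x : 𝓞 k} (hx : x ≠ 0) : Ideal.span {x} ≠ ⊥ := by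
  rwa [Ne, Ideal.span_singleton_eq_bot]

lemma cl_span (x : 𝓞 k) : cl (Ideal.span {x}) = 1 := by
  by_cases hx : x = 0
  · rw [hx]; exact dif_neg (by simp)
  · exact (cl_eq_one_iff (span_ne_bot hx)).2 ⟨x, hx, rfl⟩

lemma cl_eq_iff {I J : Ideal (𝓞 k)} (hI : I ≠ ⊥) (hJ : J ≠ ⊥) :
    cl I = cl J ↔ ∃ x y : 𝓞 k, x ≠ 0 ∧ y ≠ 0 ∧ Ideal.span {x} * I = Ideal.span {y} * J := by
  rw [cl_of hI, cl_of hJ, ClassGroup.mk0_eq_mk0_iff]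
  constructor
  · rintro ⟨x, y, hx, hy, h⟩; exact ⟨x, y, hx, hy, h⟩
  · rintro ⟨x, y, hx, hy, h⟩; exact ⟨x, y, hx, hy, h⟩

lemma cl_surj (c : ClassGroup (𝓞 k)) : ∃ I : Ideal (𝓞 k), I ≠ ⊥ ∧ cl I = c := by
  obtain ⟨I, rfl⟩ := ClassGroup.mk0_surjective c
  exact ⟨I, nonZeroDivisors.coe_ne_zero I, cl_mk0 I⟩

/-- descend an ideal function to the class group -/
noncomputable def liftCl {G : Type*} [CommGroup G] (f : Ideal (𝓞 k) → G)
    (hmul : ∀ I J, I ≠ ⊥ → J ≠ ⊥ → f (I * J) = f I * f J) (hspan : ∀ x, x ≠ 0 → f (Ideal.span {x}) = 1) :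
    ClassGroup (𝓞 k) →* G :=
  MonoidHom.mk' (fun c => f (cl_surj c).choose) fun a b => by
    have key : ∀ I J : Ideal (𝓞 k), I ≠ ⊥ → J ≠ ⊥ → cl I = cl J → f I = f J := by
      intro I J hI hJ h
      obtain ⟨x, y, hx, hy, h⟩ := (cl_eq_iff hI hJ).1 h
      have := congrArg f h
      rwa [hmul _ _ (span_ne_bot hx) hI, hmul _ _ (span_ne_bot hy) hJ, hspan x hx, hspan y hy, one_mul, one_mul] at this
    rw [← hmul _ _ (cl_surj a).choose_spec.1 (cl_surj b).choose_spec.1]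
    refine key _ _ (cl_surj (a * b)).choose_spec.1 (mul_ne_zero (cl_surj a).choose_spec.1 (cl_surj b).choose_spec.1) ?_
    rw [(cl_surj (a * b)).choose_spec.2, cl_mul (cl_surj a).choose_spec.1 (cl_surj b).choose_spec.1,
      (cl_surj a).choose_spec.2, (cl_surj b).choose_spec.2]

lemma liftCl_cl {G : Type*} [CommGroup G] (f : Ideal (𝓞 k) → G)
    (hmul : ∀ I J, I ≠ ⊥ → J ≠ ⊥ → f (I * J) = f I * f J) (hspan : ∀ x, x ≠ 0 → f (Ideal.span {x}) = 1)
    (I : Ideal (𝓞 k)) (hI : I ≠ ⊥) : liftCl f hmul hspan (cl I) = f I := by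
  have key : ∀ I J : Ideal (𝓞 k), I ≠ ⊥ → J ≠ ⊥ → cl I = cl J → f I = f J := by
    intro I J hI hJ h
    obtain ⟨x, y, hx, hy, h⟩ := (cl_eq_iff hI hJ).1 h
    have := congrArg f h
    rwa [hmul _ _ (span_ne_bot hx) hI, hmul _ _ (span_ne_bot hy) hJ, hspan x hx, hspan y hy, one_mul, one_mul] at this
  exact key _ _ (cl_surj (cl I)).choose_spec.1 hI (cl_surj (cl I)).choose_spec.2

lemma relNorm_ne_bot {I : Ideal (𝓞 K)} (hI : I ≠ ⊥) : Ideal.relNorm (𝓞 k) I ≠ ⊥ := by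
  rwa [Ne, Ideal.relNorm_eq_bot_iff]

variable (k K) in
/-- norm on class groups -/
noncomputable def clNorm : ClassGroup (𝓞 K) →* ClassGroup (𝓞 k) :=
  liftCl (fun I => cl (Ideal.relNorm (𝓞 k) I))
    (fun I J hI hJ => by rw [map_mul, cl_mul (relNorm_ne_bot hI) (relNorm_ne_bot hJ)])
    (fun x hx => by rw [Ideal.relNorm_singleton, cl_span])

lemma clNorm_cl (I : Ideal (𝓞 K)) (hI : I ≠ ⊥) : clNorm k K (cl I) = cl (Ideal.relNorm (𝓞 k) I) :=
  liftCl_cl _ _ _ I hI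

lemma map_ne_bot' {I : Ideal (𝓞 k)} (hI : I ≠ ⊥) : I.map (algebraMap (𝓞 k) (𝓞 K)) ≠ ⊥ := by
  intro h
  rw [Ideal.map_eq_bot_iff_of_injective (FaithfulSMul.algebraMap_injective (𝓞 k) (𝓞 K))] at h
  exact hI h

variable (k K) in
/-- extension on class groups -/
noncomputable def clExt : ClassGroup (𝓞 k) →* ClassGroup (𝓞 K) :=
  liftCl (fun I => cl (I.map (algebraMap (𝓞 k) (𝓞 K))))
    (fun I J hI hJ => by rw [Ideal.map_mul, cl_mul (map_ne_bot' hI) (map_ne_bot' hJ)])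
    (fun x hx => by rw [Ideal.map_span, Set.image_singleton, cl_span])

lemma clExt_cl (I : Ideal (𝓞 k)) (hI : I ≠ ⊥) : clExt k K (cl I) = cl (I.map (algebraMap (𝓞 k) (𝓞 K))) :=
  liftCl_cl _ _ _ I hI

lemma relNorm_map (I : Ideal (𝓞 k)) :
    Ideal.relNorm (𝓞 k) (I.map (algebraMap (𝓞 k) (𝓞 K))) = I ^ Module.finrank k K := by
  rw [Ideal.relNorm_algebraMap (R := 𝓞 k) (S := 𝓞 K) I]
  congr 1
  exact (Algebra.IsAlgebraic.finrank_of_isFractionRing (𝓞 k) k (𝓞 K) K).symm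

lemma clNorm_clExt (c : ClassGroup (𝓞 k)) : clNorm k K (clExt k K c) = c ^ Module.finrank k K := by
  obtain ⟨I, hI, rfl⟩ := cl_surj c
  rw [clExt_cl I hI, clNorm_cl _ (map_ne_bot' hI), relNorm_map, cl_pow hI]

variable (k K) in
/-- the norm subgroup -/
noncomputable def NCl : Subgroup (ClassGroup (𝓞 k)) := (clNorm k K).range

lemma relNorm_mem_NCl (I : Ideal (𝓞 K)) (hI : I ≠ ⊥) : cl (Ideal.relNorm (𝓞 k) I) ∈ NCl k K :=
  ⟨cl I, clNorm_cl I hI⟩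

lemma pow_mem_NCl (c : ClassGroup (𝓞 k)) : c ^ Module.finrank k K ∈ NCl k K := ⟨clExt k K c, clNorm_clExt c⟩

lemma relNorm_of_absNorm (P : HeightOneSpectrum (𝓞 K)) (q : HeightOneSpectrum (𝓞 k)) (hq : P.under (𝓞 k) = q)
    (hn : Ideal.absNorm P.asIdeal = Ideal.absNorm q.asIdeal) : Ideal.relNorm (𝓞 k) P.asIdeal = q.asIdeal := by
  subst hq
  have hp := (P.under (𝓞 k)).isPrime
  obtain ⟨s, hs⟩ := Ideal.exists_relNorm_eq_pow_of_isPrime P.asIdeal (P.under (𝓞 k)).asIdeal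
  have h1 := congrArg Ideal.absNorm hs
  rw [Ideal.absNorm_relNorm, hn, map_pow] at h1
  have h2 := two_le_absNorm (P.under (𝓞 k))
  have : s = 1 := by
    have := Nat.pow_right_injective h2 (by simpa using h1.symm : Ideal.absNorm (P.under (𝓞 k)).asIdeal ^ s = Ideal.absNorm (P.under (𝓞 k)).asIdeal ^ 1)
    exact this
  rw [hs, this, pow_one]

end
end GenusRank

namespace GenusRank
open Filter Topology nonZeroDivisors

section
variable {k K : Type*} [Field k] [NumberField k] [Field K] [NumberField K] [Algebra k K]

variable (k K) in
/-- ramified finite primes -/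
def Ram : Set (HeightOneSpectrum (𝓞 k)) := {v : HeightOneSpectrum (𝓞 k) | ∃ Q : Ideal (𝓞 K), Q.IsPrime ∧ Q ≠ ⊥ ∧
      Q ^ 2 ∣ Ideal.map (algebraMap (𝓞 k) (𝓞 K)) v.asIdeal}

lemma under_eq_of_dvd (Q : HeightOneSpectrum (𝓞 K)) (v : HeightOneSpectrum (𝓞 k))
    (h : Q.asIdeal ∣ Ideal.map (algebraMap (𝓞 k) (𝓞 K)) v.asIdeal) : Q.under (𝓞 k) = v := by
  apply asIdeal_injective
  have h1 : v.asIdeal ≤ (Q.under (𝓞 k)).asIdeal := by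
    rw [Ideal.dvd_iff_le, Ideal.map_le_iff_le_comap] at h
    exact h
  have := v.isPrime.isMaximal v.ne_bot
  exact (this.eq_of_le (Q.under (𝓞 k)).isPrime.ne_top h1).symm

lemma dvd_map_under (Q : HeightOneSpectrum (𝓞 K)) :
    Q.asIdeal ∣ Ideal.map (algebraMap (𝓞 k) (𝓞 K)) (Q.under (𝓞 k)).asIdeal := by
  rw [Ideal.dvd_iff_le, Ideal.map_le_iff_le_comap]
  exact le_rfl

variable (k K) in
lemma finite_Ram : (Ram k K).Finite := by
  have hd : differentIdeal (𝓞 k) (𝓞 K) ≠ ⊥ := differentIdeal_ne_bot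
  refine ((Ideal.finite_factors hd).image (fun Q : HeightOneSpectrum (𝓞 K) => Q.under (𝓞 k))).subset ?_
  rintro v ⟨Q, hQ, hQ0, hdvd⟩
  refine ⟨⟨Q, hQ, hQ0⟩, ?_, under_eq_of_dvd _ v ((dvd_pow_self Q two_ne_zero).trans hdvd)⟩
  have := v.isPrime.isMaximal v.ne_bot
  have h := pow_sub_one_dvd_differentIdeal (𝓞 k) (p := v.asIdeal) Q 2 v.ne_bot hdvd
  simpa using h

lemma finite_not_coprime (I : Ideal (𝓞 k)) (hI : I ≠ ⊥) :
    {q : HeightOneSpectrum (𝓞 k) | ¬ IsCoprime q.asIdeal I}.Finite := by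
  refine (Ideal.finite_factors hI).subset fun q hq => ?_
  by_contra h
  refine hq ?_
  have := q.isPrime.isMaximal q.ne_bot
  rw [Ideal.isCoprime_iff_sup_eq]
  refine this.1.2 _ (lt_of_le_of_ne le_sup_left fun h1 => h ?_)
  change q.asIdeal ∣ I
  rw [Ideal.dvd_iff_le, h1]
  exact le_sup_right

lemma coprime_absNorm (I : Ideal (𝓞 k)) (m : ℕ) (h : IsCoprime I (Ideal.span {(m : 𝓞 k)})) :
    Nat.Coprime (Ideal.absNorm I) m := by
  by_contra hn
  obtain ⟨r, hr, h1, h2⟩ := Nat.Prime.not_coprime_iff_dvd.1 hn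
  obtain ⟨P, hP, h3, h4⟩ := Ideal.exists_isMaximal_dvd_of_dvd_absNorm (Nat.prime_iff_prime_int.1 hr) I (by exact_mod_cast h1)
  rw [Ideal.isCoprime_iff_sup_eq] at h
  apply hP.ne_top
  rw [eq_top_iff, ← h]
  refine sup_le (Ideal.dvd_iff_le.1 h4) ?_
  rw [Ideal.span_singleton_le_iff_mem]
  obtain ⟨m', rfl⟩ := h2
  have : ((r : ℤ)) ∈ P.under ℤ := by rw [h3]; exact Ideal.mem_span_singleton_self _
  rw [Ideal.under_def, Ideal.mem_comap] at this
  push_cast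
  refine Ideal.mul_mem_right _ _ ?_
  simpa using this

lemma norm_congr (x y : 𝓞 k) (m : ℕ) (h : x - y ∈ Ideal.span {(m : 𝓞 k)}) :
    ((Algebra.norm ℤ x : ℤ) : ZMod m) = (Algebra.norm ℤ y : ℤ) := by
  obtain ⟨z, hz⟩ := Ideal.mem_span_singleton'.1 h
  have hx : x = y + (m : ℤ) • z := by
    rw [zsmul_eq_mul, Int.cast_natCast, mul_comm, hz]; ring
  classical
  let b := RingOfIntegers.basis k
  rw [Algebra.norm_eq_matrix_det b x, Algebra.norm_eq_matrix_det b y]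
  have h1 : ∀ M : Matrix (Module.Free.ChooseBasisIndex ℤ (𝓞 k)) (Module.Free.ChooseBasisIndex ℤ (𝓞 k)) ℤ, ((M.det : ℤ) : ZMod m) = (M.map (Int.castRingHom (ZMod m))).det := by
    intro M
    exact (Int.castRingHom (ZMod m)).map_det M
  rw [h1, h1, hx]
  congr 1
  ext i j
  rw [map_add, map_zsmul, Matrix.map_apply, Matrix.map_apply, Matrix.add_apply, Matrix.smul_apply]
  simp

lemma absNorm_mod (L : Type*) [Field L] [NumberField L] (m : ℕ) (hm : m ≠ 0) (ζ : L) (hζ : IsPrimitiveRoot ζ m)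
    (P : HeightOneSpectrum (𝓞 L)) (hP : Nat.Coprime (Ideal.absNorm P.asIdeal) m) :
    ((Ideal.absNorm P.asIdeal : ℕ) : ZMod m) = 1 := by
  have : NeZero m := ⟨hm⟩
  have hmax := P.isPrime.isMaximal P.ne_bot
  have h1 := IsPrimitiveRoot.idealQuotient_mk (I := P.asIdeal) hζ.toInteger_isPrimitiveRoot
    (by have := two_le_absNorm P; omega) hP
  letI := Ideal.Quotient.field P.asIdeal
  have hu : IsUnit ((Ideal.Quotient.mk P.asIdeal) hζ.toInteger) := h1.isUnit hm
  obtain ⟨u, hu⟩ := hu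
  have h2 := h1
  rw [← hu, IsPrimitiveRoot.coe_units_iff] at h2
  have h3 : m ∣ Nat.card (𝓞 L ⧸ P.asIdeal)ˣ := by
    rw [h2.eq_orderOf]
    exact orderOf_dvd_natCard u
  rw [Nat.card_units] at h3
  have h4 : Nat.card (𝓞 L ⧸ P.asIdeal) = Ideal.absNorm P.asIdeal := rfl
  rw [h4] at h3
  have h5 := two_le_absNorm P
  have h6 : ((Ideal.absNorm P.asIdeal - 1 : ℕ) : ZMod m) = 0 := (ZMod.natCast_eq_zero_iff _ _).2 h3
  rw [Nat.cast_sub (by omega)] at h6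
  simpa [sub_eq_zero] using h6
end
end GenusRank

namespace GenusRank
open Filter Topology nonZeroDivisors
open scoped Pointwise

section
variable {k K : Type*} [Field k] [NumberField k] [Field K] [NumberField K] [Algebra k K]

instance smulComm_gal : SMulCommClass (K ≃ₐ[k] K) (𝓞 k) (𝓞 K) where
  smul_comm g a x := by
    apply RingOfIntegers.ext
    change g ((a • x : 𝓞 K) : K) = ((a • (g • x) : 𝓞 K) : K)
    rw [Algebra.smul_def, Algebra.smul_def]
    change g (algebraMap k K (a : k) * (x : K)) = algebraMap k K (a : k) * g (x : K)
    rw [map_mul]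
    congr 1
    change g (algebraMap k K (a : k)) = algebraMap k K (a : k)
    exact g.commutes _

lemma absNorm_smul (g : K ≃ₐ[k] K) (I : Ideal (𝓞 K)) : Ideal.absNorm (g • I) = Ideal.absNorm I := by
  rw [← Ideal.absNorm_relNorm (𝓞 k), Ideal.relNorm_smul, Ideal.absNorm_relNorm]

lemma smul_dvd_map (g : K ≃ₐ[k] K) (P : Ideal (𝓞 K)) (v : Ideal (𝓞 k))
    (h : P ∣ Ideal.map (algebraMap (𝓞 k) (𝓞 K)) v) : g • P ∣ Ideal.map (algebraMap (𝓞 k) (𝓞 K)) v := by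
  rw [Ideal.dvd_iff_le, Ideal.map_le_iff_le_comap] at *
  intro x hx
  rw [Ideal.mem_comap, Ideal.mem_pointwise_smul_iff_inv_smul_mem, smul_algebraMap]
  exact h hx

lemma smul_prime (g : K ≃ₐ[k] K) (P : Ideal (𝓞 K)) (h : Prime P) : Prime (g • P) := by
  have h1 := Ideal.isPrime_of_prime h
  have h2 : (g • P).IsPrime := inferInstance
  refine Ideal.prime_of_isPrime ?_ h2
  intro h3
  apply h.ne_zero
  rw [← inv_smul_smul g P, h3]
  exact Ideal.map_bot

/-- a prime not fixed by an automorphism of prime order has degree one -/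
lemma smul_eq_of_ne {ℓ : ℕ} (hℓ : ℓ.Prime) (hK : Module.finrank k K = ℓ) (g : K ≃ₐ[k] K) (hg : g ^ ℓ = 1)
    (P : HeightOneSpectrum (𝓞 K)) (hP : Ideal.absNorm P.asIdeal ≠ Ideal.absNorm (P.under (𝓞 k)).asIdeal) :
    g • P.asIdeal = P.asIdeal := by
  classical
  by_contra hne
  set f : Ideal (𝓞 K) → Ideal (𝓞 K) := fun I => g • I with hf
  have hit : ∀ n I, f^[n] I = g ^ n • I := by
    intro n I
    rw [hf, smul_iterate]
  have hper : Function.IsPeriodicPt f ℓ P.asIdeal := by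
    change f^[ℓ] P.asIdeal = P.asIdeal
    rw [hit, hg, one_smul]
  have hmp : Function.minimalPeriod f P.asIdeal = ℓ := by
    rcases (Nat.dvd_prime hℓ).1 hper.minimalPeriod_dvd with h | h
    · exact absurd (Function.minimalPeriod_eq_one_iff_isFixedPt.1 h) hne
    · exact h
  have hinj := Function.iterate_injOn_Iio_minimalPeriod (f := f) (x := P.asIdeal)
  rw [hmp] at hinj
  have hdvd : ∏ Q ∈ (Finset.range ℓ).image (fun n => f^[n] P.asIdeal), Q ∣ Ideal.map (algebraMap (𝓞 k) (𝓞 K)) (P.under (𝓞 k)).asIdeal := by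
    refine Finset.prod_primes_dvd _ ?_ ?_
    · intro Q hQ
      obtain ⟨n, _, rfl⟩ := Finset.mem_image.1 hQ
      rw [hit]
      exact smul_prime _ _ P.prime
    · intro Q hQ
      obtain ⟨n, _, rfl⟩ := Finset.mem_image.1 hQ
      rw [hit]
      exact smul_dvd_map _ _ _ (dvd_map_under P)
  rw [Finset.prod_image (by simpa [Set.InjOn, Set.Iio] using hinj)] at hdvd
  have h1 := Ideal.absNorm_dvd_absNorm_of_le (Ideal.dvd_iff_le.1 hdvd)
  have h2 : Ideal.absNorm (Ideal.map (algebraMap (𝓞 k) (𝓞 K)) (P.under (𝓞 k)).asIdeal) = Ideal.absNorm (P.under (𝓞 k)).asIdeal ^ ℓ := by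
    rw [← Ideal.absNorm_relNorm (𝓞 k), relNorm_map, map_pow, hK]
  rw [h2, map_prod] at h1
  simp_rw [hit, absNorm_smul] at h1
  rw [Finset.prod_const, Finset.card_range, Nat.pow_dvd_pow_iff hℓ.ne_zero] at h1
  obtain ⟨e, he, hN⟩ := absNorm_under (E := k) P
  refine hP (Nat.dvd_antisymm h1 ?_)
  rw [hN]
  exact dvd_pow_self _ (by omega)

/-- a prime fixed by the Galois group is ramified or inert -/
lemma mem_Ram_of_fixed {ℓ : ℕ} (hℓ : ℓ.Prime) (hK : Module.finrank k K = ℓ) [IsGalois k K]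
    (P : HeightOneSpectrum (𝓞 K)) (hP : ∀ g : K ≃ₐ[k] K, g • P.asIdeal = P.asIdeal)
    (hS : P.under (𝓞 k) ∈ Spl k K) : P.under (𝓞 k) ∈ Ram k K := by
  have huniq : ∀ Q : HeightOneSpectrum (𝓞 K), Q.under (𝓞 k) = P.under (𝓞 k) → Q = P := by
    intro Q hQ
    apply asIdeal_injective
    have := P.isPrime
    have := Q.isPrime
    have : Q.asIdeal.LiesOver (P.under (𝓞 k)).asIdeal := by rw [← hQ]; infer_instance
    obtain ⟨g, hg⟩ := Ideal.exists_smul_eq_of_isGaloisGroup (P.under (𝓞 k)).asIdeal P.asIdeal Q.asIdeal (K ≃ₐ[k] K)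
    exact hg.symm.trans (hP g)
  by_contra hr
  obtain ⟨J, hJ⟩ := dvd_map_under (k := k) P
  have h1 : J = 1 := by
    by_contra hJ1
    rw [Ideal.one_eq_top] at hJ1
    obtain ⟨M, hM, hJM⟩ := Ideal.exists_le_maximal J hJ1
    have hM0 : M ≠ ⊥ := by
      rintro rfl
      rw [le_bot_iff] at hJM
      rw [hJM] at hJ
      exact map_ne_bot' (P.under (𝓞 k)).ne_bot (hJ.trans (Ideal.mul_bot _))
    rw [← Ideal.dvd_iff_le] at hJM
    have := huniq ⟨M, hM.isPrime, hM0⟩ (under_eq_of_dvd ⟨M, hM.isPrime, hM0⟩ _ (by rw [hJ]; exact hJM.mul_left _))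
    apply hr
    refine ⟨P.asIdeal, P.isPrime, P.ne_bot, ?_⟩
    rw [hJ, pow_two]
    refine mul_dvd_mul_left _ ?_
    rw [← this]
    exact hJM
  rw [h1, mul_one] at hJ
  have h2 : Ideal.absNorm (Ideal.map (algebraMap (𝓞 k) (𝓞 K)) (P.under (𝓞 k)).asIdeal) = Ideal.absNorm (P.under (𝓞 k)).asIdeal ^ ℓ := by
    rw [← Ideal.absNorm_relNorm (𝓞 k), relNorm_map, map_pow, hK]
  obtain ⟨Q, _, hQ, hN⟩ := hS
  rw [huniq Q hQ] at hN
  rw [hJ, hN] at h2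
  have h3 := two_le_absNorm (P.under (𝓞 k))
  have h4 : (1:ℕ) = ℓ := Nat.pow_right_injective h3 (by simpa using h2)
  exact hℓ.one_lt.ne h4

/-- class map modulo norms, over the base -/
noncomputable def Gk (k K : Type*) [Field k] [NumberField k] [Field K] [NumberField K] [Algebra k K] :
    GMap k (ClassGroup (𝓞 k) ⧸ NCl k K) where
  g I := QuotientGroup.mk (cl I)
  m := 1
  map_mul I J hI hJ _ _ := by rw [cl_mul hI hJ]; rfl
  cong x y _ _ _ _ _ _ := by rw [cl_span, cl_span]

lemma Gk_im : (Gk k K).im = ⊤ := by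
  rw [eq_top_iff]
  rintro a -
  obtain ⟨c, rfl⟩ := QuotientGroup.mk_surjective a
  obtain ⟨I, hI, rfl⟩ := cl_surj c
  exact ⟨I, hI, isCoprime_one_right, rfl⟩

variable (k K) in
lemma DLe_NCl : DLe {p : HeightOneSpectrum (𝓞 k) | cl p.asIdeal ∈ NCl k K} (1 / Nat.card (ClassGroup (𝓞 k) ⧸ NCl k K)) := by
  have := (Gk k K).density
  rw [Gk_im, Subgroup.card_top] at this
  refine this.mono fun p hp => ⟨isCoprime_one_right, ?_⟩
  exact (QuotientGroup.eq_one_iff _).2 hp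

lemma Spl_subset : Spl k K ⊆ {p : HeightOneSpectrum (𝓞 k) | cl p.asIdeal ∈ NCl k K} := by
  rintro p ⟨P, _, hP, hN⟩
  rw [Set.mem_setOf, ← relNorm_of_absNorm P p hP hN]
  exact relNorm_mem_NCl _ P.ne_bot

variable (k K) in
theorem index_le : Nat.card (ClassGroup (𝓞 k) ⧸ NCl k K) ≤ Module.finrank k K := by
  have := density_le ((DGe_Spl k K).mono Spl_subset) (DLe_NCl k K)
  have h1 : (0:ℝ) < Module.finrank k K := by exact_mod_cast Module.finrank_pos
  have h2 : (0:ℝ) < Nat.card (ClassGroup (𝓞 k) ⧸ NCl k K) := by exact_mod_cast Nat.card_pos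
  rw [one_div_le_one_div h1 h2] at this
  exact_mod_cast this

end
end GenusRank

namespace GenusRank
open Filter Topology nonZeroDivisors
open scoped Pointwise

section

open scoped Classical in
/-- norm residue -/
noncomputable def nres (m n : ℕ) : (ZMod m)ˣ := if h : Nat.Coprime n m then ZMod.unitOfCoprime n h else 1

lemma nres_val {m n : ℕ} (h : Nat.Coprime n m) : ((nres m n : (ZMod m)ˣ) : ZMod m) = n := by
  unfold nres
  rw [dif_pos h]
  rfl

lemma nres_mul {m n n' : ℕ} (h : Nat.Coprime n m) (h' : Nat.Coprime n' m) : nres m (n * n') = nres m n * nres m n' := by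
  apply Units.ext
  rw [Units.val_mul, nres_val h, nres_val h', nres_val (Nat.Coprime.mul_left h h')]
  push_cast; rfl

variable (k K E : Type*) [Field k] [NumberField k] [Field K] [NumberField K] [Field E] [NumberField E]
  [Algebra k K] [Algebra k E]

/-- class map over the auxiliary field -/
noncomputable def GE (m : ℕ) : GMap E ((ClassGroup (𝓞 k) ⧸ NCl k K) × (ZMod m)ˣ) where
  g I := (QuotientGroup.mk (cl (Ideal.relNorm (𝓞 k) I)), nres m (Ideal.absNorm I))
  m := Ideal.span {(m : 𝓞 E)}
  map_mul I J hI hJ h1 h2 := by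
    refine Prod.ext ?_ ?_
    · change QuotientGroup.mk _ = QuotientGroup.mk _ * QuotientGroup.mk _
      rw [map_mul, cl_mul (relNorm_ne_bot hI) (relNorm_ne_bot hJ)]
      rfl
    · change nres m _ = nres m _ * nres m _
      rw [map_mul, nres_mul (coprime_absNorm I m h1) (coprime_absNorm J m h2)]
  cong x y hx hy h1 h2 h3 h4 := by
    refine Prod.ext ?_ ?_
    · change QuotientGroup.mk _ = QuotientGroup.mk _
      rw [Ideal.relNorm_singleton, Ideal.relNorm_singleton, cl_span, cl_span]
    · change nres m _ = nres m _
      apply Units.ext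
      rw [nres_val (coprime_absNorm _ m h1), nres_val (coprime_absNorm _ m h2)]
      rw [Ideal.absNorm_span_singleton, Ideal.absNorm_span_singleton]
      have h5 := norm_congr x y m h3
      rw [← Int.cast_natCast, ← Int.cast_natCast (R := ZMod m), Int.natCast_natAbs, Int.natCast_natAbs]
      rcases pos_and_pos_or_neg_and_neg_of_mul_pos h4 with ⟨h6, h7⟩ | ⟨h6, h7⟩
      · rw [abs_of_pos h6, abs_of_pos h7, h5]
      · rw [abs_of_neg h6, abs_of_neg h7, Int.cast_neg, Int.cast_neg, h5]

variable {k K E}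
variable {L : Type*} [Field L] [NumberField L] [Algebra k L] [Algebra K L] [Algebra E L]
  [IsScalarTower k K L] [IsScalarTower k E L]

lemma coprime_of_under {m : ℕ} (P : HeightOneSpectrum (𝓞 L)) (q : HeightOneSpectrum (𝓞 E))
    (hN : Ideal.absNorm P.asIdeal = Ideal.absNorm q.asIdeal)
    (h : IsCoprime q.asIdeal (Ideal.span {(m : 𝓞 E)})) : Nat.Coprime (Ideal.absNorm P.asIdeal) m := by
  rw [hN]; exact coprime_absNorm _ _ h

lemma Spl_ker {m : ℕ} (hm : m ≠ 0) (ζ : L) (hζ : IsPrimitiveRoot ζ m) :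
    Spl E L \ {q : HeightOneSpectrum (𝓞 E) | ¬ IsCoprime q.asIdeal (Ideal.span {(m : 𝓞 E)})} ⊆ (GE k K E m).ker := by
  rintro q ⟨⟨P, _, hP, hN⟩, hq⟩
  have hq' : IsCoprime q.asIdeal (Ideal.span {(m : 𝓞 E)}) := by simpa using hq
  refine ⟨hq', Prod.ext ?_ ?_⟩
  · change QuotientGroup.mk _ = 1
    rw [QuotientGroup.eq_one_iff, ← relNorm_of_absNorm P q hP hN, Ideal.relNorm_relNorm, ← Ideal.relNorm_relNorm (𝓞 k) (𝓞 K)]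
    exact relNorm_mem_NCl _ (relNorm_ne_bot P.ne_bot)
  · change nres m _ = 1
    apply Units.ext
    rw [nres_val (coprime_absNorm _ m hq'), ← hN]
    exact absNorm_mod L m hm ζ hζ P (coprime_of_under P q hN hq')

lemma card_ge_prime {ℓ : ℕ} (hℓ : ℓ.Prime) {A : Type*} [CommGroup A] [Finite A] (h : ∀ a : A, a ^ ℓ = 1) (a : A) (ha : a ≠ 1) :
    ℓ ≤ Nat.card A := by
  haveI : Fact (Nat.Prime ℓ) := ⟨hℓ⟩
  have h1 : orderOf a = ℓ := orderOf_eq_prime (h a) ha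
  rw [← h1]
  exact orderOf_le_card

lemma quot_pow {ℓ : ℕ} (hK : Module.finrank k K = ℓ) (a : ClassGroup (𝓞 k) ⧸ NCl k K) : a ^ ℓ = 1 := by
  obtain ⟨c, rfl⟩ := QuotientGroup.mk_surjective a
  rw [← QuotientGroup.mk_pow, QuotientGroup.eq_one_iff, ← hK]
  exact pow_mem_NCl c

lemma span_nat_ne_bot {m : ℕ} (hm : m ≠ 0) : Ideal.span {(m : 𝓞 E)} ≠ ⊥ := span_ne_bot (by exact_mod_cast hm)

lemma im_trivial {ℓ : ℕ} (hℓ : ℓ.Prime) (hK : Module.finrank k K = ℓ) (hE : Module.finrank E L = ℓ)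
    {m : ℕ} (hm : m ≠ 0) (ζ : L) (hζ : IsPrimitiveRoot ζ m) (b : (ZMod m)ˣ) (hb : b ≠ 1)
    (hB : ((1 : ClassGroup (𝓞 k) ⧸ NCl k K), b) ∈ (GE k K E m).im) :
    2 ≤ Nat.card (GE k K E m).im ∧ ∀ x ∈ (GE k K E m).im, x.1 = 1 := by
  have : NeZero m := ⟨hm⟩
  set G := GE k K E m
  have h1 : DGe G.ker (1 / Module.finrank E L) :=
    ((DGe_Spl E L).diff_finite (finite_not_coprime _ (span_nat_ne_bot hm))).mono (Spl_ker hm ζ hζ)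
  have h2 := density_le h1 G.density
  have h3 : (0:ℝ) < Module.finrank E L := by exact_mod_cast Module.finrank_pos
  have h4 : (0:ℝ) < Nat.card G.im := by exact_mod_cast Nat.card_pos
  rw [one_div_le_one_div h3 h4, hE] at h2
  have h5 : Nat.card G.im ≤ ℓ := by exact_mod_cast h2
  let π : G.im →* (ClassGroup (𝓞 k) ⧸ NCl k K) := (MonoidHom.fst _ _).comp G.im.subtype
  have hker : 2 ≤ Nat.card π.ker := by
    have : Nontrivial π.ker := ⟨⟨⟨⟨_, hB⟩, rfl⟩, 1, fun h => hb (by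
      have := congrArg (fun z : π.ker => (z : G.im).1.2) h
      exact this)⟩⟩
    exact Finite.one_lt_card
  have hprod : Nat.card G.im = Nat.card π.range * Nat.card π.ker := by
    rw [Subgroup.card_eq_card_quotient_mul_card_subgroup π.ker, Nat.card_congr (QuotientGroup.quotientKerEquivRange π).toEquiv]
  have hr : 1 ≤ Nat.card π.range := Nat.card_pos
  refine ⟨by rw [hprod]; nlinarith, ?_⟩
  intro x hx
  by_contra hne
  have h6 : ℓ ≤ Nat.card π.range := by
    refine card_ge_prime hℓ (fun a => Subtype.ext (quot_pow hK a.1)) ⟨x.1, ⟨⟨x, hx⟩, rfl⟩⟩ ?_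
    intro h
    exact hne (congrArg Subtype.val h)
  have := hℓ.pos
  rw [hprod] at h5
  nlinarith

lemma fixed_of_gen (τ : K ≃ₐ[k] K) (hgen : ∀ g : K ≃ₐ[k] K, g ∈ Subgroup.zpowers τ) (V : Ideal (𝓞 K))
    (hV : τ • V = V) (g : K ≃ₐ[k] K) : g • V = V := by
  have h1 : τ ∈ MulAction.stabilizer (K ≃ₐ[k] K) V := hV
  exact (Subgroup.zpowers_le.2 h1) (hgen g)

lemma smul_under (σ : L ≃ₐ[E] L) (τ : K ≃ₐ[k] K) (hτ : ∀ x, σ (algebraMap K L x) = algebraMap K L (τ x))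
    (P : Ideal (𝓞 L)) (hP : σ • P = P) : τ • (P.under (𝓞 K)) = P.under (𝓞 K) := by
  have key : ∀ x : 𝓞 K, σ • (algebraMap (𝓞 K) (𝓞 L) x) = algebraMap (𝓞 K) (𝓞 L) (τ • x) := by
    intro x
    apply RingOfIntegers.ext
    exact hτ x
  ext x
  rw [Ideal.mem_pointwise_smul_iff_inv_smul_mem, Ideal.under_def, Ideal.mem_comap, Ideal.mem_comap]
  rw [← Ideal.smul_mem_pointwise_smul_iff (a := σ), hP, key, smul_inv_smul]

lemma disj_aux {ℓ : ℕ} (hℓ : ℓ.Prime) (hK : Module.finrank k K = ℓ) (hE : Module.finrank E L = ℓ) [IsGalois k K]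
    (σ : L ≃ₐ[E] L) (hσ : σ ^ ℓ = 1) (τ : K ≃ₐ[k] K) (hτ : ∀ x, σ (algebraMap K L x) = algebraMap K L (τ x))
    (hgen : ∀ g : K ≃ₐ[k] K, g ∈ Subgroup.zpowers τ) (q : HeightOneSpectrum (𝓞 E)) (hq : q ∉ Spl E L)
    (hS : q.under (𝓞 k) ∈ Spl k K) : q.under (𝓞 k) ∈ Ram k K := by
  have := q.isPrime.isMaximal q.ne_bot
  obtain ⟨P, hPm, hP⟩ := Ideal.exists_maximal_ideal_liesOver_of_isIntegral (S := 𝓞 L) q.asIdeal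
  have hP0 : P ≠ ⊥ := by
    rintro rfl
    apply q.ne_bot
    rw [hP.over, Ideal.under_bot]
  let P' : HeightOneSpectrum (𝓞 L) := ⟨P, hPm.isPrime, hP0⟩
  have h1 : P'.under (𝓞 E) = q := asIdeal_injective hP.over.symm
  have h2 : σ • P = P := by
    refine smul_eq_of_ne hℓ hE σ hσ P' ?_
    rw [h1]
    intro h3
    exact hq ⟨P', Set.mem_univ _, h1, h3⟩
  have h4 := smul_under σ τ hτ P h2
  have h5 : (P'.under (𝓞 K)).under (𝓞 k) = q.under (𝓞 k) := by
    rw [← h1]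
    apply asIdeal_injective
    change (P.under (𝓞 K)).under (𝓞 k) = (P.under (𝓞 E)).under (𝓞 k)
    rw [Ideal.under_under, Ideal.under_under]
  rw [← h5] at hS ⊢
  exact mem_Ram_of_fixed hℓ hK _ (fixed_of_gen τ hgen _ h4) hS

theorem lemmaC {ℓ : ℕ} (hℓ : ℓ.Prime) (hK : Module.finrank k K = ℓ) (hE : Module.finrank E L = ℓ) [IsGalois k K]
    (σ : L ≃ₐ[E] L) (hσ : σ ^ ℓ = 1) (τ : K ≃ₐ[k] K) (hτ : ∀ x, σ (algebraMap K L x) = algebraMap K L (τ x))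
    (hgen : ∀ g : K ≃ₐ[k] K, g ∈ Subgroup.zpowers τ)
    {m : ℕ} (hm : m ≠ 0) (ζ : L) (hζ : IsPrimitiveRoot ζ m) (c : Ideal (𝓞 E)) (hc0 : c ≠ ⊥)
    (hcm : IsCoprime c (Ideal.span {(m : 𝓞 E)})) (hcN : cl (Ideal.relNorm (𝓞 k) c) ∈ NCl k K)
    (hc1 : ((Ideal.absNorm c : ℕ) : ZMod m) ≠ 1) : NCl k K = ⊤ := by
  have : NeZero m := ⟨hm⟩
  set G := GE k K E m with hG
  have hB : ((1 : ClassGroup (𝓞 k) ⧸ NCl k K), nres m (Ideal.absNorm c)) ∈ G.im :=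
    ⟨c, hc0, hcm, Prod.ext ((QuotientGroup.eq_one_iff _).2 hcN) rfl⟩
  have hb : nres m (Ideal.absNorm c) ≠ 1 := by
    intro h
    apply hc1
    rw [← nres_val (coprime_absNorm c m hcm), h]
    rfl
  obtain ⟨h2, h3⟩ := im_trivial hℓ hK hE hm ζ hζ _ hb hB
  by_contra hne
  -- density of the kernel
  have hker : DLe G.ker (1/2) := by
    obtain ⟨C, hC⟩ := G.density
    refine ⟨C, ?_⟩
    filter_upwards [hC, tendsto_log.eventually_ge_atTop 0] with s h4 h5
    refine h4.trans ?_
    have h6 : 1 / (Nat.card G.im : ℝ) ≤ 1 / 2 := by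
      apply one_div_le_one_div_of_le two_pos
      exact_mod_cast h2
    nlinarith [mul_le_mul_of_nonneg_right h6 h5]
  set F := {q : HeightOneSpectrum (𝓞 E) | ¬ IsCoprime q.asIdeal (Ideal.span {(m : 𝓞 E)})} with hF
  have hFf : F.Finite := finite_not_coprime _ (span_nat_ne_bot hm)
  have hT : DGe ((Set.univ \ F) \ (Spl E L \ F)) (1 - 1/2) :=
    (DGe_univ.diff_finite hFf).diff (hker.mono (Spl_ker hm ζ hζ))
  have hT' := hT.down (E := k)
  have hd : (0:ℝ) < Module.finrank k E := by exact_mod_cast Module.finrank_pos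
  have hA := (DGe_Spl k K).diff_finite (finite_Ram k K)
  have hdisj : Disjoint (Spl k K \ Ram k K) (below k ((Set.univ \ F) \ (Spl E L \ F))) := by
    rw [Set.disjoint_left]
    rintro p ⟨hp1, hp2⟩ ⟨q, ⟨⟨_, hq1⟩, hq2⟩, hq, hqN⟩
    have hq3 : q ∉ Spl E L := fun h => hq2 ⟨h, hq1⟩
    rw [← hq] at hp1 hp2
    exact hp2 (disj_aux hℓ hK hE σ hσ τ hτ hgen q hq3 hp1)
  have hsum := hA.add hT' hdisj
  have hsub : (Spl k K \ Ram k K) ∪ (below k ((Set.univ \ F) \ (Spl E L \ F))) ⊆ {p : HeightOneSpectrum (𝓞 k) | cl p.asIdeal ∈ NCl k K} := by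
    rintro p (⟨hp1, -⟩ | ⟨q, ⟨⟨_, hq1⟩, hq2⟩, hq, hqN⟩)
    · exact Spl_subset hp1
    · rw [Set.mem_setOf, ← relNorm_of_absNorm q p hq hqN, ← QuotientGroup.eq_one_iff]
      have hq1' : IsCoprime q.asIdeal (Ideal.span {(m : 𝓞 E)}) := by simpa [hF] using hq1
      exact h3 _ ⟨q.asIdeal, q.ne_bot, hq1', rfl⟩
  have h7 := density_le (hsum.mono hsub) (DLe_NCl k K)
  have h8 : ℓ ≤ Nat.card (ClassGroup (𝓞 k) ⧸ NCl k K) := by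
    obtain ⟨c, hc⟩ : ∃ c, c ∉ NCl k K := by
      by_contra h
      push Not at h
      exact hne (eq_top_iff.2 fun x _ => h x)
    exact card_ge_prime hℓ (quot_pow hK) (QuotientGroup.mk c) (fun h => hc ((QuotientGroup.eq_one_iff _).1 h))
  have h9 : 1 / (Nat.card (ClassGroup (𝓞 k) ⧸ NCl k K) : ℝ) ≤ 1 / ℓ :=
    one_div_le_one_div_of_le (by exact_mod_cast hℓ.pos) (by exact_mod_cast h8)
  rw [hK] at h7
  have h10 : (0:ℝ) < (1 - 1/2) / Module.finrank k E := by positivity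
  linarith

end
end GenusRank

namespace GenusRank
open Filter Topology nonZeroDivisors
open scoped Pointwise

section

variable {k K : Type*} [Field k] [NumberField k] [Field K] [NumberField K] [Algebra k K]

lemma finite_resField (v : HeightOneSpectrum (𝓞 k)) : Finite v.asIdeal.ResidueField := by
  have := v.isPrime.isMaximal v.ne_bot
  have : Finite (𝓞 k ⧸ v.asIdeal) := Ideal.finiteQuotientOfFreeOfNeBot _ v.ne_bot
  exact Finite.of_surjective _ (Ideal.bijective_algebraMap_quotient_residueField v.asIdeal).2

lemma ram_ge_two (V : HeightOneSpectrum (𝓞 K)) [IsGalois k K]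
    (h : V.asIdeal ^ 2 ∣ Ideal.map (algebraMap (𝓞 k) (𝓞 K)) (V.under (𝓞 k)).asIdeal) :
    2 ≤ Ideal.ramificationIdxIn (V.under (𝓞 k)).asIdeal (𝓞 K) := by
  have := V.isPrime
  have := (V.under (𝓞 k)).isPrime
  have hp := (V.under (𝓞 k)).isPrime.isMaximal (V.under (𝓞 k)).ne_bot
  rw [Ideal.ramificationIdxIn_eq_ramificationIdx (V.under (𝓞 k)).asIdeal V.asIdeal (K ≃ₐ[k] K)]
  have h1 := V.asIdeal.ramificationIdx_pos (𝓞 k)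
  have h2 : V.asIdeal.ramificationIdx (𝓞 k) ≠ 1 := by
    rw [← Ideal.ramificationIdx'_eq_ramificationIdx (V.under (𝓞 k)).asIdeal V.asIdeal (V.under (𝓞 k)).ne_bot]
    rw [Ideal.ramificationIdx'_ne_one_iff]
    · exact Ideal.le_of_dvd h
    · exact Ideal.le_of_dvd ((dvd_pow_self _ two_ne_zero).trans h)
  omega

lemma ram_total {ℓ : ℕ} (hℓ : ℓ.Prime) (hK : Module.finrank k K = ℓ) [IsGalois k K] (V : HeightOneSpectrum (𝓞 K))
    (h : V.asIdeal ^ 2 ∣ Ideal.map (algebraMap (𝓞 k) (𝓞 K)) (V.under (𝓞 k)).asIdeal) :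
    Ideal.absNorm V.asIdeal = Ideal.absNorm (V.under (𝓞 k)).asIdeal ∧
      (∀ g : K ≃ₐ[k] K, g • V.asIdeal = V.asIdeal) := by
  have := V.isPrime
  have := (V.under (𝓞 k)).isPrime
  have hp := (V.under (𝓞 k)).isPrime.isMaximal (V.under (𝓞 k)).ne_bot
  have h2 := ram_ge_two V h
  have h3 := Ideal.ncard_primesOver_mul_ramificationIdxIn_mul_inertiaDegIn (V.under (𝓞 k)).asIdeal (𝓞 K) (K ≃ₐ[k] K)
  rw [IsGalois.card_aut_eq_finrank, hK] at h3
  have h4 : Ideal.ramificationIdxIn (V.under (𝓞 k)).asIdeal (𝓞 K) = ℓ := by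
    have hd : Ideal.ramificationIdxIn (V.under (𝓞 k)).asIdeal (𝓞 K) ∣ ℓ := Dvd.dvd.trans (Dvd.dvd.mul_left (dvd_mul_right _ _) _) (dvd_of_eq h3)
    rcases (Nat.dvd_prime hℓ).1 hd with h5 | h5
    · omega
    · exact h5
  rw [h4] at h3
  have h5 : ((V.under (𝓞 k)).asIdeal.primesOver (𝓞 K)).ncard * Ideal.inertiaDegIn (V.under (𝓞 k)).asIdeal (𝓞 K) = 1 := by
    have := hℓ.pos
    nlinarith
  obtain ⟨h6, h7⟩ := mul_eq_one.1 h5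
  rw [Ideal.inertiaDegIn_eq_inertiaDeg (V.under (𝓞 k)).asIdeal V.asIdeal (K ≃ₐ[k] K)] at h7
  constructor
  · rw [Ideal.absNorm_eq_pow_inertiaDeg'_of_liesOver V.asIdeal (V.under (𝓞 k)).asIdeal
      (V.under (𝓞 k)).isPrime (V.under (𝓞 k)).ne_bot, Ideal.inertiaDeg'_eq_inertiaDeg, h7, pow_one]
  · intro g
    obtain ⟨Q, hQ⟩ := Set.ncard_eq_one.1 h6
    have hV : V.asIdeal ∈ (V.under (𝓞 k)).asIdeal.primesOver (𝓞 K) := ⟨V.isPrime, inferInstance⟩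
    have hg : g • V.asIdeal ∈ (V.under (𝓞 k)).asIdeal.primesOver (𝓞 K) := ⟨inferInstance, inferInstance⟩
    rw [hQ] at hV hg
    exact hg.trans hV.symm

variable {L : Type*} [Field L] [NumberField L] [Algebra k L] [Algebra K L] [IsScalarTower k K L]

/-- an inertia element acting nontrivially on `K` -/
lemma exists_inertia [IsGalois k K] [IsGalois k L] [IsGalois K L] (W : HeightOneSpectrum (𝓞 L))
    (h : (W.under (𝓞 K)).asIdeal ^ 2 ∣ Ideal.map (algebraMap (𝓞 k) (𝓞 K)) ((W.under (𝓞 K)).under (𝓞 k)).asIdeal) :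
    ∃ i : L ≃ₐ[k] L, (∀ a : 𝓞 L, i • a - a ∈ W.asIdeal) ∧ ∃ x : K, i (algebraMap K L x) ≠ algebraMap K L x := by
  set V := W.under (𝓞 K) with hV
  set v := V.under (𝓞 k) with hv
  have := V.isPrime
  have := v.isPrime
  have := W.isPrime
  have := finite_resField V
  have := finite_resField v
  have : W.asIdeal.LiesOver v.asIdeal := Ideal.LiesOver.trans W.asIdeal V.asIdeal v.asIdeal
  have h2 := ram_ge_two V h
  have hne : Nonempty (V.asIdeal.primesOver (𝓞 L)) := ⟨⟨W.asIdeal, ⟨W.isPrime, inferInstance⟩⟩⟩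
  have h3 := Ideal.ramificationIdxIn_mul_ramificationIdxIn (p := v.asIdeal) V.asIdeal (K ≃ₐ[k] K) (𝓞 L) (L ≃ₐ[k] L) (L ≃ₐ[K] L)
  rw [← Ideal.card_inertia_eq_ramificationIdxIn (G := L ≃ₐ[k] L) v.asIdeal W.asIdeal,
    ← Ideal.card_inertia_eq_ramificationIdxIn (G := L ≃ₐ[K] L) V.asIdeal W.asIdeal] at h3
  by_contra hcon
  push Not at hcon
  have h4 : Nat.card (W.asIdeal.inertia (L ≃ₐ[k] L)) ≤ Nat.card (W.asIdeal.inertia (L ≃ₐ[K] L)) := by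
    refine Nat.card_le_card_of_injective (fun i => ⟨AlgEquiv.ofRingEquiv (f := (i.1 : L ≃ₐ[k] L).toRingEquiv) (hcon i.1 i.2), fun a => i.2 a⟩) ?_
    intro i j hij
    apply Subtype.ext
    ext x
    exact DFunLike.congr_fun (congrArg (Subtype.val) hij) x
  have h5 : 0 < Nat.card (W.asIdeal.inertia (L ≃ₐ[K] L)) := Nat.card_pos
  nlinarith
end
end GenusRank

namespace GenusRank
open Filter Topology nonZeroDivisors
open scoped Pointwise

section
variable {k K : Type*} [Field k] [NumberField k] [Field K] [NumberField K] [Algebra k K]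
variable {L : Type*} [Field L] [NumberField L] [Algebra k L] [Algebra K L] [IsScalarTower k K L]

theorem coreC {ℓ : ℕ} (hℓ : ℓ.Prime) (hK : Module.finrank k K = ℓ) [IsGalois k K]
    (s : L ≃ₐ[k] L) (hs : s ^ ℓ = 1) (x : K) (hx : s (algebraMap K L x) ≠ algebraMap K L x)
    {m : ℕ} (hm : m ≠ 0) (ζ : L) (hζ : IsPrimitiveRoot ζ m)
    (c : Ideal (𝓞 (IntermediateField.fixedField (Subgroup.zpowers s)))) (hc0 : c ≠ ⊥)
    (hcm : IsCoprime c (Ideal.span {(m : 𝓞 (IntermediateField.fixedField (Subgroup.zpowers s)))}))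
    (hcN : cl (Ideal.relNorm (𝓞 k) c) ∈ NCl k K)
    (hc1 : ((Ideal.absNorm c : ℕ) : ZMod m) ≠ 1) : NCl k K = ⊤ := by
  haveI : Fact (Nat.Prime ℓ) := ⟨hℓ⟩
  have hs1 : s ≠ 1 := by rintro rfl; exact hx rfl
  have hE : Module.finrank (IntermediateField.fixedField (Subgroup.zpowers s)) L = ℓ := by
    rw [IntermediateField.finrank_fixedField_eq_card, Nat.card_zpowers, orderOf_eq_prime hs hs1]
  have hcard : Nat.card (K ≃ₐ[k] K) = ℓ := by rw [IsGalois.card_aut_eq_finrank, hK]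
  have hτ : s.restrictNormal K ≠ 1 := by
    intro h
    apply hx
    rw [← AlgEquiv.restrictNormal_commutes, h]
    rfl
  refine lemmaC (E := IntermediateField.fixedField (Subgroup.zpowers s)) (L := L) hℓ hK hE
    (AlgEquiv.ofRingEquiv (f := s.toRingEquiv) (fun y => y.2 ⟨s, Subgroup.mem_zpowers s⟩)) ?_ (s.restrictNormal K)
    (fun y => (AlgEquiv.restrictNormal_commutes s K y).symm) (fun g => mem_zpowers_of_prime_card hcard hτ) hm ζ hζ c hc0 hcm hcN hc1
  ext y
  have h1 : ∀ (n : ℕ), ((AlgEquiv.ofRingEquiv (f := s.toRingEquiv) (fun y => y.2 ⟨s, Subgroup.mem_zpowers s⟩) : L ≃ₐ[IntermediateField.fixedField (Subgroup.zpowers s)] L) ^ n) y = (s ^ n) y := by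
    intro n
    induction n with
    | zero => rfl
    | succ n ih => rw [pow_succ', pow_succ', AlgEquiv.mul_apply, AlgEquiv.mul_apply, ih]; rfl
  rw [h1, hs]
  rfl

lemma cyc_galois (m : ℕ) [NeZero m] [IsGalois k K] : IsGalois k (CyclotomicField m K) := by
  obtain ⟨p, hp⟩ := Normal.exists_isSplittingField k K
  have h2 : Polynomial.IsSplittingField K (CyclotomicField m K) ((Polynomial.cyclotomic m k).map (algebraMap k K)) := by
    rw [Polynomial.map_cyclotomic]
    exact IsCyclotomicExtension.splitting_field_cyclotomic m K (CyclotomicField m K)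
  obtain ⟨q, hq0, hq⟩ : ∃ q : Polynomial k, q ≠ 0 ∧ Polynomial.IsSplittingField k K q := by
    by_cases h : p = 0
    · refine ⟨1, one_ne_zero, ⟨by simp, ?_⟩⟩
      have := hp.adjoin_rootSet'
      rw [h] at this
      simpa using this
    · exact ⟨p, h, hp⟩
  have h3 := Polynomial.IsSplittingField.mul (K := K) (L := CyclotomicField m K) q (Polynomial.cyclotomic m k) hq0 (Polynomial.cyclotomic_ne_zero m k)
  have := Normal.of_isSplittingField (F := k) (E := CyclotomicField m K) (q * Polynomial.cyclotomic m k)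
  exact ⟨⟩

lemma dvd_sub_one {x ℓ : ℕ} (hx : 2 ≤ x) (hℓ : 2 ≤ ℓ) : ((x : ℕ) : ZMod (x ^ ℓ - 1)) ≠ 1 := by
  intro h
  have h1 : x ^ 2 ≤ x ^ ℓ := Nat.pow_le_pow_right (by omega) hℓ
  have h2 : ((x : ℕ) : ZMod (x ^ ℓ - 1)) = ((1 : ℕ) : ZMod (x ^ ℓ - 1)) := by simpa using h
  rw [ZMod.natCast_eq_natCast_iff] at h2
  have h3 := (Nat.modEq_iff_dvd' (by omega : 1 ≤ x)).1 h2.symm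
  have h4 := Nat.le_of_dvd (by omega) h3
  have : x ^ 2 = x * x := by ring
  have : 2 * x ≤ x * x := Nat.mul_le_mul_right x hx
  omega

lemma card_le_of_pow {F : Type*} [CommRing F] [IsDomain F] [Finite F] (x : ℕ) (hx : 2 ≤ x) (h : ∀ a : F, a ^ x - a = 0) : Nat.card F ≤ x := by
  classical
  letI := Fintype.ofFinite F
  have hd : (Polynomial.X ^ x - Polynomial.X : Polynomial F).natDegree = x := by
    rw [Polynomial.natDegree_sub_eq_left_of_natDegree_lt] <;> simp <;> omega
  have h0 : (Polynomial.X ^ x - Polynomial.X : Polynomial F) ≠ 0 := by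
    intro h; rw [h] at hd; simp at hd; omega
  rw [Nat.card_eq_fintype_card, ← Finset.card_univ, ← hd]
  refine le_trans ?_ (Polynomial.card_roots' _)
  refine le_trans ?_ (Multiset.toFinset_card_le _)
  refine Finset.card_le_card fun a _ => ?_
  rw [Multiset.mem_toFinset, Polynomial.mem_roots h0]
  simpa using h a

/-- norm of a prime below, fixed by Frobenius -/
lemma norm_le_of_pow {E : Type*} [Field E] [NumberField E] (w : HeightOneSpectrum (𝓞 E)) (x : ℕ) (hx : 2 ≤ x)
    (h : ∀ a : 𝓞 E, a ^ x - a ∈ w.asIdeal) : Ideal.absNorm w.asIdeal ≤ x := by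
  have := w.isPrime
  have : Finite (𝓞 E ⧸ w.asIdeal) := Ideal.finiteQuotientOfFreeOfNeBot _ w.ne_bot
  rw [Ideal.absNorm_apply, Submodule.cardQuot_apply]
  refine card_le_of_pow x hx fun a => ?_
  obtain ⟨b, rfl⟩ := Ideal.Quotient.mk_surjective a
  rw [← map_pow, ← map_sub]
  exact Ideal.Quotient.eq_zero_iff_mem.2 (h b)

theorem NCl_top_of_ram {ℓ : ℕ} (hℓ : ℓ.Prime) (hK : Module.finrank k K = ℓ) [IsGalois k K] (h : (Ram k K).Nonempty) :
    NCl k K = ⊤ := by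
  obtain ⟨v, Q, hQ, hQ0, hdvd⟩ := h
  set V : HeightOneSpectrum (𝓞 K) := ⟨Q, hQ, hQ0⟩ with hV
  have hVv : V.under (𝓞 k) = v := under_eq_of_dvd V v ((dvd_pow_self Q two_ne_zero).trans hdvd)
  set x := Ideal.absNorm v.asIdeal with hxdef
  have hx2 : 2 ≤ x := two_le_absNorm v
  have hm : x ^ ℓ - 1 ≠ 0 := by
    have := Nat.one_lt_pow hℓ.ne_zero (show 1 < x by omega)
    omega
  set m := x ^ ℓ - 1 with hmdef
  haveI : NeZero m := ⟨hm⟩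
  haveI := cyc_galois (k := k) (K := K) m
  haveI : IsGalois K (CyclotomicField m K) := IsCyclotomicExtension.isGalois {m} K (CyclotomicField m K)
  -- a prime above
  obtain ⟨⟨W0, hW0, hW0o⟩⟩ : Nonempty (V.asIdeal.primesOver (𝓞 (CyclotomicField m K))) := by
    have := V.isPrime
    infer_instance
  have hW0b : W0 ≠ ⊥ := by
    intro hb
    exact V.ne_bot (by rw [hW0o.over, hb]; exact Ideal.under_bot _ _)
  set W : HeightOneSpectrum (𝓞 (CyclotomicField m K)) := ⟨W0, hW0, hW0b⟩ with hW
  have hWV : W.under (𝓞 K) = V := asIdeal_injective hW0o.over.symm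
  have hWv : (W.under (𝓞 K)).under (𝓞 k) = v := by rw [hWV, hVv]
  have hWv' : Ideal.under (𝓞 k) W.asIdeal = v.asIdeal := by
    rw [← hWv]
    haveI := under_liesOver (E := K) W
    haveI := under_liesOver (E := k) (W.under (𝓞 K))
    exact (Ideal.LiesOver.trans W.asIdeal (W.under (𝓞 K)).asIdeal ((W.under (𝓞 K)).under (𝓞 k)).asIdeal).over.symm
  obtain ⟨i, hi1, y, hi2⟩ := exists_inertia (k := k) (K := K) W (by rw [hWv, hWV]; exact hdvd)
  haveI := W.isPrime
  haveI : Finite (𝓞 (CyclotomicField m K) ⧸ W.asIdeal) := Ideal.finiteQuotientOfFreeOfNeBot _ W.ne_bot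
  obtain ⟨φ, hφ⟩ := IsArithFrobAt.exists_of_isInvariant (𝓞 k) (CyclotomicField m K ≃ₐ[k] CyclotomicField m K) W.asIdeal
  have hcard : Nat.card (𝓞 k ⧸ Ideal.under (𝓞 k) W.asIdeal) = x := by
    rw [hWv', hxdef, Ideal.absNorm_apply, Submodule.cardQuot_apply]
  -- a Frobenius nontrivial on `K`
  obtain ⟨s, hs, y, hsy⟩ : ∃ s : CyclotomicField m K ≃ₐ[k] CyclotomicField m K,
      IsArithFrobAt (𝓞 k) s W.asIdeal ∧ ∃ y : K, s (algebraMap K _ y) ≠ algebraMap K _ y := by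
    by_cases hc : ∃ y : K, φ (algebraMap K _ y) ≠ algebraMap K _ y
    · exact ⟨φ, hφ, hc⟩
    · push Not at hc
      refine ⟨i * φ, ?_, y, ?_⟩
      · intro a
        have h1 := hφ a
        have h2 := hi1 (φ • a)
        have h3 := W.asIdeal.add_mem h2 h1
        simp only [MulSemiringAction.toAlgHom_apply] at h3 ⊢
        rw [sub_add_sub_cancel] at h3
        rw [mul_smul]
        exact h3
      · rw [AlgEquiv.mul_apply, hc]
        exact hi2
  have hmW : (m : 𝓞 (CyclotomicField m K)) ∉ W.asIdeal := by
    intro hmem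
    have h1 : ((x : ℕ) : 𝓞 k) ∈ v.asIdeal := Ideal.absNorm_mem _
    rw [← hWv', Ideal.mem_comap, map_natCast] at h1
    have h2 : ((x ^ ℓ : ℕ) : 𝓞 (CyclotomicField m K)) ∈ W.asIdeal := by
      push_cast
      exact Ideal.pow_mem_of_mem _ h1 _ hℓ.pos
    have h3 : x ^ ℓ = m + 1 := by
      have := Nat.one_lt_pow hℓ.ne_zero (show 1 < x by omega)
      omega
    rw [h3] at h2
    push_cast at h2
    have h4 := W.asIdeal.sub_mem h2 hmem
    rw [add_sub_cancel_left] at h4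
    exact W.isPrime.ne_top ((Ideal.eq_top_iff_one _).2 h4)
  obtain ⟨ζ, hζ⟩ := IsCyclotomicExtension.exists_isPrimitiveRoot K (CyclotomicField m K) (Set.mem_singleton m) hm
  have hsζ : s ζ = ζ ^ x := by
    have h1 := AlgHom.IsArithFrobAt.apply_of_pow_eq_one hs (ζ := hζ.toInteger) (m := m)
      (by apply RingOfIntegers.ext; exact hζ.pow_eq_one) hmW
    rw [hcard] at h1
    have h2 := congrArg (algebraMap (𝓞 (CyclotomicField m K)) (CyclotomicField m K)) h1
    exact h2
  have hspow : ∀ n : ℕ, (s ^ n) ζ = ζ ^ (x ^ n) := by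
    intro n
    induction n with
    | zero => simp
    | succ n ih => rw [pow_succ', AlgEquiv.mul_apply, ih, map_pow, hsζ, ← pow_mul, pow_succ', ]
  have hsℓ : s ^ ℓ = 1 := by
    have h1 : (s ^ ℓ).restrictNormal K = 1 := by
      have : (s ^ ℓ).restrictNormal K = (s.restrictNormal K) ^ ℓ := map_pow (AlgEquiv.restrictNormalHom K) s ℓ
      rw [this, ← hK, ← IsGalois.card_aut_eq_finrank]
      exact pow_card_eq_one'
    have h2 : ∀ y : K, (s ^ ℓ) (algebraMap K _ y) = algebraMap K _ y := by
      intro y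
      rw [← AlgEquiv.restrictNormal_commutes, h1]
      rfl
    have h3 : (AlgEquiv.ofRingEquiv (f := (s ^ ℓ).toRingEquiv) h2 : CyclotomicField m K ≃ₐ[K] CyclotomicField m K) = 1 := by
      refine IsCyclotomicExtension.algEquiv_eq_of_apply_eq (S := {m}) (A := K) (B := CyclotomicField m K) (f := AlgEquiv.ofRingEquiv (f := (s ^ ℓ).toRingEquiv) h2) (g := 1) ?_
      rintro n hn -
      rw [Set.mem_singleton_iff] at hn
      subst hn
      refine ⟨ζ, hζ, ?_⟩
      change (s ^ ℓ) ζ = ζ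
      have h4 : x ^ ℓ = m + 1 := by
        have := Nat.one_lt_pow hℓ.ne_zero (show 1 < x by omega)
        omega
      rw [hspow, h4, pow_succ, hζ.pow_eq_one, one_mul]
    ext z
    exact DFunLike.congr_fun h3 z
  set E := IntermediateField.fixedField (Subgroup.zpowers s) with hE
  set w : HeightOneSpectrum (𝓞 E) := W.under (𝓞 E) with hw
  have hwv : w.under (𝓞 k) = v := by
    apply asIdeal_injective
    change (w.under (𝓞 k)).asIdeal = v.asIdeal
    rw [← hWv']
    haveI := under_liesOver (E := E) W
    haveI := under_liesOver (E := k) w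
    exact (Ideal.LiesOver.trans W.asIdeal w.asIdeal (w.under (𝓞 k)).asIdeal).over
  have hwx : Ideal.absNorm w.asIdeal ≤ x := by
    refine norm_le_of_pow w x hx2 fun a => ?_
    have h1 := hs (algebraMap (𝓞 E) (𝓞 (CyclotomicField m K)) a)
    rw [hcard] at h1
    have h2 : s • (algebraMap (𝓞 E) (𝓞 (CyclotomicField m K)) a) = algebraMap (𝓞 E) (𝓞 (CyclotomicField m K)) a := by
      apply RingOfIntegers.ext
      exact (a : E).2 ⟨s, Subgroup.mem_zpowers s⟩
    rw [MulSemiringAction.toAlgHom_apply, h2] at h1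
    change algebraMap (𝓞 E) (𝓞 (CyclotomicField m K)) (a ^ x - a) ∈ W.asIdeal
    rw [map_sub, map_pow, ← neg_sub]
    exact W.asIdeal.neg_mem h1
  have hwx' : Ideal.absNorm w.asIdeal = x := by
    obtain ⟨f, hf, hN⟩ := absNorm_under (E := k) w
    rw [hwv] at hN
    refine le_antisymm hwx ?_
    rw [hN]
    exact Nat.le_self_pow (by omega) _
  refine coreC hℓ hK s hsℓ y hsy hm ζ hζ w.asIdeal w.ne_bot ?_ ?_ ?_
  · rw [Ideal.isCoprime_iff_sup_eq]
    by_contra hne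
    have h1 := (w.isPrime.isMaximal w.ne_bot).eq_of_le hne le_sup_left
    have h2 : (m : 𝓞 E) ∈ w.asIdeal := by
      rw [h1]
      exact Ideal.mem_sup_right (Ideal.mem_span_singleton_self _)
    have h3 : algebraMap (𝓞 E) (𝓞 (CyclotomicField m K)) (m : 𝓞 E) ∈ W.asIdeal := h2
    rw [map_natCast] at h3
    exact hmW h3
  · rw [relNorm_of_absNorm w v hwv hwx', ← relNorm_of_absNorm V v hVv]
    · exact relNorm_mem_NCl _ V.ne_bot
    · rw [← hVv]
      exact (ram_total hℓ hK V (by rw [hVv]; exact hdvd)).1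
  · rw [hwx']
    exact dvd_sub_one hx2 hℓ.two_le
end
end GenusRank

namespace GenusRank
open Filter Topology nonZeroDivisors
open scoped Pointwise

section

lemma norm_sub_eval {E : Type*} [Field E] [NumberField E] (δ : E) (q : ℚ) :
    Algebra.norm ℚ (algebraMap ℚ E q - δ) = (LinearMap.charpoly (LinearMap.mul ℚ E δ)).eval q := by
  rw [LinearMap.eval_charpoly, Algebra.norm_apply]
  congr 1
  ext x
  simp [sub_mul, Algebra.smul_def]

lemma exists_norm_neg {E : Type*} [Field E] [NumberField E] (ψ : E →+* ℝ) : ∃ γ : E, Algebra.norm ℚ γ < 0 := by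
  by_contra hcon
  push Not at hcon
  set pb := Field.powerBasisOfFiniteOfSeparable ℚ E
  set f := minpoly ℚ pb.gen with hf
  have h1 : LinearMap.charpoly (LinearMap.mul ℚ E pb.gen) = f := by
    rw [hf, ← charpoly_leftMulMatrix, Algebra.leftMulMatrix_apply, LinearMap.charpoly_toMatrix]
    rfl
  have h2 : ∀ q : ℚ, 0 ≤ f.eval q := by
    intro q
    rw [← h1, ← norm_sub_eval]
    exact hcon _
  let ψ' : E →ₐ[ℚ] ℝ := ψ.toRatAlgHom
  have h3 : ∀ x : ℝ, 0 ≤ Polynomial.aeval x f := by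
    intro x
    have hc : Continuous fun x : ℝ => Polynomial.aeval x f := Polynomial.continuous_aeval f
    have hcl : IsClosed {x : ℝ | 0 ≤ Polynomial.aeval x f} := isClosed_le continuous_const hc
    have hd : DenseRange ((↑) : ℚ → ℝ) := Rat.isDenseEmbedding_coe_real.dense
    refine hd.induction_on (p := fun x : ℝ => 0 ≤ Polynomial.aeval x f) x hcl fun q => ?_
    have : (Polynomial.aeval (q : ℝ)) f = ((f.eval q : ℚ) : ℝ) := by
      have := Polynomial.aeval_algebraMap_apply ℝ q f
      simpa using this
    rw [this]
    exact_mod_cast h2 q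
  have h4 : Polynomial.aeval (ψ' pb.gen) f = 0 := by
    rw [Polynomial.aeval_algHom_apply, hf, minpoly.aeval, map_zero]
  have hsep : f.Separable := (minpoly.irreducible (Algebra.IsIntegral.isIntegral _)).separable
  have h5 := hsep.aeval_derivative_ne_zero h4
  apply h5
  have hmin : IsLocalMin (fun x : ℝ => Polynomial.aeval x f) (ψ' pb.gen) := by
    refine Filter.Eventually.of_forall fun x => ?_
    change Polynomial.aeval (ψ' pb.gen) f ≤ Polynomial.aeval x f
    rw [h4]
    exact h3 x
  have h6 := hmin.deriv_eq_zero
  rwa [Polynomial.deriv_aeval] at h6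

lemma exists_alpha {E : Type*} [Field E] [NumberField E] (ψ : E →+* ℝ) :
    ∃ α : 𝓞 E, α - 1 ∈ Ideal.span {((4 : ℕ) : 𝓞 E)} ∧ Algebra.norm ℤ α < 0 := by
  obtain ⟨γ, hγ⟩ := exists_norm_neg ψ
  obtain ⟨⟨a, d⟩, had⟩ := IsLocalization.surj (Algebra.algebraMapSubmonoid (𝓞 E) (nonZeroDivisors ℤ)) γ
  obtain ⟨_, D, hD, rfl⟩ := d
  have hD0 : D ≠ 0 := nonZeroDivisors.ne_zero hD
  have had' : γ * (D : E) = (a : E) := by simpa using had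
  set b : 𝓞 E := (D : 𝓞 E) * a with hb
  have hnat : ∀ (q : ℚ) (x : E), Algebra.norm ℚ ((q : E) * x) = q ^ (Module.finrank ℚ E) * Algebra.norm ℚ x := by
    intro q x
    rw [map_mul, ← Algebra.norm_algebraMap (S := E) q]
    rfl
  have hδ : Algebra.norm ℚ (4 * (b : E)) < 0 := by
    have h1 : 4 * (b : E) = (((4 * D ^ 2 : ℚ)) : E) * γ := by
      have : (b : E) = (D : E) * (a : E) := by rw [hb]; simp
      rw [this, ← had']
      push_cast
      ring
    rw [h1, hnat]
    refine mul_neg_of_pos_of_neg (pow_pos ?_ _) hγ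
    have : (D : ℚ) ≠ 0 := by exact_mod_cast hD0
    positivity
  set g := LinearMap.charpoly (LinearMap.mul ℚ E (-(4 * (b : E)))) with hg
  have hgq : ∀ q : ℚ, Algebra.norm ℚ ((q : E) + 4 * (b : E)) = g.eval q := by
    intro q
    rw [hg, ← norm_sub_eval, sub_neg_eq_add]
    rfl
  have h0 : g.eval 0 < 0 := by
    rw [← hgq]
    simpa using hδ
  have ht : Tendsto (fun T : ℕ => g.eval (1 / ((T : ℚ) + 1))) atTop (𝓝 (g.eval 0)) :=
    (g.continuous.tendsto 0).comp tendsto_one_div_add_atTop_nhds_zero_nat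
  obtain ⟨T, hT⟩ := (ht.eventually_lt_const h0).exists
  refine ⟨1 + ((T : 𝓞 E) + 1) * (4 * b), ?_, ?_⟩
  · rw [add_sub_cancel_left, Ideal.mem_span_singleton]
    exact ⟨((T : 𝓞 E) + 1) * b, by push_cast; ring⟩
  · have h1 : ((Algebra.norm ℤ (1 + ((T : 𝓞 E) + 1) * (4 * b)) : ℤ) : ℚ) < 0 := by
      rw [Algebra.coe_norm_int]
      have h2 : ((1 + ((T : 𝓞 E) + 1) * (4 * b) : 𝓞 E) : E) = (((T : ℚ) + 1 : ℚ) : E) * (((1 / ((T : ℚ) + 1) : ℚ) : E) + 4 * (b : E)) := by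
        have h3 : ((T : E) + 1) ≠ 0 := by exact_mod_cast Nat.succ_ne_zero T
        push_cast
        simp only [map_add, map_mul, map_one, map_natCast, map_ofNat]
        field_simp
      rw [h2, hnat, hgq]
      exact mul_neg_of_pos_of_neg (by positivity) hT
    exact_mod_cast h1

variable {k K : Type*} [Field k] [NumberField k] [Field K] [NumberField K] [Algebra k K]

theorem NCl_top_of_inf {ℓ : ℕ} (hℓ : ℓ.Prime) (hK : Module.finrank k K = ℓ) [IsGalois k K]
    (v : InfinitePlace k) (hv : v.IsReal) (w : InfinitePlace K) (hw : w.comap (algebraMap k K) = v) (hwc : w.IsComplex) :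
    NCl k K = ⊤ := by
  haveI := cyc_galois (k := k) (K := K) 4
  obtain ⟨ζ, hζ⟩ := IsCyclotomicExtension.exists_isPrimitiveRoot K (CyclotomicField 4 K) (Set.mem_singleton 4) (by norm_num)
  letI : Algebra K ℂ := w.embedding.toAlgebra
  let ψ : CyclotomicField 4 K →ₐ[K] ℂ := IsAlgClosed.lift
  have hψ : ∀ x : K, ψ (algebraMap K _ x) = w.embedding x := fun x => ψ.commutes x
  have hreal : ∀ x : k, (starRingEnd ℂ) (w.embedding (algebraMap k K x)) = w.embedding (algebraMap k K x) := by
    have h1 : InfinitePlace.mk (w.embedding.comp (algebraMap k K)) = v := by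
      rw [← hw, ← InfinitePlace.comap_mk, InfinitePlace.mk_embedding]
    have h2 : ComplexEmbedding.IsReal (w.embedding.comp (algebraMap k K)) := by
      rw [← InfinitePlace.isReal_mk_iff, h1]; exact hv
    intro x
    exact RingHom.congr_fun h2 x
  obtain ⟨s, hs⟩ := ComplexEmbedding.exists_comp_symm_eq_of_comp_eq (k := k) (ComplexEmbedding.conjugate (ψ : CyclotomicField 4 K →+* ℂ)) (ψ : CyclotomicField 4 K →+* ℂ) (by
    ext x
    have h1 : ψ (algebraMap k _ x) = w.embedding (algebraMap k K x) := by
      rw [IsScalarTower.algebraMap_apply k K, hψ]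
    change (starRingEnd ℂ) (ψ (algebraMap k _ x)) = ψ (algebraMap k _ x)
    rw [h1, hreal])
  have hs' : ∀ x, ψ (s x) = (starRingEnd ℂ) (ψ x) := by
    intro x
    have := RingHom.congr_fun hs (s x)
    simp at this
    exact this.symm
  have hs2 : s ^ 2 = 1 := by
    ext x
    apply (ψ : CyclotomicField 4 K →+* ℂ).injective
    change ψ ((s ^ 2) x) = ψ x
    rw [pow_two, AlgEquiv.mul_apply, hs', hs', Complex.conj_conj]
  obtain ⟨x, hx⟩ : ∃ x : K, s (algebraMap K _ x) ≠ algebraMap K _ x := by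
    by_contra hcon
    push Not at hcon
    rw [InfinitePlace.isComplex_iff] at hwc
    apply hwc
    ext x
    have h1 := hs' (algebraMap K _ x)
    rw [hcon, hψ] at h1
    exact h1.symm
  have hτ : (s.restrictNormal K) ≠ 1 := by
    intro h
    apply hx
    rw [← AlgEquiv.restrictNormal_commutes, h]
    rfl
  have hτ2 : (s.restrictNormal K) ^ 2 = 1 := by
    have : (s ^ 2).restrictNormal K = (s.restrictNormal K) ^ 2 := map_pow (AlgEquiv.restrictNormalHom K) s 2
    rw [← this, hs2]
    exact map_one (AlgEquiv.restrictNormalHom K)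
  have hℓ2 : ℓ = 2 := by
    haveI : Fact (Nat.Prime 2) := ⟨Nat.prime_two⟩
    have h1 : orderOf (s.restrictNormal K) = 2 := orderOf_eq_prime hτ2 hτ
    have h2 : orderOf (s.restrictNormal K) ∣ Nat.card (K ≃ₐ[k] K) := orderOf_dvd_natCard _
    rw [h1, IsGalois.card_aut_eq_finrank, hK] at h2
    exact ((Nat.prime_dvd_prime_iff_eq Nat.prime_two hℓ).1 h2).symm
  set E := IntermediateField.fixedField (Subgroup.zpowers s) with hE
  have hEr : ComplexEmbedding.IsReal ((ψ : CyclotomicField 4 K →+* ℂ).comp (algebraMap E (CyclotomicField 4 K))) := by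
    ext y
    have h1 := hs' (y : CyclotomicField 4 K)
    have h2 : s (y : CyclotomicField 4 K) = y := y.2 ⟨s, Subgroup.mem_zpowers s⟩
    rw [h2] at h1
    exact h1.symm
  obtain ⟨α, hα1, hα2⟩ := exists_alpha (E := E) hEr.embedding
  have hα0 : α ≠ 0 := by
    rintro rfl
    simp at hα2
  subst hℓ2
  refine coreC hℓ hK s hs2 x hx (by norm_num) ζ hζ (Ideal.span {α}) (span_ne_bot hα0) ?_ ?_ ?_
  · obtain ⟨z, hz⟩ := Ideal.mem_span_singleton'.1 hα1
    rw [Ideal.isCoprime_span_singleton_iff]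
    exact ⟨1, -z, by rw [one_mul, neg_mul, hz]; ring⟩
  · rw [Ideal.relNorm_singleton, cl_span]
    exact one_mem _
  · have h1 := norm_congr α 1 4 hα1
    rw [Ideal.absNorm_span_singleton, ← Int.cast_natCast, Int.natCast_natAbs, abs_of_neg hα2, Int.cast_neg, h1, map_one]
    decide
end
end GenusRank

namespace GenusRank
open Filter Topology nonZeroDivisors
open scoped Pointwise

section

lemma relIndex_compare {G G' : Type*} [Group G] [Group G'] (H K : Subgroup G) (H' K' : Subgroup G')
    (r : G → G' → Prop) (h1 : ∀ x ∈ K, ∃ y ∈ K', r x y)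
    (h2 : ∀ x x' y y', r x y → r x' y' → y⁻¹ * y' ∈ H' → x⁻¹ * x' ∈ H)
    (h0 : H'.relIndex K' ≠ 0) : H.relIndex K ≤ H'.relIndex K' ∧ H.relIndex K ≠ 0 := by
  classical
  have h1' : ∀ x : K, ∃ y : K', r x y := fun x => by
    obtain ⟨y, hy, h⟩ := h1 x x.2
    exact ⟨⟨y, hy⟩, h⟩
  choose f hf using h1'
  haveI : Finite (K' ⧸ H'.subgroupOf K') := Subgroup.index_ne_zero_iff_finite.1 h0
  let φ : (K ⧸ H.subgroupOf K) → (K' ⧸ H'.subgroupOf K') := fun c => QuotientGroup.mk (f c.out)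
  have hφ : Function.Injective φ := by
    intro c c' hcc
    have := QuotientGroup.eq.1 hcc
    rw [Subgroup.mem_subgroupOf] at this
    have h3 := h2 _ _ _ _ (hf c.out) (hf c'.out) (by simpa using this)
    rw [← QuotientGroup.out_eq' c, ← QuotientGroup.out_eq' c']
    refine QuotientGroup.eq.2 ?_
    rw [Subgroup.mem_subgroupOf]
    simpa using h3
  refine ⟨Nat.card_le_card_of_injective φ hφ, ?_⟩
  haveI := Finite.of_injective φ hφ
  exact Subgroup.index_ne_zero_of_finite

lemma chevalley_abs {M I C : Type*} [CommGroup M] [CommGroup I] [CommGroup C]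
    (d : M →* I) (q : I →* C) (hq : Function.Surjective q) (hdq : q.ker = d.range)
    (DM N : M →* M) (DI NI : I →* I) (DC : C →* C)
    (hd : ∀ x, d (DM x) = DI (d x)) (hN : ∀ x, d (N x) = NI (d x)) (hqD : ∀ a, q (DI a) = DC (q a))
    (hDN : ∀ x, DM (N x) = 1) (hND : ∀ x, N (DM x) = 1) (hNDI : ∀ x, NI (DI x) = 1)
    (h90 : ∀ x, N x = 1 → ∃ y, DM y = x)
    (J : Subgroup I) (hJ1 : DM.ker.map d ≤ J) (hJF : J ≤ DI.ker) (R h : ℕ)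
    (hR : J.relIndex DI.ker ≤ R) (hR0 : J.relIndex DI.ker ≠ 0)
    (hh : (DM.ker.map d).relIndex J ≤ h) (hh0 : (DM.ker.map d).relIndex J ≠ 0)
    (H0 : (d.ker.map N).relIndex (d.ker ⊓ DM.ker) ≠ 0) :
    Nat.card DC.ker * (d.ker.map DM).relIndex (d.ker ⊓ N.ker) ≤
      R * h * (d.ker.map N).relIndex (d.ker ⊓ DM.ker) := by
  set P := d.range
  set F := DI.ker
  set Pk := DM.ker.map d
  set S := DC.ker.comap q
  have hPkP : Pk ≤ P ⊓ F := by
    rintro _ ⟨x, hx, rfl⟩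
    refine ⟨⟨x, rfl⟩, ?_⟩
    change DI (d x) = 1
    rw [← hd, show DM x = 1 from hx, map_one]
  have hPkF : Pk.relIndex F = Pk.relIndex J * J.relIndex F := (Subgroup.relIndex_mul_relIndex _ _ _ hJ1 hJF).symm
  have hPkF' : Pk.relIndex (P ⊓ F) * (P ⊓ F).relIndex F = Pk.relIndex F :=
    Subgroup.relIndex_mul_relIndex _ _ _ hPkP inf_le_right
  have hne : Pk.relIndex (P ⊓ F) ≠ 0 := by
    intro h0
    rw [h0, zero_mul, hPkF] at hPkF'
    exact mul_ne_zero hh0 hR0 hPkF'.symm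
  have hFS : F ≤ S := by
    intro a ha
    change DC (q a) = 1
    rw [← hqD, show DI a = 1 from ha, map_one]
  have hPS : P ≤ S := by
    intro a ha
    have : q a = 1 := by rw [← hdq] at ha; exact ha
    change DC (q a) = 1
    rw [this, map_one]
  have hcard : Nat.card DC.ker = P.relIndex S := by
    rw [← hdq, Subgroup.relIndex_ker, Subgroup.map_comap_eq_self_of_surjective hq]
  have e1 : P.relIndex S = P.relIndex (F ⊔ P) * (F ⊔ P).relIndex S :=
    (Subgroup.relIndex_mul_relIndex _ _ _ le_sup_right (sup_le hFS hPS)).symm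
  have e2 : P.relIndex (F ⊔ P) = (P ⊓ F).relIndex F := by
    rw [Subgroup.relIndex_sup_right, Subgroup.inf_relIndex_right]
  have b1 := (relIndex_compare (d.ker.map DM) (d.ker ⊓ N.ker) Pk (P ⊓ F)
    (fun u w => ∃ y, DM y = u ∧ d y = w) (by
      rintro u ⟨hu, hu'⟩
      obtain ⟨y, rfl⟩ := h90 u hu'
      refine ⟨d y, ⟨⟨y, rfl⟩, ?_⟩, y, rfl, rfl⟩
      change DI (d y) = 1
      rw [← hd]; exact hu) (by
      rintro _ _ _ _ ⟨y, rfl, rfl⟩ ⟨y', rfl, rfl⟩ ⟨m, hm, hmm⟩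
      have hm' : DM m = 1 := hm
      refine ⟨y⁻¹ * y' * m⁻¹, ?_, ?_⟩
      · change d _ = 1
        rw [map_mul, map_mul, map_inv, map_inv, hmm, mul_inv_cancel]
      · simp [hm']) hne).1
  have b2 := (relIndex_compare (F ⊔ P) S (d.ker.map N) (d.ker ⊓ DM.ker)
    (fun a w => ∃ x, d x = DI a ∧ N x = w) (by
      intro a ha
      have : q (DI a) = 1 := by rw [hqD]; exact ha
      have h3 : DI a ∈ q.ker := this
      rw [hdq] at h3
      obtain ⟨x, hx⟩ := h3
      refine ⟨N x, ⟨?_, hDN x⟩, x, hx, rfl⟩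
      change d (N x) = 1
      rw [hN, hx, hNDI]) (by
      rintro a a' _ _ ⟨x, hx, rfl⟩ ⟨x', hx', rfl⟩ ⟨e, he, hee⟩
      have he' : d e = 1 := he
      obtain ⟨y, hy⟩ := h90 (x⁻¹ * x' * e⁻¹) (by rw [map_mul, map_mul, map_inv, map_inv, hee, mul_inv_cancel])
      have h4 : DI (a⁻¹ * a') = DI (d y) := by
        rw [← hd, hy]; simp [hx, hx', he']
      have h5 : a⁻¹ * a' = (a⁻¹ * a' * (d y)⁻¹) * d y := by group
      rw [h5]
      refine Subgroup.mul_mem_sup ?_ ⟨y, rfl⟩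
      change DI _ = 1
      rw [map_mul, h4, map_inv, mul_inv_cancel]) H0).1
  rw [hcard, e1, e2]
  calc (P ⊓ F).relIndex F * (F ⊔ P).relIndex S * (d.ker.map DM).relIndex (d.ker ⊓ N.ker)
      ≤ (P ⊓ F).relIndex F * (d.ker.map N).relIndex (d.ker ⊓ DM.ker) * Pk.relIndex (P ⊓ F) := by gcongr
    _ = Pk.relIndex J * J.relIndex F * (d.ker.map N).relIndex (d.ker ⊓ DM.ker) := by
        rw [← hPkF, ← hPkF']; ring
    _ ≤ h * R * (d.ker.map N).relIndex (d.ker ⊓ DM.ker) := by gcongr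
    _ = _ := by ring

end

end GenusRank

namespace GenusRank
open Filter Topology nonZeroDivisors
open scoped Pointwise

section

lemma q_mul {A : Type*} [AddCommGroup A] (f g : A →+ A) :
    (f.comp g).range.index * Nat.card f.ker * Nat.card g.ker =
      f.range.index * g.range.index * Nat.card (f.comp g).ker := by
  have h1 : (f.comp g).range.index = (g.range ⊔ f.ker).index * f.range.index := by
    rw [← AddSubgroup.index_map, AddMonoidHom.map_range]
  have h2 : g.range.index = g.range.relIndex f.ker * (g.range ⊔ f.ker).index := by
    rw [← AddSubgroup.relIndex_sup_left, AddSubgroup.relIndex_mul_index le_sup_left]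
  have h3 : Nat.card f.ker = Nat.card (g.range ⊓ f.ker : AddSubgroup A) * g.range.relIndex f.ker := by
    rw [← AddSubgroup.relIndex_bot_left, ← AddSubgroup.relIndex_bot_left, ← AddSubgroup.inf_relIndex_right g.range,
      AddSubgroup.relIndex_mul_relIndex _ _ _ bot_le inf_le_right]
  have h4 : Nat.card (f.comp g).ker = Nat.card g.ker * Nat.card (g.range ⊓ f.ker : AddSubgroup A) := by
    have : (f.comp g).ker = f.ker.comap g := rfl
    rw [this, ← AddSubgroup.map_comap_eq, ← AddSubgroup.relIndex_ker, ← AddSubgroup.relIndex_bot_left,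
      ← AddSubgroup.relIndex_bot_left, AddSubgroup.relIndex_mul_relIndex _ _ _ bot_le]
    intro x hx
    change f (g x) = 0
    rw [show g x = 0 from hx, map_zero]
  rw [h1, h2, h3, h4]
  ring

/-- the torsion subgroup -/
abbrev Tor (A : Type*) [AddCommGroup A] : AddSubgroup A := (Submodule.torsion ℤ A).toAddSubgroup

lemma mem_Tor {A : Type*} [AddCommGroup A] (x : A) : x ∈ Tor A ↔ ∃ n : ℤ, n ≠ 0 ∧ n • x = 0 := by
  change x ∈ Submodule.torsion ℤ A ↔ _
  rw [Submodule.mem_torsion_iff]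
  constructor
  · rintro ⟨a, ha⟩
    exact ⟨a, nonZeroDivisors.ne_zero a.2, ha⟩
  · rintro ⟨n, hn, h⟩
    exact ⟨⟨n, mem_nonZeroDivisors_of_ne_zero hn⟩, h⟩

lemma map_Tor {A : Type*} [AddCommGroup A] (f : A →+ A) {x : A} (hx : x ∈ Tor A) : f x ∈ Tor A := by
  rw [mem_Tor] at *
  obtain ⟨n, hn, h⟩ := hx
  exact ⟨n, hn, by rw [← map_zsmul, h, map_zero]⟩

lemma nsmul_Tor {A : Type*} [AddCommGroup A] {n : ℕ} (hn : n ≠ 0) {x : A} (hx : n • x ∈ Tor A) : x ∈ Tor A := by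
  rw [mem_Tor] at *
  obtain ⟨m, hm, h⟩ := hx
  exact ⟨m * n, mul_ne_zero hm (by exact_mod_cast hn), by rw [mul_smul, natCast_zsmul, h]⟩

lemma finite_Tor (A : Type*) [AddCommGroup A] [Module.Finite ℤ A] : Finite (Tor A) := by
  haveI : Module.Finite ℤ (Submodule.torsion ℤ A) := inferInstance
  haveI : AddGroup.FG (Submodule.torsion ℤ A) := Module.Finite.iff_addGroup_fg.1 this
  refine AddCommGroup.finite_of_fg_isAddTorsion (Submodule.torsion ℤ A) ?_
  intro x
  obtain ⟨n, hn, h⟩ := (mem_Tor (x : A)).1 x.2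
  rw [isOfFinAddOrder_iff_zsmul_eq_zero]
  exact ⟨n, hn, Subtype.ext (by simpa using h)⟩

/-- pulling back torsion -/
def TorInj {A : Type*} [AddCommGroup A] (f : A →+ A) : Prop := ∀ x, f x ∈ Tor A → x ∈ Tor A

lemma TorInj.ker_le {A : Type*} [AddCommGroup A] {f : A →+ A} (hf : TorInj f) : f.ker ≤ Tor A := by
  intro x hx
  refine hf x ?_
  rw [show f x = 0 from hx]
  exact zero_mem _

lemma TorInj.card_ker {A : Type*} [AddCommGroup A] [Module.Finite ℤ A] {f : A →+ A} (hf : TorInj f) :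
    Nat.card f.ker ≠ 0 := by
  haveI := finite_Tor A
  haveI : Finite f.ker := Finite.of_injective _ (AddSubgroup.inclusion_injective hf.ker_le)
  exact Nat.card_pos.ne'

lemma index_q {A : Type*} [AddCommGroup A] [Module.Finite ℤ A] (f : A →+ A) (hf : TorInj f) :
    f.range.index = (f.range ⊔ Tor A).index * Nat.card f.ker := by
  haveI := finite_Tor A
  have h1 : f.range.index = f.range.relIndex (Tor A) * (f.range ⊔ Tor A).index := by
    rw [← AddSubgroup.relIndex_sup_left, AddSubgroup.relIndex_mul_index le_sup_left]
  have h2 : f.range ⊓ Tor A = (Tor A).map f := by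
    ext y
    constructor
    · rintro ⟨⟨x, rfl⟩, hy⟩
      exact ⟨x, hf x hy, rfl⟩
    · rintro ⟨x, hx, rfl⟩
      exact ⟨⟨x, rfl⟩, map_Tor f hx⟩
  have h3 : Nat.card ((Tor A).map f) * f.range.relIndex (Tor A) = Nat.card (Tor A) := by
    rw [← h2, ← AddSubgroup.inf_relIndex_right, ← AddSubgroup.relIndex_bot_left, ← AddSubgroup.relIndex_bot_left,
      AddSubgroup.relIndex_mul_relIndex _ _ _ bot_le inf_le_right]
  have h4 : Nat.card f.ker * Nat.card ((Tor A).map f) = Nat.card (Tor A) := by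
    rw [← AddSubgroup.relIndex_ker, ← AddSubgroup.relIndex_bot_left, ← AddSubgroup.relIndex_bot_left,
      AddSubgroup.relIndex_mul_relIndex _ _ _ bot_le hf.ker_le]
  have h5 : Nat.card ((Tor A).map f) ≠ 0 := by
    intro h
    rw [h, zero_mul] at h3
    exact Nat.card_pos.ne' h3.symm
  have h6 : f.range.relIndex (Tor A) = Nat.card f.ker := by
    apply Nat.eq_of_mul_eq_mul_left (Nat.pos_of_ne_zero h5)
    rw [h3, ← h4, mul_comm]
  rw [h1, h6, mul_comm]

/-- absolute determinant modulo torsion -/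
noncomputable def bdet {A : Type*} [AddCommGroup A] (f : A →+ A) : ℕ := (f.range ⊔ Tor A).index

lemma TorInj.comp {A : Type*} [AddCommGroup A] {f g : A →+ A} (hf : TorInj f) (hg : TorInj g) :
    TorInj (f.comp g) := fun x hx => hg x (hf _ hx)

lemma bdet_comp {A : Type*} [AddCommGroup A] [Module.Finite ℤ A] (f g : A →+ A) (hf : TorInj f) (hg : TorInj g) :
    bdet (f.comp g) = bdet f * bdet g := by
  have h := q_mul f g
  rw [index_q f hf, index_q g hg, index_q _ (hf.comp hg)] at h
  have h1 := hf.card_ker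
  have h2 := hg.card_ker
  have h3 := (hf.comp hg).card_ker
  apply Nat.eq_of_mul_eq_mul_right (Nat.pos_of_ne_zero (mul_ne_zero (mul_ne_zero h1 h2) h3))
  simp only [bdet]
  linarith

lemma bdet_pow {A : Type*} [AddCommGroup A] [Module.Finite ℤ A] (f : AddMonoid.End A) (hf : TorInj f) (n : ℕ) :
    TorInj (f ^ n : AddMonoid.End A) ∧ bdet (f ^ n : AddMonoid.End A) = bdet f ^ n := by
  induction n with
  | zero =>
    refine ⟨fun x hx => hx, ?_⟩
    rw [pow_zero, pow_zero]
    change ((1 : AddMonoid.End A).range ⊔ Tor A).index = 1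
    have : AddMonoidHom.range (AddMonoidHom.id A) = ⊤ := AddMonoidHom.range_eq_top.2 fun x => ⟨x, rfl⟩
    change (AddMonoidHom.range (AddMonoidHom.id A) ⊔ Tor A).index = 1
    rw [this]; simp
  | succ n ih =>
    have : (f ^ (n+1) : AddMonoid.End A) = AddMonoidHom.comp (f ^ n : AddMonoid.End A) f := by rw [pow_succ]; rfl
    rw [this]
    refine ⟨ih.1.comp hf, ?_⟩
    rw [bdet_comp _ _ ih.1 hf, ih.2, pow_succ]

lemma index_free (ℓ n : ℕ) : ((nsmulAddMonoidHom ℓ : (Fin n → ℤ) →+ (Fin n → ℤ)).range).index = ℓ ^ n := by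
  have : (nsmulAddMonoidHom ℓ : (Fin n → ℤ) →+ (Fin n → ℤ)).range =
      AddSubgroup.pi Set.univ (fun _ : Fin n => AddSubgroup.zmultiples (ℓ : ℤ)) := by
    ext x
    rw [AddSubgroup.mem_pi]
    constructor
    · rintro ⟨y, rfl⟩ i -
      rw [Int.mem_zmultiples_iff]
      exact ⟨y i, by simp⟩
    · intro h
      have : ∀ i, ∃ c, x i = ℓ * c := fun i => Int.mem_zmultiples_iff.1 (h i trivial)
      choose c hc using this
      exact ⟨c, by ext i; simp [hc]⟩
  rw [this, AddSubgroup.index_pi]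
  simp [Int.index_zmultiples]

lemma bdet_nsmul {A : Type*} [AddCommGroup A] [Module.Finite ℤ A] (ℓ : ℕ) :
    bdet (nsmulAddMonoidHom ℓ : A →+ A) = ℓ ^ Module.finrank ℤ A := by
  let Q := A ⧸ Submodule.torsion ℤ A
  have hr : Module.finrank ℤ Q = Module.finrank ℤ A := finrank_quotient_eq_of_le_torsion fun ⦃x⦄ a => a
  let b := Module.finBasis ℤ Q
  let π : A →+ (Fin (Module.finrank ℤ Q) → ℤ) :=
    ((b.equivFun.toLinearMap ∘ₗ (Submodule.torsion ℤ A).mkQ)).toAddMonoidHom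
  have hπ : Function.Surjective π :=
    b.equivFun.surjective.comp (Submodule.mkQ_surjective _)
  have hker : π.ker = Tor A := by
    ext x
    change b.equivFun ((Submodule.torsion ℤ A).mkQ x) = 0 ↔ x ∈ Submodule.torsion ℤ A
    rw [LinearEquiv.map_eq_zero_iff, Submodule.mkQ_apply, Submodule.Quotient.mk_eq_zero]
  rw [bdet, ← hker, ← hr, ← index_free ℓ]
  have h1 := AddSubgroup.index_map (nsmulAddMonoidHom ℓ : A →+ A).range π
  rw [AddMonoidHom.range_eq_top.2 hπ, AddSubgroup.index_top, mul_one] at h1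
  rw [← h1]
  congr 1
  ext y
  constructor
  · rintro ⟨_, ⟨x, rfl⟩, rfl⟩
    exact ⟨π x, by simp⟩
  · rintro ⟨z, rfl⟩
    obtain ⟨x, rfl⟩ := hπ z
    exact ⟨ℓ • x, ⟨x, rfl⟩, by simp⟩

lemma poly_geom (ℓ : ℕ) (hℓ : ℓ.Prime) : ∃ U W : Polynomial ℤ,
    (∑ i ∈ Finset.range ℓ, (Polynomial.X : Polynomial ℤ) ^ i) = (Polynomial.X - 1) ^ (ℓ - 1) + (ℓ : Polynomial ℤ) * U ∧
    (∑ i ∈ Finset.range ℓ, (Polynomial.X : Polynomial ℤ) ^ i) = (ℓ : Polynomial ℤ) + W * (Polynomial.X - 1) := by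
  obtain ⟨r, hr⟩ := exists_add_pow_prime_eq hℓ (Polynomial.X - 1 : Polynomial ℤ) 1
  have hX : (Polynomial.X - 1 : Polynomial ℤ) ≠ 0 := by
    have := Polynomial.X_sub_C_ne_zero (1 : ℤ)
    simpa using this
  have hg := mul_geom_sum (Polynomial.X : Polynomial ℤ) ℓ
  have hdvd : (Polynomial.X - 1 : Polynomial ℤ) ∣
      (∑ i ∈ Finset.range ℓ, (Polynomial.X : Polynomial ℤ) ^ i) - (ℓ : Polynomial ℤ) := by
    have h1 : (Polynomial.X - 1 : Polynomial ℤ) = Polynomial.X - Polynomial.C 1 := by simp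
    rw [h1, Polynomial.dvd_iff_isRoot]
    simp [Polynomial.eval_finset_sum]
  obtain ⟨W, hW⟩ := hdvd
  refine ⟨r, W, ?_, ?_⟩
  · apply mul_left_cancel₀ hX
    rw [hg]
    have h2 : (Polynomial.X - 1 : Polynomial ℤ) ^ ℓ = (Polynomial.X - 1) * (Polynomial.X - 1) ^ (ℓ - 1) := by
      rw [← pow_succ', Nat.sub_add_cancel hℓ.one_le]
    rw [h2] at hr
    simp only [sub_add_cancel, one_pow, mul_one] at hr
    rw [hr]; ring
  · linear_combination hW

lemma core_B {B : Type*} [AddCommGroup B] [Module.Finite ℤ B] (ℓ : ℕ) (hℓ : ℓ.Prime) (s : AddMonoid.End B)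
    (hs : ∑ i ∈ Finset.range ℓ, s ^ i = 0) :
    (AddMonoidHom.range (s - 1 : AddMonoid.End B)).index =
      bdet (s - 1 : AddMonoid.End B) * Nat.card (AddMonoidHom.ker (s - 1 : AddMonoid.End B)) ∧
    bdet (s - 1 : AddMonoid.End B) ≠ 0 ∧ Nat.card (AddMonoidHom.ker (s - 1 : AddMonoid.End B)) ≠ 0 ∧
    ℓ ^ Module.finrank ℤ B ≤ (bdet (s - 1 : AddMonoid.End B)) ^ (ℓ - 1) := by
  obtain ⟨U, W, hU, hW⟩ := poly_geom ℓ hℓ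
  let φ := Polynomial.aeval (R := ℤ) s
  have hU' := congrArg φ hU
  have hW' := congrArg φ hW
  have hφX : φ Polynomial.X = s := Polynomial.aeval_X s
  simp only [map_sum, map_pow, map_add, map_mul, map_sub, map_one, map_natCast, hφX, hs] at hU' hW'
  set D : AddMonoid.End B := s - 1 with hD
  have hℓ0 := hℓ.ne_zero
  have hpow : ∀ x, (D ^ (ℓ - 1)) x = ℓ • (- φ U) x := by
    intro x
    have : D ^ (ℓ - 1) = (ℓ : AddMonoid.End B) * (- φ U) := by
      rw [mul_neg]; exact eq_neg_of_add_eq_zero_left hU'.symm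
    rw [this]
    change (ℓ : AddMonoid.End B) ((- φ U) x) = _
    simp
  have hlin : ∀ x, ℓ • x = (- φ W) (D x) := by
    intro x
    have : (ℓ : AddMonoid.End B) = (- φ W) * D := by
      rw [neg_mul]; exact eq_neg_of_add_eq_zero_left hW'.symm
    have h2 := congrArg (fun f : AddMonoid.End B => f x) this
    change (ℓ : AddMonoid.End B) x = (- φ W) (D x) at h2
    rw [← h2]; simp
  have hcomm : φ W * D = D * φ W := by
    have : D = φ (Polynomial.X - 1) := by simp [hφX, hD]
    rw [this, ← map_mul, mul_comm, map_mul]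
  have hlin' : ∀ x, ℓ • x = D ((- φ W) x) := by
    intro x
    have : (ℓ : AddMonoid.End B) = D * (- φ W) := by
      rw [mul_neg, ← hcomm]; exact eq_neg_of_add_eq_zero_left hW'.symm
    have h2 := congrArg (fun f : AddMonoid.End B => f x) this
    change (ℓ : AddMonoid.End B) x = D ((- φ W) x) at h2
    rw [← h2]; simp
  have hTD : TorInj D := by
    intro x hx
    apply nsmul_Tor hℓ0
    rw [hlin]
    exact map_Tor _ hx
  have hTl : TorInj (nsmulAddMonoidHom ℓ : B →+ B) := fun x hx => nsmul_Tor hℓ0 hx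
  obtain ⟨hTp, hbp⟩ := bdet_pow D hTD (ℓ - 1)
  have hcomp : (D ^ (ℓ - 1) : AddMonoid.End B) = AddMonoidHom.comp (nsmulAddMonoidHom ℓ : B →+ B) (- φ U : AddMonoid.End B) := by
    ext x
    exact hpow x
  have hTU : TorInj (- φ U : AddMonoid.End B) := by
    intro x hx
    apply hTp
    have h7 : ℓ • (- φ U) x ∈ Tor B := nsmul_mem hx _
    rw [← hpow] at h7
    exact h7
  have hb0 : bdet D ≠ 0 := by
    have h1 : bdet (nsmulAddMonoidHom ℓ : B →+ B) ≠ 0 := by rw [bdet_nsmul]; exact pow_ne_zero _ hℓ0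
    intro h0
    apply h1
    refine Nat.eq_zero_of_zero_dvd ?_
    rw [← h0]
    apply AddSubgroup.index_dvd_of_le
    refine sup_le_sup_right ?_ _
    rintro _ ⟨x, rfl⟩
    exact ⟨(- φ W) x, (hlin' x).symm⟩
  refine ⟨index_q D hTD, hb0, hTD.card_ker, ?_⟩
  have h5 := bdet_comp _ _ hTl hTU
  rw [← hcomp, hbp, bdet_nsmul] at h5
  rw [h5]
  refine Nat.le_mul_of_pos_right _ (Nat.pos_of_ne_zero ?_)
  intro h0
  rw [h0, mul_zero] at h5
  exact pow_ne_zero _ hb0 h5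

end

end GenusRank

namespace GenusRank
open Filter Topology nonZeroDivisors
open scoped Pointwise

section

lemma finite_sub {A : Type*} [AddCommGroup A] [Module.Finite ℤ A] (B : AddSubgroup A) : Module.Finite ℤ B :=
  Module.Finite.of_injective (B.subtype.toIntLinearMap) B.subtype_injective

lemma rank_ker_add {A : Type*} [AddCommGroup A] [Module.Finite ℤ A] (N : A →+ A) (C : AddSubgroup A) (h : N.range ≤ C) :
    Module.finrank ℤ A ≤ Module.finrank ℤ N.ker + Module.finrank ℤ C := by
  have h1 := Submodule.finrank_quotient_add_finrank (LinearMap.ker N.toIntLinearMap)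
  have h2 := LinearEquiv.finrank_eq (LinearMap.quotKerEquivRange N.toIntLinearMap)
  have h3 : Module.finrank ℤ (LinearMap.range N.toIntLinearMap) ≤ Module.finrank ℤ (AddSubgroup.toIntSubmodule C) := by
    apply Submodule.finrank_mono
    rintro _ ⟨x, rfl⟩
    exact h ⟨x, rfl⟩
  have h4 : Module.finrank ℤ (AddSubgroup.toIntSubmodule C) = Module.finrank ℤ C := rfl
  have h5 : Module.finrank ℤ (LinearMap.ker N.toIntLinearMap) = Module.finrank ℤ N.ker := rfl
  omega

lemma herbrand {A : Type*} [AddCommGroup A] [Module.Finite ℤ A] (ℓ : ℕ) (hℓ : ℓ.Prime)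
    (s D N : A →+ A) (hD : ∀ x, D x = s x - x) (hN : ∀ x, N x = ∑ i ∈ Finset.range ℓ, s^[i] x)
    (hs : ∀ x, s^[ℓ] x = x) (e : ℕ)
    (he : Module.finrank ℤ D.ker + (ℓ - 1) * e ≤ Module.finrank ℤ A) :
    ℓ ^ e * N.range.relIndex D.ker ≤ ℓ ^ (Module.finrank ℤ D.ker) * D.range.relIndex N.ker ∧
    N.range.relIndex D.ker ≠ 0 ∧ D.range.relIndex N.ker ≠ 0 := by
  haveI := finite_sub D.ker
  haveI := finite_sub N.ker
  have hℓ0 := hℓ.ne_zero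
  have hsN : ∀ x, s (N x) = N x := by
    intro x
    rw [hN, map_sum]
    simp only [← Function.iterate_succ_apply' s]
    have := Finset.sum_range_succ' (fun i => s^[i] x) ℓ
    rw [Finset.sum_range_succ, hs] at this
    simp only [Function.iterate_zero, id] at this
    exact (add_right_cancel this).symm
  have hNs : ∀ x, N (s x) = N x := by
    intro x
    have : N (s x) = s (N x) := by
      rw [hN, hN, map_sum]
      simp only [← Function.iterate_succ_apply' s, ← Function.iterate_succ_apply]
    rw [this, hsN]
  have hDN : N.range ≤ D.ker := by
    rintro _ ⟨x, rfl⟩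
    change D (N x) = 0
    rw [hD, hsN, sub_self]
  have hND : D.range ≤ N.ker := by
    rintro _ ⟨x, rfl⟩
    change N (D x) = 0
    rw [hD, map_sub, hNs, sub_self]
  have hfix : ∀ x ∈ D.ker, s x = x := fun x hx => by
    have : D x = 0 := hx
    rw [hD] at this
    exact sub_eq_zero.1 this
  have hNfix : ∀ x ∈ D.ker, N x = ℓ • x := by
    intro x hx
    rw [hN]
    have : ∀ i, s^[i] x = x := fun i => Function.iterate_fixed (hfix x hx) i
    simp [this]
  -- restricted s
  let B := N.ker
  let sB : AddMonoid.End B := (s.comp B.subtype).codRestrict B (fun x => by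
    change N (s x) = 0
    rw [hNs]; exact x.2)
  have hsB : ∀ x : B, ((sB x : B) : A) = s x := fun x => rfl
  have hsBi : ∀ i (x : B), (((sB ^ i) x : B) : A) = s^[i] x := by
    intro i
    induction i with
    | zero => intro x; rfl
    | succ i ih =>
      intro x
      have : (sB ^ (i+1)) x = sB ((sB ^ i) x) := by rw [pow_succ']; rfl
      rw [this, hsB, ih, ← Function.iterate_succ_apply' s]
  have hsum : ∑ i ∈ Finset.range ℓ, sB ^ i = 0 := by
    ext x
    have h1 : (((∑ i ∈ Finset.range ℓ, sB ^ i) x : B) : A) = N x := by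
      have : ((∑ i ∈ Finset.range ℓ, sB ^ i : AddMonoid.End B) x) = ∑ i ∈ Finset.range ℓ, (sB ^ i) x :=
        AddMonoidHom.finset_sum_apply _ _ _
      rw [this, hN]
      push_cast
      exact Finset.sum_congr rfl fun i _ => hsBi i x
    rw [h1]
    exact x.2
  obtain ⟨c1, c2, c3, c4⟩ := core_B ℓ hℓ sB hsum
  have hDB : ∀ x : B, (((sB - 1 : AddMonoid.End B) x : B) : A) = D x := by
    intro x
    rw [hD]
    rfl
  -- transfer index
  have t1 : (N.ker.map D).relIndex N.ker = (AddMonoidHom.range (sB - 1 : AddMonoid.End B)).index := by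
    rw [AddSubgroup.relIndex]
    congr 1
    ext x
    rw [AddSubgroup.mem_addSubgroupOf]
    constructor
    · rintro ⟨y, hy, hyx⟩
      exact ⟨⟨y, hy⟩, Subtype.ext ((hDB ⟨y, hy⟩).trans hyx)⟩
    · rintro ⟨y, rfl⟩
      exact ⟨y, y.2, (hDB y).symm⟩
  have t2 : (D.ker.map N).relIndex D.ker = (nsmulAddMonoidHom ℓ : D.ker →+ D.ker).range.index := by
    rw [AddSubgroup.relIndex]
    congr 1
    ext x
    rw [AddSubgroup.mem_addSubgroupOf]
    constructor
    · rintro ⟨y, hy, hyx⟩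
      exact ⟨⟨y, hy⟩, Subtype.ext ((hNfix y hy).symm.trans hyx)⟩
    · rintro ⟨y, rfl⟩
      exact ⟨y, y.2, hNfix y y.2⟩
  have t3 : Nat.card (nsmulAddMonoidHom ℓ : D.ker →+ D.ker).ker = Nat.card (AddMonoidHom.ker (sB - 1 : AddMonoid.End B)) := by
    refine Nat.card_congr ⟨fun x => ⟨⟨x.1.1, ?_⟩, ?_⟩, fun x => ⟨⟨x.1.1, ?_⟩, ?_⟩, fun x => rfl, fun x => rfl⟩
    · change N x.1.1 = 0
      rw [hNfix _ x.1.2]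
      exact congrArg Subtype.val x.2
    · refine Subtype.ext ?_
      exact (hDB _).trans x.1.2
    · change D x.1.1 = 0
      rw [← hDB x.1]
      exact congrArg Subtype.val x.2
    · refine Subtype.ext ?_
      have h1 : x.1.1 ∈ D.ker := by
        change D x.1.1 = 0
        rw [← hDB x.1]
        exact congrArg Subtype.val x.2
      exact (hNfix _ h1).symm.trans x.1.2
  have t4 := index_q (nsmulAddMonoidHom ℓ : D.ker →+ D.ker) (fun x hx => nsmul_Tor hℓ0 hx)
  change _ = bdet (nsmulAddMonoidHom ℓ : D.ker →+ D.ker) * _ at t4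
  rw [bdet_nsmul, t3, ← t2] at t4
  rw [← t1] at c1
  -- chains
  have k1 : (D.ker.map N).relIndex N.range * N.range.relIndex D.ker = (D.ker.map N).relIndex D.ker :=
    AddSubgroup.relIndex_mul_relIndex _ _ _ (by rintro _ ⟨y, _, rfl⟩; exact ⟨y, rfl⟩) hDN
  have k2 : (N.ker.map D).relIndex D.range * D.range.relIndex N.ker = (N.ker.map D).relIndex N.ker :=
    AddSubgroup.relIndex_mul_relIndex _ _ _ (by rintro _ ⟨y, _, rfl⟩; exact ⟨y, rfl⟩) hND
  have k3 : (D.ker.map N).relIndex N.range = (N.ker.map D).relIndex D.range := by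
    rw [AddMonoidHom.range_eq_map, AddMonoidHom.range_eq_map, AddSubgroup.relIndex_map_map, AddSubgroup.relIndex_map_map,
      sup_comm D.ker]
    simp
  rw [c1] at k2
  rw [t4, k3] at k1
  set m := (N.ker.map D).relIndex D.range
  set τ := Nat.card (AddMonoidHom.ker (sB - 1 : AddMonoid.End B))
  set b := bdet (sB - 1 : AddMonoid.End B)
  have hm : m ≠ 0 := by
    intro h; rw [h, zero_mul] at k2
    exact mul_ne_zero c2 c3 k2.symm
  have hbe : ℓ ^ e ≤ b := by
    have hr := rank_ker_add N D.ker hDN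
    change _ ≤ Module.finrank ℤ B + _ at hr
    have h1 : ℓ ^ ((ℓ - 1) * e) ≤ b ^ (ℓ - 1) :=
      le_trans (Nat.pow_le_pow_right hℓ.pos (by omega)) c4
    rw [mul_comm, pow_mul] at h1
    exact (Nat.pow_le_pow_iff_left (by have := hℓ.two_le; omega)).1 h1
  refine ⟨?_, ?_, ?_⟩
  · apply Nat.le_of_mul_le_mul_left _ (Nat.pos_of_ne_zero hm)
    calc m * (ℓ ^ e * N.range.relIndex D.ker) = ℓ ^ e * (m * N.range.relIndex D.ker) := by ring
      _ = ℓ ^ e * (ℓ ^ (Module.finrank ℤ D.ker) * τ) := by rw [k1]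
      _ ≤ b * (ℓ ^ (Module.finrank ℤ D.ker) * τ) := by gcongr
      _ = ℓ ^ (Module.finrank ℤ D.ker) * (m * D.range.relIndex N.ker) := by rw [k2]; ring
      _ = _ := by ring
  · intro h; rw [h, mul_zero] at k1
    exact mul_ne_zero (pow_ne_zero _ hℓ0) c3 k1.symm
  · intro h; rw [h, mul_zero] at k2
    exact mul_ne_zero c2 c3 k2.symm

end

end GenusRank

namespace GenusRank
open Filter Topology nonZeroDivisors
open scoped Pointwise

section

/-- `σ - 1` -/
def Dh {G : Type*} [CommGroup G] (σ : G →* G) : G →* G := σ / MonoidHom.id G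

lemma Dh_apply {G : Type*} [CommGroup G] (σ : G →* G) (x : G) : Dh σ x = σ x / x := rfl

lemma mem_ker_Dh {G : Type*} [CommGroup G] (σ : G →* G) (x : G) : x ∈ (Dh σ).ker ↔ σ x = x := by
  change σ x / x = 1 ↔ _
  rw [div_eq_one]

/-- norm -/
def Nh {G : Type*} [CommGroup G] (ℓ : ℕ) (σ : G →* G) : G →* G where
  toFun x := ∏ i ∈ Finset.range ℓ, σ^[i] x
  map_one' := by
    have : ∀ i, σ^[i] 1 = 1 := fun i => iterate_map_one σ i
    simp [this]
  map_mul' x y := by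
    have : ∀ i, σ^[i] (x * y) = σ^[i] x * σ^[i] y := fun i => iterate_map_mul σ i x y
    simp [this, Finset.prod_mul_distrib]

lemma Nh_apply {G : Type*} [CommGroup G] (ℓ : ℕ) (σ : G →* G) (x : G) : Nh ℓ σ x = ∏ i ∈ Finset.range ℓ, σ^[i] x := rfl

lemma sigma_Nh {G : Type*} [CommGroup G] (ℓ : ℕ) (σ : G →* G) (hs : ∀ x, σ^[ℓ] x = x) (x : G) :
    σ (Nh ℓ σ x) = Nh ℓ σ x := by
  rw [Nh_apply, map_prod]
  simp only [← Function.iterate_succ_apply' σ]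
  have := Finset.prod_range_succ' (fun i => σ^[i] x) ℓ
  rw [Finset.prod_range_succ, hs] at this
  simp only [Function.iterate_zero, id] at this
  exact (mul_right_cancel this).symm

lemma Nh_sigma {G : Type*} [CommGroup G] (ℓ : ℕ) (σ : G →* G) (hs : ∀ x, σ^[ℓ] x = x) (x : G) :
    Nh ℓ σ (σ x) = Nh ℓ σ x := by
  have : Nh ℓ σ (σ x) = σ (Nh ℓ σ x) := by
    rw [Nh_apply, Nh_apply, map_prod]
    simp only [← Function.iterate_succ_apply' σ, ← Function.iterate_succ_apply]
  rw [this, sigma_Nh ℓ σ hs]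

lemma Dh_Nh {G : Type*} [CommGroup G] (ℓ : ℕ) (σ : G →* G) (hs : ∀ x, σ^[ℓ] x = x) (x : G) :
    Dh σ (Nh ℓ σ x) = 1 := by
  rw [Dh_apply, sigma_Nh ℓ σ hs, div_self']

lemma Nh_Dh {G : Type*} [CommGroup G] (ℓ : ℕ) (σ : G →* G) (hs : ∀ x, σ^[ℓ] x = x) (x : G) :
    Nh ℓ σ (Dh σ x) = 1 := by
  rw [Dh_apply, map_div, Nh_sigma ℓ σ hs, div_self']

lemma map_Dh {G G' : Type*} [CommGroup G] [CommGroup G'] (f : G →* G') (σ : G →* G) (σ' : G' →* G')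
    (h : ∀ x, f (σ x) = σ' (f x)) (x : G) : f (Dh σ x) = Dh σ' (f x) := by
  rw [Dh_apply, map_div, h, Dh_apply]

lemma map_Nh {G G' : Type*} [CommGroup G] [CommGroup G'] (f : G →* G') (ℓ : ℕ) (σ : G →* G) (σ' : G' →* G')
    (h : ∀ x, f (σ x) = σ' (f x)) (x : G) : f (Nh ℓ σ x) = Nh ℓ σ' (f x) := by
  have : ∀ i, f (σ^[i] x) = σ'^[i] (f x) := by
    intro i
    induction i with
    | zero => rfl
    | succ i ih => rw [Function.iterate_succ_apply', Function.iterate_succ_apply', h, ih]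
  rw [Nh_apply, map_prod, Nh_apply]
  simp [this]

lemma herbrand_mul {U : Type*} [CommGroup U] [Module.Finite ℤ (Additive U)] (ℓ : ℕ) (hℓ : ℓ.Prime)
    (σ : U →* U) (hs : ∀ x, σ^[ℓ] x = x) (r e : ℕ)
    (hr : Module.finrank ℤ (Additive (Dh σ).ker) = r)
    (he : r + (ℓ - 1) * e ≤ Module.finrank ℤ (Additive U)) :
    ℓ ^ e * (Nh ℓ σ).range.relIndex (Dh σ).ker ≤ ℓ ^ r * (Dh σ).range.relIndex (Nh ℓ σ).ker ∧
    (Nh ℓ σ).range.relIndex (Dh σ).ker ≠ 0 ∧ (Dh σ).range.relIndex (Nh ℓ σ).ker ≠ 0 := by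
  have hr' : Module.finrank ℤ (MonoidHom.toAdditive (Dh σ)).ker = r := hr
  have := herbrand ℓ hℓ (MonoidHom.toAdditive σ) (MonoidHom.toAdditive (Dh σ)) (MonoidHom.toAdditive (Nh ℓ σ))
    (fun x => rfl) (fun x => rfl) (fun x => hs x) e (by rw [hr']; exact he)
  rw [hr'] at this
  exact this

lemma abs_bound {M I C U : Type*} [CommGroup M] [CommGroup I] [CommGroup C] [CommGroup U]
    [Module.Finite ℤ (Additive U)] (ℓ : ℕ) (hℓ : ℓ.Prime)
    (d : M →* I) (q : I →* C) (hq : Function.Surjective q) (hdq : q.ker = d.range)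
    (ι : U →* M) (hι : Function.Injective ι) (hιd : ι.range = d.ker)
    (σM : M →* M) (σI : I →* I) (σC : C →* C) (σU : U →* U)
    (hMU : ∀ x, ι (σU x) = σM (ι x)) (hd : ∀ x, d (σM x) = σI (d x)) (hqs : ∀ a, q (σI a) = σC (q a))
    (hsM : ∀ x, σM^[ℓ] x = x) (hsI : ∀ x, σI^[ℓ] x = x) (hsU : ∀ x, σU^[ℓ] x = x)
    (h90 : ∀ x, Nh ℓ σM x = 1 → ∃ y, Dh σM y = x)
    (J : Subgroup I) (hJ1 : (Dh σM).ker.map d ≤ J) (hJF : J ≤ (Dh σI).ker) (R h : ℕ)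
    (hR : J.relIndex (Dh σI).ker ≤ R) (hR0 : J.relIndex (Dh σI).ker ≠ 0)
    (hh : ((Dh σM).ker.map d).relIndex J ≤ h) (hh0 : ((Dh σM).ker.map d).relIndex J ≠ 0)
    (r e : ℕ) (hr : Module.finrank ℤ (Additive (Dh σU).ker) = r)
    (he : r + (ℓ - 1) * e ≤ Module.finrank ℤ (Additive U)) :
    ℓ ^ e * Nat.card (Dh σC).ker ≤ ℓ ^ r * R * h := by
  obtain ⟨b1, b2, b3⟩ := herbrand_mul ℓ hℓ σU hsU r e hr he
  have hDι := map_Dh ι σU σM hMU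
  have hNι := map_Nh ι ℓ σU σM hMU
  have kDD : (Dh σU).ker.map ι = d.ker ⊓ (Dh σM).ker := by
    rw [← hιd]
    ext x
    constructor
    · rintro ⟨u, hu, rfl⟩
      refine ⟨⟨u, rfl⟩, ?_⟩
      change Dh σM (ι u) = 1
      rw [← hDι, show Dh σU u = 1 from hu, map_one]
    · rintro ⟨⟨u, rfl⟩, hu⟩
      refine ⟨u, hι ?_, rfl⟩
      rw [hDι, map_one]; exact hu
  have kNN : (Nh ℓ σU).ker.map ι = d.ker ⊓ (Nh ℓ σM).ker := by
    rw [← hιd]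
    ext x
    constructor
    · rintro ⟨u, hu, rfl⟩
      refine ⟨⟨u, rfl⟩, ?_⟩
      change Nh ℓ σM (ι u) = 1
      rw [← hNι, show Nh ℓ σU u = 1 from hu, map_one]
    · rintro ⟨⟨u, rfl⟩, hu⟩
      refine ⟨u, hι ?_, rfl⟩
      rw [hNι, map_one]; exact hu
  have rD : (Dh σU).range.map ι = d.ker.map (Dh σM) := by
    rw [← hιd]
    ext x
    constructor
    · rintro ⟨_, ⟨u, rfl⟩, rfl⟩
      exact ⟨ι u, ⟨u, rfl⟩, (hDι u).symm⟩
    · rintro ⟨_, ⟨u, rfl⟩, rfl⟩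
      exact ⟨_, ⟨u, rfl⟩, hDι u⟩
  have rN : (Nh ℓ σU).range.map ι = d.ker.map (Nh ℓ σM) := by
    rw [← hιd]
    ext x
    constructor
    · rintro ⟨_, ⟨u, rfl⟩, rfl⟩
      exact ⟨ι u, ⟨u, rfl⟩, (hNι u).symm⟩
    · rintro ⟨_, ⟨u, rfl⟩, rfl⟩
      exact ⟨_, ⟨u, rfl⟩, hNι u⟩
  rw [← Subgroup.relIndex_map_map_of_injective _ _ hι, ← Subgroup.relIndex_map_map_of_injective _ _ hι,
    kDD, kNN, rD, rN] at b1
  rw [← Subgroup.relIndex_map_map_of_injective _ _ hι, kDD, rN] at b2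
  rw [← Subgroup.relIndex_map_map_of_injective _ _ hι, kNN, rD] at b3
  have hch := chevalley_abs d q hq hdq (Dh σM) (Nh ℓ σM) (Dh σI) (Nh ℓ σI) (Dh σC)
    (map_Dh d σM σI hd) (map_Nh d ℓ σM σI hd) (map_Dh q σI σC hqs) (Dh_Nh ℓ σM hsM) (Nh_Dh ℓ σM hsM)
    (Nh_Dh ℓ σI hsI) h90 J hJ1 hJF R h hR hR0 hh hh0 b2
  apply Nat.le_of_mul_le_mul_right _ (Nat.pos_of_ne_zero b3)
  set H1 := (d.ker.map (Dh σM)).relIndex (d.ker ⊓ (Nh ℓ σM).ker)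
  set H0 := (d.ker.map (Nh ℓ σM)).relIndex (d.ker ⊓ (Dh σM).ker)
  calc ℓ ^ e * Nat.card (Dh σC).ker * H1 = ℓ ^ e * (Nat.card (Dh σC).ker * H1) := by ring
    _ ≤ ℓ ^ e * (R * h * H0) := by gcongr
    _ = R * h * (ℓ ^ e * H0) := by ring
    _ ≤ R * h * (ℓ ^ r * H1) := by gcongr
    _ = _ := by ring

end

end GenusRank

namespace GenusRank
open Filter Topology nonZeroDivisors
open scoped Pointwise

section
variable {k K : Type*} [Field k] [NumberField k] [Field K] [NumberField K] [Algebra k K]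

lemma conj_of_under_eq [IsGalois k K] (P Q : HeightOneSpectrum (𝓞 K)) (hQ : Q.under (𝓞 k) = P.under (𝓞 k)) :
    ∃ g : K ≃ₐ[k] K, g • P.asIdeal = Q.asIdeal := by
  have := P.isPrime
  have := Q.isPrime
  have : Q.asIdeal.LiesOver (P.under (𝓞 k)).asIdeal := by rw [← hQ]; infer_instance
  exact Ideal.exists_smul_eq_of_isGaloisGroup (P.under (𝓞 k)).asIdeal P.asIdeal Q.asIdeal (K ≃ₐ[k] K)

lemma smul_map_eq (g : K ≃ₐ[k] K) (v : Ideal (𝓞 k)) :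
    g • (Ideal.map (algebraMap (𝓞 k) (𝓞 K)) v) = Ideal.map (algebraMap (𝓞 k) (𝓞 K)) v := by
  have h : ∀ g : K ≃ₐ[k] K, g • (Ideal.map (algebraMap (𝓞 k) (𝓞 K)) v) ≤ Ideal.map (algebraMap (𝓞 k) (𝓞 K)) v := by
    intro g
    have h := (smul_dvd_map g⁻¹ _ v (dvd_refl _))
    rw [Ideal.dvd_iff_le] at h
    have h2 := Ideal.map_mono (f := MulSemiringAction.toRingHom (K ≃ₐ[k] K) (𝓞 K) g) h
    change g • Ideal.map (algebraMap (𝓞 k) (𝓞 K)) v ≤ g • (g⁻¹ • Ideal.map (algebraMap (𝓞 k) (𝓞 K)) v) at h2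
    rwa [smul_inv_smul] at h2
  exact le_antisymm (h g) (Ideal.dvd_iff_le.1 (smul_dvd_map g _ v (dvd_refl _)))

lemma smul_mul_ideal (g : K ≃ₐ[k] K) (I J : Ideal (𝓞 K)) : g • (I * J) = g • I * g • J := Ideal.map_mul _ _ _

lemma smul_dvd_smul (g : K ≃ₐ[k] K) {I J : Ideal (𝓞 K)} (h : I ∣ J) : g • I ∣ g • J := by
  obtain ⟨C, rfl⟩ := h
  exact ⟨g • C, smul_mul_ideal _ _ _⟩

/-- a ramified prime is totally ramified -/
lemma ram_pow {ℓ : ℕ} (hℓ : ℓ.Prime) (hK : Module.finrank k K = ℓ) [IsGalois k K] (V : HeightOneSpectrum (𝓞 K))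
    (h : V.asIdeal ^ 2 ∣ Ideal.map (algebraMap (𝓞 k) (𝓞 K)) (V.under (𝓞 k)).asIdeal) :
    Ideal.map (algebraMap (𝓞 k) (𝓞 K)) (V.under (𝓞 k)).asIdeal = V.asIdeal ^ ℓ := by
  classical
  obtain ⟨h1, h2⟩ := ram_total hℓ hK V h
  set I := Ideal.map (algebraMap (𝓞 k) (𝓞 K)) (V.under (𝓞 k)).asIdeal with hI
  have hI0 : I ≠ ⊥ := map_ne_bot' (V.under (𝓞 k)).ne_bot
  have h3 : ∀ Q ∈ UniqueFactorizationMonoid.normalizedFactors I, Q = V.asIdeal := by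
    intro Q hQ
    have hp := UniqueFactorizationMonoid.prime_of_normalized_factor Q hQ
    have hd := UniqueFactorizationMonoid.dvd_of_mem_normalizedFactors hQ
    obtain ⟨g, hg⟩ := conj_of_under_eq V ⟨Q, Ideal.isPrime_of_prime hp, hp.ne_zero⟩ (under_eq_of_dvd _ _ hd)
    rw [h2] at hg
    exact hg.symm
  have h4 := Ideal.prod_normalizedFactors_eq_self hI0
  rw [Multiset.eq_replicate_of_mem h3, Multiset.prod_replicate] at h4
  set m := Multiset.card (UniqueFactorizationMonoid.normalizedFactors I)
  have h5 : Ideal.absNorm I = Ideal.absNorm (V.under (𝓞 k)).asIdeal ^ ℓ := by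
    rw [← Ideal.absNorm_relNorm (𝓞 k), relNorm_map, map_pow, hK]
  rw [← h4, map_pow, h1] at h5
  have h6 := Nat.pow_right_injective (two_le_absNorm (V.under (𝓞 k))) h5
  rw [← h4, h6]

/-- induction principle for Galois-invariant ideals -/
lemma fixed_induction {ℓ : ℕ} (hℓ : ℓ.Prime) (hK : Module.finrank k K = ℓ) [IsGalois k K]
    (T : Ideal (𝓞 K) → Prop) (h1 : T 1) (hmul : ∀ A B, A ≠ ⊥ → B ≠ ⊥ → T A → T B → T (A * B))
    (hmap : ∀ v : HeightOneSpectrum (𝓞 k), T (Ideal.map (algebraMap (𝓞 k) (𝓞 K)) v.asIdeal))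
    (hram : ∀ V : HeightOneSpectrum (𝓞 K), V.asIdeal ^ 2 ∣ Ideal.map (algebraMap (𝓞 k) (𝓞 K)) (V.under (𝓞 k)).asIdeal → T V.asIdeal)
    (A : Ideal (𝓞 K)) (hA : A ≠ ⊥) (hfix : ∀ g : K ≃ₐ[k] K, g • A = A) : T A := by
  classical
  induction hn : Ideal.absNorm A using Nat.strong_induction_on generalizing A with
  | _ n ih =>
  by_cases hA1 : A = 1
  · rw [hA1]; exact h1
  have hA1' : A ≠ ⊤ := by rwa [← Ideal.one_eq_top]
  obtain ⟨M, hM, hAM⟩ := Ideal.exists_le_maximal A hA1'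
  have hM0 : M ≠ ⊥ := by
    rintro rfl
    exact hA (le_bot_iff.1 hAM)
  obtain ⟨P, rfl⟩ : ∃ P : HeightOneSpectrum (𝓞 K), P.asIdeal = M := ⟨⟨M, hM.isPrime, hM0⟩, rfl⟩
  rw [← Ideal.dvd_iff_le] at hAM
  have key : ∃ X : Ideal (𝓞 K), X ≠ ⊥ ∧ X ≠ ⊤ ∧ X ∣ A ∧ T X ∧ ∀ g : K ≃ₐ[k] K, g • X = X := by
    by_cases hr : P.asIdeal ^ 2 ∣ Ideal.map (algebraMap (𝓞 k) (𝓞 K)) (P.under (𝓞 k)).asIdeal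
    · exact ⟨P.asIdeal, hM0, hM.ne_top, hAM, hram P hr, (ram_total hℓ hK P hr).2⟩
    · set I := Ideal.map (algebraMap (𝓞 k) (𝓞 K)) (P.under (𝓞 k)).asIdeal with hI
      have hI0 : I ≠ ⊥ := map_ne_bot' (P.under (𝓞 k)).ne_bot
      have hconj : ∀ Q : Ideal (𝓞 K), Prime Q → Q ∣ I → ∃ g : K ≃ₐ[k] K, g • P.asIdeal = Q := by
        intro Q hQ hd
        exact conj_of_under_eq P ⟨Q, Ideal.isPrime_of_prime hQ, hQ.ne_zero⟩ (under_eq_of_dvd _ _ hd)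
      have hsq : Squarefree I := by
        rw [squarefree_iff_no_irreducibles hI0]
        intro Q hQ hQI
        rw [UniqueFactorizationMonoid.irreducible_iff_prime] at hQ
        obtain ⟨g, rfl⟩ := hconj Q hQ ((dvd_mul_right _ _).trans hQI)
        apply hr
        have := smul_dvd_smul g⁻¹ hQI
        rw [smul_mul_ideal, inv_smul_smul, hI, smul_map_eq] at this
        rwa [pow_two]
      rw [UniqueFactorizationMonoid.squarefree_iff_nodup_normalizedFactors hI0] at hsq
      refine ⟨I, hI0, ?_, ?_, hmap _, fun g => smul_map_eq g _⟩
      · intro h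
        have := dvd_map_under (k := k) P
        rw [← hI, h, Ideal.dvd_iff_le] at this
        exact hM.ne_top (top_le_iff.1 this)
      · have h5 : ∏ Q ∈ (UniqueFactorizationMonoid.normalizedFactors I).toFinset, Q ∣ A := by
          refine Finset.prod_primes_dvd _ ?_ ?_
          · intro Q hQ
            exact UniqueFactorizationMonoid.prime_of_normalized_factor Q (Multiset.mem_toFinset.1 hQ)
          · intro Q hQ
            have hQ := Multiset.mem_toFinset.1 hQ
            obtain ⟨g, rfl⟩ := hconj Q (UniqueFactorizationMonoid.prime_of_normalized_factor Q hQ)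
              (UniqueFactorizationMonoid.dvd_of_mem_normalizedFactors hQ)
            rw [← hfix g]
            exact smul_dvd_smul g hAM
        rw [Finset.prod_eq_multiset_prod, Multiset.toFinset_val, hsq.dedup, Multiset.map_id', Ideal.prod_normalizedFactors_eq_self hI0] at h5
        exact h5
  obtain ⟨X, hX0, hXt, ⟨B, rfl⟩, hTX, hXg⟩ := key
  have hB0 : B ≠ ⊥ := by
    rintro rfl
    exact hA (Ideal.mul_bot _)
  refine hmul X B hX0 hB0 hTX (ih _ ?_ B hB0 ?_ rfl)
  · rw [← hn, map_mul]
    have : Ideal.absNorm B ≠ 0 := by rwa [Ne, Ideal.absNorm_eq_zero_iff]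
    have : Ideal.absNorm X ≠ 0 := by rwa [Ne, Ideal.absNorm_eq_zero_iff]
    have : Ideal.absNorm X ≠ 1 := by rwa [Ne, Ideal.absNorm_eq_one_iff]
    have : 2 ≤ Ideal.absNorm X := by omega
    nlinarith [Nat.pos_of_ne_zero ‹Ideal.absNorm B ≠ 0›]
  · intro g
    have := hfix g
    rw [smul_mul_ideal, hXg] at this
    exact mul_left_cancel₀ hX0 this

end
end GenusRank

namespace GenusRank
open Filter Topology nonZeroDivisors
open scoped Pointwise

section

lemma relIndex_sup_zpowers {G : Type*} [CommGroup G] (H : Subgroup G) (x : G) (ℓ : ℕ) (hℓ : 0 < ℓ) (hx : x ^ ℓ ∈ H) :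
    H.relIndex (H ⊔ Subgroup.zpowers x) ≤ ℓ ∧ H.relIndex (H ⊔ Subgroup.zpowers x) ≠ 0 := by
  rw [Subgroup.relIndex_sup_left]
  have h1 := Subgroup.relIndex_ker (Subgroup.zpowers x) (QuotientGroup.mk' H)
  rw [QuotientGroup.ker_mk', MonoidHom.map_zpowers, Nat.card_zpowers] at h1
  have h2 : orderOf (QuotientGroup.mk' H x) ∣ ℓ := by
    apply orderOf_dvd_of_pow_eq_one
    rw [← map_pow]
    exact (QuotientGroup.eq_one_iff _).2 hx
  rw [h1]
  exact ⟨Nat.le_of_dvd hℓ h2, (Nat.pos_of_dvd_of_pos h2 hℓ).ne'⟩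

lemma relIndex_sup_closure {G α : Type*} [CommGroup G] (J : Subgroup G) (ℓ : ℕ) (hℓ : 0 < ℓ) (x : α → G) (S : Finset α)
    (hx : ∀ a ∈ S, x a ^ ℓ ∈ J) :
    J.relIndex (J ⊔ Subgroup.closure (x '' S)) ≤ ℓ ^ S.card ∧ J.relIndex (J ⊔ Subgroup.closure (x '' S)) ≠ 0 := by
  classical
  induction S using Finset.induction_on with
  | empty => simp
  | insert a S ha ih =>
    obtain ⟨h1, h2⟩ := ih fun b hb => hx b (Finset.mem_insert_of_mem hb)
    have h3 : J ⊔ Subgroup.closure (x '' ↑(insert a S)) = (J ⊔ Subgroup.closure (x '' S)) ⊔ Subgroup.zpowers (x a) := by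
      rw [Finset.coe_insert, Set.image_insert_eq, Set.insert_eq, Subgroup.closure_union, Subgroup.zpowers_eq_closure, sup_assoc, sup_comm (Subgroup.closure {x a})]
    obtain ⟨h4, h5⟩ := relIndex_sup_zpowers (J ⊔ Subgroup.closure (x '' S)) (x a) ℓ hℓ
      ((le_sup_left : J ≤ _) (hx a (Finset.mem_insert_self _ _)))
    rw [h3, ← Subgroup.relIndex_mul_relIndex J (J ⊔ Subgroup.closure (x '' S)) _ le_sup_left le_sup_left,
      Finset.card_insert_of_notMem ha, pow_succ]
    exact ⟨Nat.mul_le_mul h1 h4, mul_ne_zero h2 h5⟩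

end

section
variable {k K : Type*} [Field k] [NumberField k] [Field K] [NumberField K] [Algebra k K]

/-- action on integers -/
noncomputable def fO (g : K ≃ₐ[k] K) : 𝓞 K ≃+* 𝓞 K := MulSemiringAction.toRingEquiv (K ≃ₐ[k] K) (𝓞 K) g

lemma fO_coe (g : K ≃ₐ[k] K) (x : 𝓞 K) : algebraMap (𝓞 K) K (fO g x) = g (algebraMap (𝓞 K) K x) := rfl

lemma frac_fO (g : K ≃ₐ[k] K) (x : K) : IsFractionRing.ringEquivOfRingEquiv (K := K) (L := K) (fO g) x = g x := by
  have h : (IsFractionRing.ringEquivOfRingEquiv (K := K) (L := K) (fO g)).toRingHom = (g : K →+* K) := by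
    refine IsLocalization.ringHom_ext (nonZeroDivisors (𝓞 K)) ?_
    ext a
    change IsFractionRing.ringEquivOfRingEquiv (K := K) (L := K) (fO g) (algebraMap _ _ a) = g (algebraMap _ _ a)
    rw [IsFractionRing.ringEquivOfRingEquiv_algebraMap, fO_coe]
  exact congrArg (fun r : K →+* K => r x) h

variable (K) in
/-- ideal group -/
abbrev Idl := (FractionalIdeal (𝓞 K)⁰ K)ˣ

/-- action on fractional ideals -/
noncomputable def sI (g : K ≃ₐ[k] K) : Idl K →* Idl K :=
  Units.map (FractionalIdeal.ringEquivOfRingEquiv K K (fO g)).toRingHom.toMonoidHom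

lemma sI_coe (g : K ≃ₐ[k] K) (a : Idl K) : ((sI g a : Idl K) : FractionalIdeal (𝓞 K)⁰ K) =
  FractionalIdeal.ringEquivOfRingEquiv K K (fO g) a := rfl

/-- action on units of K -/
noncomputable def sM (g : K ≃ₐ[k] K) : Kˣ →* Kˣ := Units.map (g : K →* K)

/-- action on units of the integers -/
noncomputable def sU (g : K ≃ₐ[k] K) : (𝓞 K)ˣ →* (𝓞 K)ˣ := Units.map (fO g : 𝓞 K →* 𝓞 K)

lemma sI_d (g : K ≃ₐ[k] K) (x : Kˣ) : toPrincipalIdeal (𝓞 K) K (sM g x) = sI g (toPrincipalIdeal (𝓞 K) K x) := by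
  apply Units.ext
  rw [sI_coe, coe_toPrincipalIdeal, coe_toPrincipalIdeal, FractionalIdeal.ringEquivOfRingEquiv_spanSingleton, frac_fO]
  rfl

lemma coeIdeal_smul (g : K ≃ₐ[k] K) (J : Ideal (𝓞 K)) :
    FractionalIdeal.ringEquivOfRingEquiv K K (fO g) (J : FractionalIdeal (𝓞 K)⁰ K) = ((g • J : Ideal (𝓞 K)) : FractionalIdeal (𝓞 K)⁰ K) := by
  ext y
  rw [← FractionalIdeal.mem_coe, FractionalIdeal.mem_coeIdeal]
  change y ∈ (FractionalIdeal.ringEquivOfRingEquiv K K (fO g) (J : FractionalIdeal (𝓞 K)⁰ K)).val ↔ _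
  rw [FractionalIdeal.ringEquivOfRingEquiv_apply_val]
  constructor
  · rintro ⟨x, hx, rfl⟩
    obtain ⟨a, ha, rfl⟩ := (FractionalIdeal.mem_coeIdeal _).1 hx
    refine ⟨fO g a, Ideal.mem_map_of_mem _ ha, ?_⟩
    exact (fO_coe g a).trans (frac_fO g _).symm
  · rintro ⟨b, hb, rfl⟩
    rw [Ideal.mem_pointwise_smul_iff_inv_smul_mem] at hb
    refine ⟨algebraMap (𝓞 K) K (g⁻¹ • b), FractionalIdeal.mem_coeIdeal_of_mem _ hb, ?_⟩
    refine (frac_fO g _).trans ?_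
    rw [← fO_coe]
    congr 1
    exact smul_inv_smul g b

lemma smul_ne_bot (g : K ≃ₐ[k] K) {J : Ideal (𝓞 K)} (hJ : J ≠ ⊥) : g • J ≠ ⊥ := by
  intro h
  apply hJ
  rw [← inv_smul_smul g J, h]
  exact Ideal.map_bot

open scoped Classical in
/-- unit fractional ideal attached to an ideal -/
noncomputable def uI (J : Ideal (𝓞 K)) : Idl K :=
  if h : J ≠ ⊥ then FractionalIdeal.mk0 K ⟨J, mem_nonZeroDivisors_of_ne_zero h⟩ else 1

lemma uI_coe {J : Ideal (𝓞 K)} (h : J ≠ ⊥) : ((uI J : Idl K) : FractionalIdeal (𝓞 K)⁰ K) = (J : FractionalIdeal (𝓞 K)⁰ K) := by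
  rw [uI, dif_pos h]; rfl

lemma uI_mul {I J : Ideal (𝓞 K)} (hI : I ≠ ⊥) (hJ : J ≠ ⊥) : uI (I * J) = uI I * uI J := by
  apply Units.ext
  rw [Units.val_mul, uI_coe hI, uI_coe hJ, uI_coe (mul_ne_zero hI hJ), FractionalIdeal.coeIdeal_mul]

lemma uI_one : uI (1 : Ideal (𝓞 K)) = 1 := by
  apply Units.ext
  rw [uI_coe one_ne_zero]; simp

lemma uI_pow {I : Ideal (𝓞 K)} (hI : I ≠ ⊥) (n : ℕ) : uI (I ^ n) = uI I ^ n := by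
  apply Units.ext
  rw [Units.val_pow_eq_pow_val, uI_coe hI, uI_coe (pow_ne_zero n hI), FractionalIdeal.coeIdeal_pow]

lemma uI_inj {I J : Ideal (𝓞 K)} (hI : I ≠ ⊥) (hJ : J ≠ ⊥) (h : uI I = uI J) : I = J := by
  have := congrArg Units.val h
  rw [uI_coe hI, uI_coe hJ] at this
  exact FractionalIdeal.coeIdeal_injective this

lemma sI_uI (g : K ≃ₐ[k] K) {J : Ideal (𝓞 K)} (h : J ≠ ⊥) : sI g (uI J) = uI (g • J) := by
  apply Units.ext
  rw [sI_coe, uI_coe h, uI_coe (smul_ne_bot g h), coeIdeal_smul]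

lemma q_uI {J : Ideal (𝓞 K)} (h : J ≠ ⊥) : ClassGroup.mk K (uI J) = cl J := by
  rw [uI, dif_pos h, cl_of h, ClassGroup.mk_mk0]

/-- every fractional ideal is integral over a rational integer -/
lemma exists_rep (a : Idl K) : ∃ (A : Ideal (𝓞 K)) (n : ℕ), A ≠ ⊥ ∧ n ≠ 0 ∧
    a * uI (Ideal.span {(n : 𝓞 K)}) = uI A := by
  obtain ⟨x, I, hx, hI⟩ := FractionalIdeal.exists_eq_spanSingleton_mul (a : FractionalIdeal (𝓞 K)⁰ K)
  have hI0 : I ≠ ⊥ := by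
    rintro rfl
    apply a.ne_zero
    rw [hI]; simp
  obtain ⟨n, hn0, hn⟩ : ∃ n : ℕ, n ≠ 0 ∧ x ∣ (n : 𝓞 K) := by
    refine ⟨Ideal.absNorm (Ideal.span {x}), ?_, ?_⟩
    · rw [Ne, Ideal.absNorm_eq_zero_iff]; simpa using hx
    · rw [← Ideal.mem_span_singleton]; exact Ideal.absNorm_mem _
  obtain ⟨y, hy⟩ := hn
  have hn' : (n : 𝓞 K) ≠ 0 := Nat.cast_ne_zero.2 hn0
  have hy0 : y ≠ 0 := by rintro rfl; simp [hn0] at hy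
  refine ⟨Ideal.span {y} * I, n, mul_ne_zero (span_ne_bot hy0) hI0, hn0, ?_⟩
  apply Units.ext
  rw [Units.val_mul, uI_coe (span_ne_bot hn'), uI_coe (mul_ne_zero (span_ne_bot hy0) hI0), FractionalIdeal.coeIdeal_mul, hI,
    FractionalIdeal.coeIdeal_span_singleton, FractionalIdeal.coeIdeal_span_singleton, hy, map_mul,
    ← FractionalIdeal.spanSingleton_mul_spanSingleton, mul_right_comm, ← mul_assoc, FractionalIdeal.spanSingleton_mul_spanSingleton]
  have : (algebraMap (𝓞 K) K x) ≠ 0 := by simpa using hx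
  rw [inv_mul_cancel₀ this, FractionalIdeal.spanSingleton_one, one_mul]

end
end GenusRank

namespace GenusRank
open Filter Topology nonZeroDivisors
open scoped Pointwise

section
variable {k K : Type*} [Field k] [NumberField k] [Field K] [NumberField K] [Algebra k K]

variable (k K) in
/-- extension of fractional ideals -/
noncomputable def jI : Idl k →* Idl K := Units.map (FractionalIdeal.extendedHom K (𝓞 K) : FractionalIdeal (𝓞 k)⁰ k →+* FractionalIdeal (𝓞 K)⁰ K).toMonoidHom

lemma jI_coe (a : Idl k) : ((jI k K a : Idl K) : FractionalIdeal (𝓞 K)⁰ K) = FractionalIdeal.extendedHom K (𝓞 K) (a : FractionalIdeal (𝓞 k)⁰ k) := rfl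

lemma jI_uI {A : Ideal (𝓞 k)} (hA : A ≠ ⊥) : jI k K (uI A) = uI (A.map (algebraMap (𝓞 k) (𝓞 K))) := by
  apply Units.ext
  rw [jI_coe, uI_coe hA, uI_coe (map_ne_bot' hA), FractionalIdeal.extendedHom_coeIdeal_eq_map]

lemma jI_inj : Function.Injective (jI k K) := by
  intro a b h
  apply Units.ext
  have := congrArg Units.val h
  rw [jI_coe, jI_coe] at this
  exact FractionalIdeal.extendedHom_injective (K := k) _ _ _ this

lemma jI_d (x : kˣ) : jI k K (toPrincipalIdeal (𝓞 k) k x) = toPrincipalIdeal (𝓞 K) K (Units.map (algebraMap k K : k →* K) x) := by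
  apply Units.ext
  rw [jI_coe, coe_toPrincipalIdeal, coe_toPrincipalIdeal, FractionalIdeal.extendedHom_spanSingleton]
  congr 1
  have h : (IsFractionRing.map (FaithfulSMul.algebraMap_injective (𝓞 k) (𝓞 K)) : k →+* K) = algebraMap k K := by
    refine IsLocalization.ringHom_ext (nonZeroDivisors (𝓞 k)) ?_
    ext a
    change (IsFractionRing.map (FaithfulSMul.algebraMap_injective (𝓞 k) (𝓞 K)) : k →+* K) (algebraMap _ _ a) = _
    rw [IsFractionRing.map, IsLocalization.map_eq]
    rfl
  exact congrArg (fun r : k →+* K => r x) h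

lemma jI_fixed (g : K ≃ₐ[k] K) (a : Idl k) : sI g (jI k K a) = jI k K a := by
  obtain ⟨A, n, hA, hn, h⟩ := exists_rep a
  have hn' : (n : 𝓞 k) ≠ 0 := Nat.cast_ne_zero.2 hn
  have h1 : ∀ B : Ideal (𝓞 k), B ≠ ⊥ → sI g (jI k K (uI B)) = jI k K (uI B) := by
    intro B hB
    rw [jI_uI hB, sI_uI _ (map_ne_bot' hB), smul_map_eq]
  rw [eq_div_of_mul_eq' h, map_div, map_div, h1 A hA, h1 _ (span_ne_bot hn')]

lemma fix_all {X : Type*} [MulAction (K ≃ₐ[k] K) X] (g : K ≃ₐ[k] K) (hg : ∀ h, h ∈ Subgroup.zpowers g) (A : X)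
    (h : g • A = A) (h' : K ≃ₐ[k] K) : h' • A = A := by
  have h1 : Subgroup.zpowers g ≤ MulAction.stabilizer (K ≃ₐ[k] K) A := by
    rw [Subgroup.zpowers_le]
    exact h
  exact h1 (hg h')

lemma fixed_index {ℓ : ℕ} (hℓ : ℓ.Prime) (hK : Module.finrank k K = ℓ) [IsGalois k K]
    (g : K ≃ₐ[k] K) (hg : ∀ h, h ∈ Subgroup.zpowers g) :
    (jI k K).range ≤ (Dh (sI g)).ker ∧ (jI k K).range.relIndex (Dh (sI g)).ker ≤ ℓ ^ (Ram k K).ncard ∧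
      (jI k K).range.relIndex (Dh (sI g)).ker ≠ 0 := by
  classical
  refine ⟨?_, ?_⟩
  · rintro _ ⟨a, rfl⟩
    rw [mem_ker_Dh]
    exact jI_fixed g a
  have hex : ∀ v ∈ Ram k K, ∃ I : Ideal (𝓞 K), ∃ V : HeightOneSpectrum (𝓞 K), V.asIdeal = I ∧ V.under (𝓞 k) = v ∧
      V.asIdeal ^ 2 ∣ Ideal.map (algebraMap (𝓞 k) (𝓞 K)) (V.under (𝓞 k)).asIdeal := by
    rintro v ⟨Q, hQ, hQ0, hd⟩
    have := under_eq_of_dvd ⟨Q, hQ, hQ0⟩ v ((dvd_pow_self Q two_ne_zero).trans hd)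
    refine ⟨Q, ⟨Q, hQ, hQ0⟩, rfl, this, ?_⟩
    rw [this]
    exact hd
  choose! I hI using hex
  set x : HeightOneSpectrum (𝓞 k) → Idl K := fun v => uI (I v) with hx
  set S := (finite_Ram k K).toFinset with hS
  have hmapJ : ∀ B : Ideal (𝓞 k), B ≠ ⊥ → uI (B.map (algebraMap (𝓞 k) (𝓞 K))) ∈ (jI k K).range := by
    intro B hB
    exact ⟨uI B, jI_uI hB⟩
  obtain ⟨h1, h2⟩ := relIndex_sup_closure (jI k K).range ℓ hℓ.pos x S (by
    intro v hv
    have hv : v ∈ Ram k K := by simpa [hS] using hv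
    obtain ⟨V, hV0, hV1, hV2⟩ := hI v hv
    change uI (I v) ^ ℓ ∈ _
    rw [← hV0, ← uI_pow V.ne_bot, ← ram_pow hℓ hK _ hV2]
    exact hmapJ _ (HeightOneSpectrum.ne_bot _))
  have hle : (Dh (sI g)).ker ≤ (jI k K).range ⊔ Subgroup.closure (x '' S) := by
    intro a ha
    rw [mem_ker_Dh] at ha
    obtain ⟨A, n, hA, hn, h⟩ := exists_rep a
    have hn' : (n : 𝓞 K) ≠ 0 := Nat.cast_ne_zero.2 hn
    have hn'' : (n : 𝓞 k) ≠ 0 := Nat.cast_ne_zero.2 hn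
    have hsp : Ideal.span {(n : 𝓞 K)} = (Ideal.span {(n : 𝓞 k)}).map (algebraMap (𝓞 k) (𝓞 K)) := by
      rw [Ideal.map_span, Set.image_singleton, map_natCast]
    have hA2 : g • A = A := by
      apply uI_inj (smul_ne_bot g hA) hA
      rw [← sI_uI g hA, ← h, map_mul, ha, sI_uI g (span_ne_bot hn'), hsp, smul_map_eq]
    have hA3 := fix_all g hg A hA2
    have hA4 : uI A ∈ (jI k K).range ⊔ Subgroup.closure (x '' S) := by
      refine fixed_induction hℓ hK (fun A => uI A ∈ (jI k K).range ⊔ Subgroup.closure (x '' S)) ?_ ?_ ?_ ?_ A hA hA3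
      · change uI 1 ∈ _
        rw [uI_one]; exact one_mem _
      · intro A B hA hB h1 h2
        change uI (A * B) ∈ _
        rw [uI_mul hA hB]
        exact mul_mem h1 h2
      · intro v
        exact (le_sup_left : (jI k K).range ≤ _) (hmapJ _ v.ne_bot)
      · intro W hW
        have hWr : W.under (𝓞 k) ∈ Ram k K := ⟨W.asIdeal, W.isPrime, W.ne_bot, hW⟩
        obtain ⟨V, hV0, hV1, hV2⟩ := hI _ hWr
        obtain ⟨τ, hτ⟩ := conj_of_under_eq (k := k) W V hV1
        rw [(ram_total hℓ hK W hW).2 τ] at hτ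
        refine (le_sup_right : Subgroup.closure (x '' S) ≤ _) (Subgroup.subset_closure ⟨W.under (𝓞 k), ?_, ?_⟩)
        · simpa [hS] using hWr
        · change uI (I (W.under (𝓞 k))) = uI W.asIdeal
          rw [hτ, hV0]
    rw [eq_div_of_mul_eq' h]
    refine div_mem hA4 ?_
    rw [hsp]
    exact (le_sup_left : (jI k K).range ≤ _) (hmapJ _ (span_ne_bot hn''))
  have hc : S.card = (Ram k K).ncard := (Set.ncard_eq_toFinset_card _ _).symm
  rw [hc] at h1
  refine ⟨(Subgroup.relIndex_le_of_le_right hle h2).trans h1, ?_⟩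
  exact fun h0 => h2 (Subgroup.relIndex_eq_zero_of_le_right hle h0)

end
end GenusRank

namespace GenusRank
open Filter Topology nonZeroDivisors
open scoped Pointwise

section
variable {k K : Type*} [Field k] [NumberField k] [Field K] [NumberField K] [Algebra k K]

/-- action on classes -/
noncomputable def sC (g : K ≃ₐ[k] K) : ClassGroup (𝓞 K) →* ClassGroup (𝓞 K) :=
  liftCl (fun I => cl (g • I)) (fun I J hI hJ => by
    rw [smul_mul_ideal, cl_mul (smul_ne_bot g hI) (smul_ne_bot g hJ)]) (fun x hx => by
    have : g • Ideal.span {x} = Ideal.span {g • x} := by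
      change Ideal.map _ _ = _
      rw [Ideal.map_span, Set.image_singleton]
      rfl
    rw [this, cl_span])

lemma sC_cl (g : K ≃ₐ[k] K) {I : Ideal (𝓞 K)} (hI : I ≠ ⊥) : sC g (cl I) = cl (g • I) := liftCl_cl _ _ _ I hI

lemma q_surj : Function.Surjective (ClassGroup.mk K : Idl K →* ClassGroup (𝓞 K)) := by
  intro c
  obtain ⟨I, hI, rfl⟩ := cl_surj c
  exact ⟨uI I, q_uI hI⟩

lemma q_sI (g : K ≃ₐ[k] K) (a : Idl K) : ClassGroup.mk K (sI g a) = sC g (ClassGroup.mk K a) := by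
  obtain ⟨A, n, hA, hn, h⟩ := exists_rep a
  have hn' : (n : 𝓞 K) ≠ 0 := Nat.cast_ne_zero.2 hn
  have h1 : ∀ B : Ideal (𝓞 K), B ≠ ⊥ → ClassGroup.mk K (sI g (uI B)) = sC g (ClassGroup.mk K (uI B)) := by
    intro B hB
    rw [sI_uI g hB, q_uI hB, q_uI (smul_ne_bot g hB), sC_cl g hB]
  rw [eq_div_of_mul_eq' h, map_div, map_div, map_div, map_div, h1 A hA, h1 _ (span_ne_bot hn')]

lemma q_ker : (ClassGroup.mk K : Idl K →* ClassGroup (𝓞 K)).ker = (toPrincipalIdeal (𝓞 K) K).range := by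
  ext a
  rw [MonoidHom.mem_ker, ← (ClassGroup.equiv (R := 𝓞 K) K).injective.eq_iff, ClassGroup.equiv_mk]
  simp only [FractionalIdeal.canonicalEquiv_self, RingEquiv.coe_mulEquiv_refl, QuotientGroup.mk'_apply,
    map_one, QuotientGroup.eq_one_iff]
  rfl

lemma cl_index : (toPrincipalIdeal (𝓞 k) k).range.index = Nat.card (ClassGroup (𝓞 k)) :=
  (Nat.card_congr (ClassGroup.equiv (R := 𝓞 k) k).toEquiv).symm

lemma iota_inj : Function.Injective (Units.map (algebraMap (𝓞 K) K : 𝓞 K →* K)) :=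
  Units.map_injective (FaithfulSMul.algebraMap_injective (𝓞 K) K)

lemma iota_range : (Units.map (algebraMap (𝓞 K) K : 𝓞 K →* K)).range = (toPrincipalIdeal (𝓞 K) K).ker := by
  ext x
  have key : ∀ y : Kˣ, y ∈ (toPrincipalIdeal (𝓞 K) K).ker → ∃ a : 𝓞 K, algebraMap (𝓞 K) K a = y := by
    intro y hy
    rw [MonoidHom.mem_ker, toPrincipalIdeal_eq_iff] at hy
    rw [← FractionalIdeal.mem_one_iff (𝓞 K)⁰]
    have := FractionalIdeal.mem_spanSingleton_self (𝓞 K)⁰ (y : K)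
    rw [hy] at this
    simpa using this
  constructor
  · rintro ⟨u, rfl⟩
    rw [MonoidHom.mem_ker, toPrincipalIdeal_eq_iff]
    change FractionalIdeal.spanSingleton (𝓞 K)⁰ (algebraMap (𝓞 K) K u) = 1
    rw [← FractionalIdeal.coeIdeal_span_singleton, Ideal.span_singleton_eq_top.2 u.isUnit]
    simp
  · intro hx
    obtain ⟨a, ha⟩ := key x hx
    obtain ⟨b, hb⟩ := key x⁻¹ (inv_mem hx)
    have hab : a * b = 1 := by
      apply FaithfulSMul.algebraMap_injective (𝓞 K) K
      rw [map_mul, ha, hb, map_one, ← Units.val_mul, mul_inv_cancel, Units.val_one]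
    refine ⟨⟨a, b, hab, by rw [mul_comm, hab]⟩, ?_⟩
    exact Units.ext ha

lemma fixed_K [IsGalois k K] (g : K ≃ₐ[k] K) (hg : ∀ h, h ∈ Subgroup.zpowers g) (x : K) (hx : g x = x) :
    ∃ y : k, algebraMap k K y = x := by
  have := fix_all g hg x hx
  exact (IsGalois.mem_range_algebraMap_iff_fixed x).2 this

lemma ker_sM [IsGalois k K] (g : K ≃ₐ[k] K) (hg : ∀ h, h ∈ Subgroup.zpowers g) :
    (Dh (sM g)).ker = (Units.map (algebraMap k K : k →* K)).range := by
  ext x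
  rw [mem_ker_Dh]
  constructor
  · intro h
    have h : g (x : K) = x := congrArg Units.val h
    obtain ⟨y, hy⟩ := fixed_K g hg x h
    have hy0 : y ≠ 0 := by
      rintro rfl
      rw [map_zero] at hy
      exact x.ne_zero hy.symm
    exact ⟨Units.mk0 y hy0, Units.ext hy⟩
  · rintro ⟨y, rfl⟩
    apply Units.ext
    exact g.commutes _

lemma hh_index [IsGalois k K] (g : K ≃ₐ[k] K) (hg : ∀ h, h ∈ Subgroup.zpowers g) :
    (Dh (sM g)).ker.map (toPrincipalIdeal (𝓞 K) K) ≤ (jI k K).range ∧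
    ((Dh (sM g)).ker.map (toPrincipalIdeal (𝓞 K) K)).relIndex (jI k K).range = Nat.card (ClassGroup (𝓞 k)) := by
  have h1 : (Dh (sM g)).ker.map (toPrincipalIdeal (𝓞 K) K) = (toPrincipalIdeal (𝓞 k) k).range.map (jI k K) := by
    rw [ker_sM g hg, ← MonoidHom.range_comp, ← MonoidHom.range_comp]
    congr 1
    ext1 x
    exact (jI_d x).symm
  rw [h1]
  refine ⟨Subgroup.map_le_range _ _, ?_⟩
  rw [MonoidHom.range_eq_map (jI k K), Subgroup.relIndex_map_map_of_injective _ _ jI_inj, Subgroup.relIndex_top_right, cl_index]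

lemma iterate_aut (g : K ≃ₐ[k] K) (n : ℕ) (x : K) : (g ^ n) x = g^[n] x := by
  induction n generalizing x with
  | zero => rfl
  | succ n ih => rw [pow_succ, Function.iterate_succ_apply, ← ih]; rfl

lemma sM_iter (g : K ≃ₐ[k] K) (n : ℕ) (x : Kˣ) : (((sM g)^[n] x : Kˣ) : K) = (g ^ n) (x : K) := by
  rw [iterate_aut]
  induction n generalizing x with
  | zero => rfl
  | succ n ih => rw [Function.iterate_succ_apply, ih]; rfl

lemma h90 [IsGalois k K] {ℓ : ℕ} (hℓ : 0 < ℓ) (hc : Nat.card (K ≃ₐ[k] K) = ℓ) (g : K ≃ₐ[k] K) (hg : ∀ h, h ∈ Subgroup.zpowers g)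
    (x : Kˣ) (hx : Nh ℓ (sM g) x = 1) : ∃ y, Dh (sM g) y = x := by
  classical
  have h1 : orderOf g = ℓ := by rw [orderOf_eq_card_of_forall_mem_zpowers hg, hc]
  have hgl : g ^ ℓ = 1 := by rw [← h1, pow_orderOf_eq_one]
  have hinj : Function.Injective (fun i : Fin ℓ => ((g ^ (i : ℕ) : K ≃ₐ[k] K) : K →* K)) := by
    intro a b hab
    have h2 := pow_injOn_Iio_orderOf (x := g)
    rw [h1] at h2
    apply Fin.ext
    refine h2 a.2 b.2 ?_
    ext z
    exact congrArg (fun r : K →* K => r z) hab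
  have hli := (linearIndependent_monoidHom K K).comp _ hinj
  rw [Fintype.linearIndependent_iff] at hli
  set b : ℕ → Kˣ := fun i => ∏ j ∈ Finset.range i, (sM g)^[j] x with hb
  have hbl : b ℓ = 1 := hx
  have hbs : ∀ i, x * sM g (b i) = b (i + 1) := by
    intro i
    rw [hb]
    simp only
    rw [Finset.prod_range_succ', map_prod, mul_comm]
    congr 1
    refine Finset.prod_congr rfl fun j _ => ?_
    rw [Function.iterate_succ_apply']
  have hne : ∃ z : K, ∑ i ∈ Finset.range ℓ, (b i : K) * (g ^ i) z ≠ 0 := by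
    by_contra! hall
    have := hli (fun i => (b i : K)) (by
      ext z
      rw [Finset.sum_apply]
      have := hall z
      rw [← Fin.sum_univ_eq_sum_range (fun i => (b i : K) * (g ^ i) z)] at this
      exact this) ⟨0, hℓ⟩
    exact (b 0).ne_zero this
  obtain ⟨z, hz⟩ := hne
  set θ := ∑ i ∈ Finset.range ℓ, (b i : K) * (g ^ i) z with hθ
  have hkey : (x : K) * g θ = θ := by
    rw [hθ, map_sum, Finset.mul_sum]
    have h3 : ∀ i ∈ Finset.range ℓ, (x : K) * g ((b i : K) * (g ^ i) z) = (fun i => (b i : K) * (g ^ i) z) (i + 1) := by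
      intro i _
      simp only
      rw [← hbs i, map_mul, Units.val_mul, pow_succ', ← mul_assoc]
      rfl
    rw [Finset.sum_congr rfl h3]
    have h4 := Finset.sum_range_succ (fun i => (b i : K) * (g ^ i) z) ℓ
    rw [Finset.sum_range_succ'] at h4
    have h5 : (b ℓ : K) * (g ^ ℓ) z = (b 0 : K) * (g ^ 0) z := by
      rw [hbl, hgl, pow_zero]
      simp [hb]
    rw [h5] at h4
    exact add_right_cancel h4
  refine ⟨(Units.mk0 θ hz)⁻¹, ?_⟩
  rw [Dh_apply, map_inv, inv_div_inv, div_eq_iff_eq_mul]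
  apply Units.ext
  rw [Units.val_mul]
  exact hkey.symm

end
end GenusRank

namespace GenusRank
open Filter Topology nonZeroDivisors
open scoped Pointwise

section
variable {k K : Type*} [Field k] [NumberField k] [Field K] [NumberField K] [Algebra k K]

variable (k K) in
/-- ramified infinite places -/
def InfRam : Set (InfinitePlace k) := {v : InfinitePlace k | v.IsReal ∧ ∃ w : InfinitePlace K, w.comap (algebraMap k K) = v ∧ w.IsComplex}

lemma inf_count [IsGalois k K] {ℓ : ℕ} (hℓ : 2 ≤ ℓ) (hK : Module.finrank k K = ℓ) :
    ∃ u c : ℕ, Fintype.card (InfinitePlace k) = u + c ∧ c ≤ (InfRam k K).ncard ∧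
      u * ℓ + c ≤ Fintype.card (InfinitePlace K) := by
  classical
  refine ⟨Finset.card {w : InfinitePlace k | w.IsUnramifiedIn K}, Finset.card ({w : InfinitePlace k | w.IsUnramifiedIn K} : Finset _)ᶜ, ?_, ?_, ?_⟩
  · rw [Finset.card_add_card_compl]
  · rw [← Set.ncard_coe_finset]
    refine Set.ncard_le_ncard ?_ (Set.toFinite _)
    intro v hv
    have hv : ¬ v.IsUnramifiedIn K := by simpa using hv
    rw [InfinitePlace.IsUnramifiedIn] at hv
    push Not at hv
    obtain ⟨w, hw, hwu⟩ := hv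
    rw [InfinitePlace.not_isUnramified_iff] at hwu
    rw [← hw]
    exact ⟨hwu.2, w, rfl, hwu.1⟩
  · rw [InfinitePlace.card_eq_card_isUnramifiedIn (k := k) (K := K), hK]
    have h1 : 1 ≤ ℓ / 2 := by omega
    gcongr
    exact Nat.le_mul_of_pos_right _ h1

lemma ker_sU [IsGalois k K] (g : K ≃ₐ[k] K) (hg : ∀ h, h ∈ Subgroup.zpowers g) :
    (Dh (sU g)).ker = (Units.map (algebraMap (𝓞 k) (𝓞 K) : 𝓞 k →* 𝓞 K)).range := by
  ext x
  rw [mem_ker_Dh]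
  have key : ∀ y : 𝓞 K, fO g y = y → ∃ a : 𝓞 k, algebraMap (𝓞 k) (𝓞 K) a = y := by
    intro y hy
    obtain ⟨a, ha⟩ := fixed_K g hg (y : K) (by rw [← fO_coe]; rw [hy])
    have haInt : IsIntegral ℤ a := by
      rw [← isIntegral_algebraMap_iff (FaithfulSMul.algebraMap_injective k K), ha]
      exact y.isIntegral_coe
    exact ⟨⟨a, haInt⟩, RingOfIntegers.ext ha⟩
  constructor
  · intro h
    obtain ⟨a, ha⟩ := key x (congrArg Units.val h)
    obtain ⟨b, hb⟩ := key (x⁻¹ : (𝓞 K)ˣ) (by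
      have := congrArg (fun u => (u⁻¹ : (𝓞 K)ˣ)) h
      change (sU g x)⁻¹ = x⁻¹ at this
      rw [← map_inv] at this
      exact congrArg Units.val this)
    have hab : a * b = 1 := by
      apply FaithfulSMul.algebraMap_injective (𝓞 k) (𝓞 K)
      rw [map_mul, ha, hb, map_one, ← Units.val_mul, mul_inv_cancel, Units.val_one]
    refine ⟨⟨a, b, hab, by rw [mul_comm, hab]⟩, ?_⟩
    exact Units.ext ha
  · rintro ⟨y, rfl⟩
    apply Units.ext
    apply RingOfIntegers.ext
    exact g.commutes _

lemma rank_ker_sU [IsGalois k K] (g : K ≃ₐ[k] K) (hg : ∀ h, h ∈ Subgroup.zpowers g) :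
    Module.finrank ℤ (Additive (Dh (sU g)).ker) = Fintype.card (InfinitePlace k) - 1 := by
  rw [ker_sU g hg]
  have hinj : Function.Injective (Units.map (algebraMap (𝓞 k) (𝓞 K) : 𝓞 k →* 𝓞 K)) :=
    Units.map_injective (FaithfulSMul.algebraMap_injective (𝓞 k) (𝓞 K))
  have e : Additive (𝓞 k)ˣ ≃ₗ[ℤ] Additive (Units.map (algebraMap (𝓞 k) (𝓞 K) : 𝓞 k →* 𝓞 K)).range := (MonoidHom.ofInjective hinj).toAdditive.toIntLinearEquiv
  rw [← e.finrank_eq, Units.finrank_eq]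
  rfl

instance finite_units : Module.Finite ℤ (Additive (𝓞 K)ˣ) := by
  infer_instance

lemma sI_iter (g : K ≃ₐ[k] K) (n : ℕ) (a : Idl K) (hg : g ^ n = 1) : (sI g)^[n] a = a := by
  have h2 : ∀ n (J : Ideal (𝓞 K)), J ≠ ⊥ → (sI g)^[n] (uI J) = uI (g ^ n • J) := by
    intro n
    induction n with
    | zero => intro J _; simp
    | succ n ih =>
      intro J hJ
      rw [Function.iterate_succ_apply, sI_uI g hJ, ih _ (smul_ne_bot g hJ), smul_smul, pow_succ]
  obtain ⟨A, m, hA, hm, h⟩ := exists_rep a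
  have hm' : (m : 𝓞 K) ≠ 0 := Nat.cast_ne_zero.2 hm
  rw [eq_div_of_mul_eq' h, iterate_map_div, h2 n A hA, h2 n _ (span_ne_bot hm'), hg, one_smul, one_smul]

lemma sU_iota (g : K ≃ₐ[k] K) (x : (𝓞 K)ˣ) : Units.map (algebraMap (𝓞 K) K : 𝓞 K →* K) (sU g x) =
    sM g (Units.map (algebraMap (𝓞 K) K : 𝓞 K →* K) x) := Units.ext (fO_coe g x)

lemma sM_per (g : K ≃ₐ[k] K) (n : ℕ) (a : Kˣ) (hg : g ^ n = 1) : (sM g)^[n] a = a := by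
  apply Units.ext
  rw [sM_iter, hg]; rfl

lemma sU_per (g : K ≃ₐ[k] K) (n : ℕ) (a : (𝓞 K)ˣ) (hg : g ^ n = 1) : (sU g)^[n] a = a := by
  apply iota_inj
  have : Function.Semiconj (Units.map (algebraMap (𝓞 K) K : 𝓞 K →* K)) (sU g) (sM g) := sU_iota g
  rw [this.iterate_right n a, sM_per g n _ hg]

/-- ambiguous class number bound -/
theorem ambig_bound [IsGalois k K] {ℓ : ℕ} (hℓ : ℓ.Prime) (hK : Module.finrank k K = ℓ)
    (g : K ≃ₐ[k] K) (hg : ∀ h, h ∈ Subgroup.zpowers g) :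
    ℓ * Nat.card (Dh (sC g)).ker ≤ ℓ ^ ((Ram k K).ncard + (InfRam k K).ncard) * Nat.card (ClassGroup (𝓞 k)) := by
  have hc : Nat.card (K ≃ₐ[k] K) = ℓ := by rw [IsGalois.card_aut_eq_finrank, hK]
  have hgl : g ^ ℓ = 1 := by rw [← hc, pow_card_eq_one']
  obtain ⟨hJF, hR, hR0⟩ := fixed_index hℓ hK g hg
  obtain ⟨hJ1, hh⟩ := hh_index g hg
  obtain ⟨u, c, huc, hct, hs⟩ := inf_count hℓ.two_le hK
  have hcl : Nat.card (ClassGroup (𝓞 k)) ≠ 0 := Nat.card_pos.ne'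
  have hspos : 0 < Fintype.card (InfinitePlace k) := Fintype.card_pos
  have hr := rank_ker_sU g hg
  have he : Fintype.card (InfinitePlace k) - 1 + (ℓ - 1) * u ≤ Module.finrank ℤ (Additive (𝓞 K)ˣ) := by
    rw [Units.finrank_eq]
    change _ ≤ Fintype.card (InfinitePlace K) - 1
    have : u * ℓ = (ℓ - 1) * u + u := by
      obtain ⟨m, rfl⟩ : ∃ m, ℓ = m + 1 := ⟨ℓ - 1, by have := hℓ.pos; omega⟩
      simp only [Nat.add_sub_cancel]; ring
    omega
  have hb := abs_bound ℓ hℓ (toPrincipalIdeal (𝓞 K) K) (ClassGroup.mk K) q_surj q_ker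
    (Units.map (algebraMap (𝓞 K) K : 𝓞 K →* K)) iota_inj iota_range (sM g) (sI g) (sC g) (sU g)
    (sU_iota g) (sI_d g) (q_sI g) (fun x => sM_per g ℓ x hgl) (fun x => sI_iter g ℓ x hgl) (fun x => sU_per g ℓ x hgl)
    (h90 hℓ.pos hc g hg) (jI k K).range hJ1 hJF _ _ hR hR0 hh.le (by rw [hh]; exact hcl) _ u hr he
  have h1 : ℓ ^ (Fintype.card (InfinitePlace k) - 1) * ℓ = ℓ ^ u * ℓ ^ c := by
    rw [← pow_succ, ← pow_add]; congr 1; omega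
  have hu : 0 < ℓ ^ u := pow_pos hℓ.pos _
  have h2 : ℓ ^ u * (ℓ * Nat.card (Dh (sC g)).ker) ≤ ℓ ^ u * (ℓ ^ c * ℓ ^ (Ram k K).ncard * Nat.card (ClassGroup (𝓞 k))) := by
    calc ℓ ^ u * (ℓ * Nat.card (Dh (sC g)).ker) = ℓ * (ℓ ^ u * Nat.card (Dh (sC g)).ker) := by ring
      _ ≤ ℓ * (ℓ ^ (Fintype.card (InfinitePlace k) - 1) * ℓ ^ (Ram k K).ncard * Nat.card (ClassGroup (𝓞 k))) := Nat.mul_le_mul_left _ hb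
      _ = (ℓ ^ (Fintype.card (InfinitePlace k) - 1) * ℓ) * ℓ ^ (Ram k K).ncard * Nat.card (ClassGroup (𝓞 k)) := by ring
      _ = _ := by rw [h1]; ring
  refine (Nat.le_of_mul_le_mul_left h2 hu).trans ?_
  rw [← pow_add, add_comm c]
  have := Nat.pow_le_pow_right hℓ.pos (Nat.add_le_add_left hct (Ram k K).ncard)
  exact Nat.mul_le_mul_right _ this

end
end GenusRank

namespace GenusRank
open Filter Topology nonZeroDivisors
open scoped Pointwise

section

lemma card_eq_map_ker {A B : Type*} [CommGroup A] [Finite A] [CommGroup B] (f : A →* B) (H : Subgroup A) :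
    Nat.card H = Nat.card (H.map f) * Nat.card (f.ker ⊓ H : Subgroup A) := by
  rw [← Subgroup.relIndex_ker, ← Subgroup.relIndex_bot_left, ← Subgroup.relIndex_bot_left,
    ← Subgroup.inf_relIndex_right f.ker H, mul_comm]
  exact (Subgroup.relIndex_mul_relIndex ⊥ (f.ker ⊓ H) H bot_le inf_le_right).symm

lemma filt {A : Type*} [CommGroup A] [Finite A] (T : A →* A) (n : ℕ) (h : ∀ a, T^[n] a = 1) :
    Nat.card A ≤ T.range.index ^ n := by
  rw [Subgroup.index_range]
  suffices H : ∀ n (U : Subgroup A), (∀ a ∈ U, T^[n] a = 1) → Nat.card U ≤ Nat.card T.ker ^ n by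
    have := H n ⊤ (fun a _ => h a)
    rwa [Subgroup.card_top] at this
  intro n
  induction n with
  | zero =>
    intro U hU
    have : U = ⊥ := by
      rw [eq_bot_iff]; intro a ha; exact hU a ha
    rw [this]; simp
  | succ n ih =>
    intro U hU
    rw [card_eq_map_ker T U, pow_succ]
    refine Nat.mul_le_mul (ih _ ?_) ?_
    · rintro _ ⟨a, ha, rfl⟩
      have := hU a ha
      rwa [Function.iterate_succ_apply] at this
    · exact Nat.le_of_dvd Nat.card_pos (Subgroup.card_dvd_of_le inf_le_left)

lemma nilp {V : Type*} [CommGroup V] {ℓ : ℕ} (hℓ : ℓ.Prime) (hV : ∀ v : V, v ^ ℓ = 1) (s : V →* V)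
    (hs : ∀ v, s^[ℓ] v = v) (v : V) : (Dh s)^[ℓ] v = 1 := by
  let E : (V →* V) → AddMonoid.End (Additive V) := fun f => f.toAdditive
  have hcoe : ∀ (f : V →* V) (n : ℕ) (v : V), (E f ^ n) (Additive.ofMul v) = Additive.ofMul (f^[n] v) := by
    intro f n
    induction n with
    | zero => intro v; rfl
    | succ n ih =>
      intro v
      rw [pow_succ, Function.iterate_succ_apply]
      exact ih (f v)
  set S : AddMonoid.End (Additive V) := E s with hS
  set T : AddMonoid.End (Additive V) := E (Dh s) with hT
  have hST : T + 1 = S := by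
    ext x
    change Additive.ofMul (Dh s x.toMul * x.toMul) = Additive.ofMul (s x.toMul)
    rw [Dh_apply, div_mul_cancel]
  have hS1 : S ^ ℓ = 1 := by
    ext x
    change (S ^ ℓ) (Additive.ofMul x.toMul) = x
    rw [hcoe, hs]; rfl
  have hl : ((ℓ : ℕ) : AddMonoid.End (Additive V)) = 0 := by
    ext x
    rw [AddMonoid.End.natCast_apply]
    exact congrArg Additive.ofMul (hV x.toMul)
  obtain ⟨r, hr⟩ := (Commute.one_right T).exists_add_pow_prime_eq hℓ
  rw [hST, hS1, hl, one_pow, mul_assoc, mul_assoc, zero_mul, add_zero] at hr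
  have hT0 : T ^ ℓ = 0 := by
    have := hr
    exact (add_eq_right.1 this.symm)
  have := hcoe (Dh s) ℓ v
  rw [← hT, hT0] at this
  exact this.symm

/-- `|C/ℓ| ≤ |W/ℓ|^ℓ` where `W = C/(σ-1)`. -/
lemma step_c {C : Type*} [CommGroup C] [Finite C] {ℓ : ℕ} (hℓ : ℓ.Prime) (σ : C →* C) (hs : ∀ v, σ^[ℓ] v = v) :
    Nat.card (C ⧸ (powMonoidHom ℓ : C →* C).range) ≤
      ((powMonoidHom ℓ : C ⧸ (Dh σ).range →* C ⧸ (Dh σ).range).range.index) ^ ℓ := by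
  set P := (powMonoidHom ℓ : C →* C).range with hP
  have hPs : P ≤ P.comap σ := by
    rintro _ ⟨a, rfl⟩
    exact ⟨σ a, by simp⟩
  set s : C ⧸ P →* C ⧸ P := QuotientGroup.map P P σ hPs with hsdef
  have hsm : ∀ a : C, s (a : C ⧸ P) = ((σ a : C) : C ⧸ P) := fun a => rfl
  have h1 := filt (Dh s) ℓ (nilp hℓ (by
    intro v
    obtain ⟨a, rfl⟩ := QuotientGroup.mk_surjective v
    rw [← QuotientGroup.mk_pow, QuotientGroup.eq_one_iff]
    exact ⟨a, rfl⟩) s (by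
    intro v
    obtain ⟨a, rfl⟩ := QuotientGroup.mk_surjective v
    have hsc : Function.Semiconj (fun a : C => (a : C ⧸ P)) σ s := fun a => (hsm a).symm
    have := hsc.iterate_right ℓ a
    change ((σ^[ℓ] a : C) : C ⧸ P) = s^[ℓ] (a : C ⧸ P) at this
    rw [← this, hs]))
  refine h1.trans (le_of_eq ?_)
  congr 1
  have e1 : (Dh s).range.comap (QuotientGroup.mk' P) = (Dh σ).range ⊔ P := by
    have : (Dh s).range = (Dh σ).range.map (QuotientGroup.mk' P) := by
      ext x
      constructor
      · rintro ⟨y, rfl⟩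
        obtain ⟨a, rfl⟩ := QuotientGroup.mk_surjective y
        refine ⟨Dh σ a, ⟨a, rfl⟩, ?_⟩
        rw [Dh_apply, Dh_apply, hsm]; rfl
      · rintro ⟨_, ⟨a, rfl⟩, rfl⟩
        refine ⟨(a : C ⧸ P), ?_⟩
        rw [Dh_apply, Dh_apply, hsm]; rfl
    rw [this, Subgroup.comap_map_eq, QuotientGroup.ker_mk']
  have e2 : ((powMonoidHom ℓ : C ⧸ (Dh σ).range →* C ⧸ (Dh σ).range).range).comap (QuotientGroup.mk' (Dh σ).range) = P ⊔ (Dh σ).range := by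
    have : (powMonoidHom ℓ : C ⧸ (Dh σ).range →* C ⧸ (Dh σ).range).range = P.map (QuotientGroup.mk' (Dh σ).range) := by
      ext x
      constructor
      · rintro ⟨y, rfl⟩
        obtain ⟨a, rfl⟩ := QuotientGroup.mk_surjective y
        exact ⟨a ^ ℓ, ⟨a, rfl⟩, rfl⟩
      · rintro ⟨_, ⟨a, rfl⟩, rfl⟩
        exact ⟨(a : C ⧸ (Dh σ).range), rfl⟩
    rw [this, Subgroup.comap_map_eq, QuotientGroup.ker_mk']
  rw [← Subgroup.index_comap_of_surjective _ (QuotientGroup.mk'_surjective P), e1,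
    ← Subgroup.index_comap_of_surjective _ (QuotientGroup.mk'_surjective (Dh σ).range), e2, sup_comm]

lemma step_d {W B : Type*} [CommGroup W] [Finite W] [CommGroup B] [Finite B] (N : W →* B) (ℓ : ℕ) :
    (powMonoidHom ℓ : W →* W).range.index * Nat.card N.range ≤
      Nat.card W * (powMonoidHom ℓ : B →* B).range.index := by
  rw [Subgroup.index_range, Subgroup.index_range]
  have h1 := card_eq_map_ker N (powMonoidHom ℓ : W →* W).ker
  have h2 := card_eq_map_ker N ⊤
  rw [Subgroup.card_top, ← MonoidHom.range_eq_map, inf_top_eq] at h2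
  have h3 : Nat.card ((powMonoidHom ℓ : W →* W).ker.map N) ≤ Nat.card (powMonoidHom ℓ : B →* B).ker := by
    refine Nat.le_of_dvd Nat.card_pos (Subgroup.card_dvd_of_le ?_)
    rintro _ ⟨a, ha, rfl⟩
    have ha' : a ^ ℓ = 1 := ha
    change (N a) ^ ℓ = 1
    rw [← map_pow, ha', map_one]
  have h4 : Nat.card (N.ker ⊓ (powMonoidHom ℓ : W →* W).ker : Subgroup W) ≤ Nat.card N.ker :=
    Nat.le_of_dvd Nat.card_pos (Subgroup.card_dvd_of_le inf_le_left)
  calc _ ≤ (Nat.card (powMonoidHom ℓ : B →* B).ker * Nat.card N.ker) * Nat.card N.range := by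
        rw [h1]; exact Nat.mul_le_mul_right _ (Nat.mul_le_mul h3 h4)
    _ = _ := by rw [h2]; ring

end

section
variable {k K : Type*} [Field k] [NumberField k] [Field K] [NumberField K] [Algebra k K]

lemma sC_iter (g : K ≃ₐ[k] K) (n : ℕ) (hg : g ^ n = 1) (c : ClassGroup (𝓞 K)) : (sC g)^[n] c = c := by
  have h2 : ∀ n (J : Ideal (𝓞 K)), J ≠ ⊥ → (sC g)^[n] (cl J) = cl (g ^ n • J) := by
    intro n
    induction n with
    | zero => intro J _; simp
    | succ n ih =>
      intro J hJ
      rw [Function.iterate_succ_apply, sC_cl g hJ, ih _ (smul_ne_bot g hJ), smul_smul, pow_succ]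
  obtain ⟨I, hI, rfl⟩ := cl_surj c
  rw [h2 n I hI, hg, one_smul]

lemma clNorm_sC [IsGalois k K] (g : K ≃ₐ[k] K) (c : ClassGroup (𝓞 K)) : clNorm k K (sC g c) = clNorm k K c := by
  obtain ⟨I, hI, rfl⟩ := cl_surj c
  rw [sC_cl g hI, clNorm_cl _ (smul_ne_bot g hI), clNorm_cl _ hI]
  congr 1
  exact Ideal.relNorm_smul (𝓞 k) g I

theorem final_ineq [IsGalois k K] {ℓ : ℕ} (hℓ : ℓ.Prime) (hK : Module.finrank k K = ℓ)
    (g : K ≃ₐ[k] K) (hg : ∀ h, h ∈ Subgroup.zpowers g) :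
    ℓ * (powMonoidHom ℓ : ClassGroup (𝓞 K) ⧸ (Dh (sC g)).range →* ClassGroup (𝓞 K) ⧸ (Dh (sC g)).range).range.index
     ≤ Nat.card (ClassGroup (𝓞 k) ⧸ NCl k K) * ℓ ^ ((Ram k K).ncard + (InfRam k K).ncard) *
       Nat.card (ClassGroup (𝓞 k) ⧸ (powMonoidHom ℓ : ClassGroup (𝓞 k) →* ClassGroup (𝓞 k)).range) := by
  have hle : (Dh (sC g)).range ≤ (clNorm k K).ker := by
    rintro _ ⟨a, rfl⟩
    rw [MonoidHom.mem_ker, Dh_apply, map_div, clNorm_sC, div_self']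
  set N : ClassGroup (𝓞 K) ⧸ (Dh (sC g)).range →* ClassGroup (𝓞 k) := QuotientGroup.lift _ (clNorm k K) hle with hN
  have hNr : N.range = NCl k K := by
    ext x
    constructor
    · rintro ⟨y, rfl⟩
      obtain ⟨a, rfl⟩ := QuotientGroup.mk_surjective y
      exact ⟨a, rfl⟩
    · rintro ⟨a, rfl⟩
      exact ⟨(a : _ ⧸ _), rfl⟩
  have hd := step_d N ℓ
  rw [hNr] at hd
  have hW : Nat.card (ClassGroup (𝓞 K) ⧸ (Dh (sC g)).range) = Nat.card (Dh (sC g)).ker := by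
    rw [← Subgroup.index_range]; rfl
  have ha := ambig_bound hℓ hK g hg
  rw [← hW] at ha
  have hh : Nat.card (ClassGroup (𝓞 k)) = Nat.card (ClassGroup (𝓞 k) ⧸ NCl k K) * Nat.card (NCl k K) :=
    Subgroup.card_eq_card_quotient_mul_card_subgroup _
  have hpos : 0 < Nat.card (NCl k K) := Nat.card_pos
  refine Nat.le_of_mul_le_mul_right ?_ hpos
  set X := (powMonoidHom ℓ : ClassGroup (𝓞 K) ⧸ (Dh (sC g)).range →* ClassGroup (𝓞 K) ⧸ (Dh (sC g)).range).range.index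
  change X * _ ≤ _ * Nat.card (ClassGroup (𝓞 k) ⧸ (powMonoidHom ℓ : ClassGroup (𝓞 k) →* ClassGroup (𝓞 k)).range) at hd
  set r := Nat.card (ClassGroup (𝓞 k) ⧸ (powMonoidHom ℓ : ClassGroup (𝓞 k) →* ClassGroup (𝓞 k)).range)
  set w := Nat.card (ClassGroup (𝓞 K) ⧸ (Dh (sC g)).range)
  calc ℓ * X * Nat.card (NCl k K) = ℓ * (X * Nat.card (NCl k K)) := by ring
    _ ≤ ℓ * (w * r) := Nat.mul_le_mul_left _ hd
    _ = (ℓ * w) * r := by ring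
    _ ≤ _ := Nat.mul_le_mul_right _ ha
    _ = _ := by rw [hh]; ring

lemma card_mod_pow {G : Type*} [CommGroup G] [Finite G] {ℓ : ℕ} (hℓ : ℓ.Prime) :
    ∃ r, Nat.card (G ⧸ (powMonoidHom ℓ : G →* G).range) = ℓ ^ r := by
  haveI := Fact.mk hℓ
  have : IsPGroup ℓ (G ⧸ (powMonoidHom ℓ : G →* G).range) := by
    intro v
    obtain ⟨a, rfl⟩ := QuotientGroup.mk_surjective v
    refine ⟨1, ?_⟩
    rw [← QuotientGroup.mk_pow, QuotientGroup.eq_one_iff, pow_one]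
    exact ⟨a, rfl⟩
  exact IsPGroup.iff_card.1 this

theorem final_card [IsGalois k K] {ℓ : ℕ} (hℓ : ℓ.Prime) (hK : Module.finrank k K = ℓ)
    (g : K ≃ₐ[k] K) (hg : ∀ h, h ∈ Subgroup.zpowers g) (r : ℕ)
    (hr : Nat.card (ClassGroup (𝓞 k) ⧸ (powMonoidHom ℓ : ClassGroup (𝓞 k) →* ClassGroup (𝓞 k)).range) = ℓ ^ r) :
    Nat.card (ClassGroup (𝓞 K) ⧸ (powMonoidHom ℓ : ClassGroup (𝓞 K) →* ClassGroup (𝓞 K)).range) ≤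
      ℓ ^ (ℓ * (r + ((Ram k K).ncard + (InfRam k K).ncard - 1))) := by
  have hc : Nat.card (K ≃ₐ[k] K) = ℓ := by rw [IsGalois.card_aut_eq_finrank, hK]
  have hgl : g ^ ℓ = 1 := by rw [← hc, pow_card_eq_one']
  have h1 := step_c hℓ (sC g) (sC_iter g ℓ hgl)
  have h2 := final_ineq hℓ hK g hg
  rw [hr] at h2
  refine h1.trans ?_
  rw [mul_comm ℓ, pow_mul]
  refine Nat.pow_le_pow_left ?_ _
  refine Nat.le_of_mul_le_mul_left (h2.trans ?_) hℓ.pos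
  rw [← pow_succ']
  rcases Nat.eq_zero_or_pos ((Ram k K).ncard + (InfRam k K).ncard) with h0 | h0
  · rw [h0, pow_zero, mul_one, Nat.zero_sub, add_zero, pow_succ']
    exact Nat.mul_le_mul_right _ ((index_le k K).trans hK.le)
  · have htop : NCl k K = ⊤ := by
      rcases Nat.eq_zero_or_pos (Ram k K).ncard with h | h
      · have h' : 0 < (InfRam k K).ncard := by omega
        obtain ⟨v, hv, w, hw, hwc⟩ := Set.nonempty_of_ncard_ne_zero h'.ne'
        exact NCl_top_of_inf hℓ hK v hv w hw hwc
      · exact NCl_top_of_ram hℓ hK (Set.nonempty_of_ncard_ne_zero h.ne')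
    have : Nat.card (ClassGroup (𝓞 k) ⧸ NCl k K) = 1 := by
      change (NCl k K).index = 1
      rw [htop, Subgroup.index_top]
    rw [this, one_mul, ← pow_add]
    exact Nat.pow_le_pow_right hℓ.pos (by omega)

end
end GenusRank

/-- Rosen, relative genus theory. Let `ℓ` be a prime and `K/k` a Galois
extension of number fields with `Gal(K/k)` cyclic of order `ℓ`. Let `t` be the number of
primes of `k`, finite or infinite, which ramify in `K` (a finite prime ramifies if some
prime above it has ramification index `> 1`; a real place ramifies if some place of `K`
above it is complex). Then
`rank_{ℤ/ℓℤ}(Cl_K/ℓCl_K) ≤ ℓ·(rank_{ℤ/ℓℤ}(Cl_k/ℓCl_k) + max{0, t − 1})`. -/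
theorem ellRank_classGroup_le (ℓ : ℕ) (hℓ : ℓ.Prime)
    (k K : Type*) [Field k] [NumberField k] [Field K] [NumberField K]
    [Algebra k K] [IsGalois k K]
    (hcyc : IsCyclic (K ≃ₐ[k] K)) (hdeg : Nat.card (K ≃ₐ[k] K) = ℓ)
    (t : ℕ)
    (ht : t = ({v : HeightOneSpectrum (𝓞 k) | ∃ Q : Ideal (𝓞 K), Q.IsPrime ∧ Q ≠ ⊥ ∧
            Q ^ 2 ∣ Ideal.map (algebraMap (𝓞 k) (𝓞 K)) v.asIdeal}.ncard
          + {v : InfinitePlace k | v.IsReal ∧ ∃ w : InfinitePlace K,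
              w.comap (algebraMap k K) = v ∧ w.IsComplex}.ncard)) :
    ellRank ℓ (ClassGroup (𝓞 K)) ≤ ℓ * (ellRank ℓ (ClassGroup (𝓞 k)) + (t - 1)) := by
  obtain ⟨g, hg⟩ := hcyc.exists_generator
  have hK : Module.finrank k K = ℓ := by rw [← IsGalois.card_aut_eq_finrank, hdeg]
  obtain ⟨r, hr⟩ := GenusRank.card_mod_pow (G := ClassGroup (𝓞 k)) hℓ
  have hrk : ellRank ℓ (ClassGroup (𝓞 k)) = r := by
    unfold ellRank
    rw [hr, Nat.log_pow hℓ.one_lt]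
  have h := GenusRank.final_card hℓ hK g hg r hr
  have ht' : t = (GenusRank.Ram k K).ncard + (GenusRank.InfRam k K).ncard := ht
  rw [hrk, ht']
  unfold ellRank
  refine (Nat.log_mono_right h).trans ?_
  rw [Nat.log_pow hℓ.one_lt]
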